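/- arXiv:1602.06894 — 2 statements merged into one kernel-verified Lean document; each statement's English description precedes it below -/
import Mathlib

section
/- Let P be a d-dimensional polytope with exactly d+4 vertices that is not a pyramid over any polytope. Then P has exactly d+2 facets if and only if P is combinatorially equivalent to the product Δ_1 × Δ_3 (in particular d = 4). -/
open Set

noncomputable section

/-- A polytope: the convex hull of a finite set of points. -/
def IsPolytope {N : ℕ} (P : Set (Fin N → ℝ)) : Prop :=
  ∃ S : Finset (Fin N → ℝ), P = convexHull ℝ (S : Set (Fin N → ℝ))

/-- Dimension of a set: the dimension of its affine hull (with `-1` for the empty set). -/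
def pdim {N : ℕ} (P : Set (Fin N → ℝ)) : ℤ :=
  haveI := Classical.dec P.Nonempty
  if P.Nonempty then (Module.finrank ℝ (affineSpan ℝ P).direction : ℤ) else -1

/-- `F` is a face of `P`: the subset of `P` where some linear functional bounded above on `P`
attains its maximum value.  This includes `∅` and `P` itself. -/
def IsFaceOf {N : ℕ} (F P : Set (Fin N → ℝ)) : Prop :=
  ∃ (c : Fin N → ℝ) (b : ℝ),
    (∀ x ∈ P, ∑ i, c i * x i ≤ b) ∧ F = {x ∈ P | ∑ i, c i * x i = b}

/-- A facet: a face of dimension one less than the polytope. -/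
def IsFacetOf {N : ℕ} (F P : Set (Fin N → ℝ)) : Prop :=
  IsFaceOf F P ∧ pdim F + 1 = pdim P

/-- A ridge: a face of dimension two less than the polytope. -/
def IsRidgeOf {N : ℕ} (F P : Set (Fin N → ℝ)) : Prop :=
  IsFaceOf F P ∧ pdim F + 2 = pdim P

def IsVertexOf {N : ℕ} (v : Fin N → ℝ) (P : Set (Fin N → ℝ)) : Prop :=
  IsFaceOf {v} P

def vertexSet {N : ℕ} (P : Set (Fin N → ℝ)) : Set (Fin N → ℝ) :=
  {v | IsVertexOf v P}

def vertexCount {N : ℕ} (P : Set (Fin N → ℝ)) : ℕ := (vertexSet P).ncard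

def facetCount {N : ℕ} (P : Set (Fin N → ℝ)) : ℕ := {F | IsFacetOf F P}.ncard

/-- Extension complexity: the minimal number of facets of a polytope (in any dimension)
admitting an affine projection onto `P`. -/
def xc {N : ℕ} (P : Set (Fin N → ℝ)) : ℕ :=
  sInf {n | ∃ (e : ℕ) (Q : Set (Fin e → ℝ)) (π : (Fin e → ℝ) →ᵃ[ℝ] (Fin N → ℝ)),
    IsPolytope Q ∧ π '' Q = P ∧ facetCount Q = n}

/-- Combinatorial equivalence: an inclusion-preserving bijection between face lattices. -/
def CombEquiv {M N : ℕ} (P : Set (Fin M → ℝ)) (Q : Set (Fin N → ℝ)) : Prop :=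
  ∃ φ : {F : Set (Fin M → ℝ) // IsFaceOf F P} ≃ {G : Set (Fin N → ℝ) // IsFaceOf G Q},
    ∀ F₁ F₂ : {F : Set (Fin M → ℝ) // IsFaceOf F P},
      F₁.1 ⊆ F₂.1 ↔ (φ F₁).1 ⊆ (φ F₂).1

/-- A full-dimensional `n`-simplex in `ℝ^n` with the origin in its (relative) interior. -/
def simplexF (n : ℕ) : Set (Fin n → ℝ) :=
  convexHull ℝ ((Set.range fun i : Fin n => Pi.single i (1 : ℝ)) ∪ {fun _ => -1})

/-- The Cartesian product `Δ_n × Δ_m`, realized in `ℝ^{n+m}`. -/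
def prodP (n m : ℕ) : Set (Fin (n + m) → ℝ) :=
  {z | ∃ a ∈ simplexF n, ∃ b ∈ simplexF m, z = Fin.append a b}

/-- The direct sum `Δ_n ⊕ Δ_m`, realized in `ℝ^{n+m}`. -/
def sumP (n m : ℕ) : Set (Fin (n + m) → ℝ) :=
  convexHull ℝ (((fun a : Fin n → ℝ => Fin.append a (0 : Fin m → ℝ)) '' simplexF n) ∪
    ((fun b : Fin m → ℝ => Fin.append (0 : Fin n → ℝ) b) '' simplexF m))

/-- The join `A ⋆ B` of two polytopes, realized in `ℝ^{p+q+1}` with the two copies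
placed in skew affine subspaces. -/
def joinP {p q : ℕ} (A : Set (Fin p → ℝ)) (B : Set (Fin q → ℝ)) :
    Set (Fin (p + q + 1) → ℝ) :=
  convexHull ℝ
    (((fun a : Fin p → ℝ =>
        Fin.append (Fin.append a (0 : Fin q → ℝ)) (fun _ : Fin 1 => (0 : ℝ))) '' A) ∪
     ((fun b : Fin q → ℝ =>
        Fin.append (Fin.append (0 : Fin p → ℝ) b) (fun _ : Fin 1 => (1 : ℝ))) '' B))

/-- The canonical `k`-fold iterated pyramid over `X`, realized in `ℝ^{p+k}`. -/
def pyrK {p : ℕ} (k : ℕ) (X : Set (Fin p → ℝ)) : Set (Fin (p + k) → ℝ) :=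
  convexHull ℝ (((fun x : Fin p → ℝ => Fin.append x (0 : Fin k → ℝ)) '' X) ∪
    Set.range (fun j : Fin k => Fin.append (0 : Fin p → ℝ) (Pi.single j (1 : ℝ))))

/-- Transport a subset of `ℝ^a` to `ℝ^b` along a proof that `a = b`. -/
def castSet {a b : ℕ} (h : a = b) (X : Set (Fin a → ℝ)) : Set (Fin b → ℝ) :=
  (fun x : Fin a → ℝ => fun i : Fin b => x (Fin.cast h.symm i)) '' X

/-- Projective equivalence of two subsets of `ℝ^N`: `Q` is the image of `P` under a
projective transformation `x ↦ (A x + b) / (⟨c, x⟩ + δ)` whose associated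
`(N+1) × (N+1)` matrix is invertible and whose denominator is positive on `P`. -/
def ProjEquiv {N : ℕ} (P Q : Set (Fin N → ℝ)) : Prop :=
  ∃ (A : (Fin N → ℝ) →ₗ[ℝ] (Fin N → ℝ)) (b c : Fin N → ℝ) (δ : ℝ),
    Function.Bijective
      (fun z : (Fin N → ℝ) × ℝ => (A z.1 + z.2 • b, (∑ i, c i * z.1 i) + δ * z.2)) ∧
    (∀ x ∈ P, 0 < (∑ i, c i * x i) + δ) ∧
    Q = (fun x : Fin N → ℝ => ((∑ i, c i * x i) + δ)⁻¹ • (A x + b)) '' P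

/-- `P` is a pyramid with base `B`: the convex hull of `B` and a point outside
the affine hull of `B`. -/
def IsPyramidOver {N : ℕ} (P B : Set (Fin N → ℝ)) : Prop :=
  ∃ a : Fin N → ℝ, a ∉ affineSpan ℝ B ∧ P = convexHull ℝ (B ∪ {a})

/-- `P` is a `k`-fold iterated pyramid over `B`. -/
def IsKFoldPyramidOver {N : ℕ} : ℕ → Set (Fin N → ℝ) → Set (Fin N → ℝ) → Prop
  | 0, P, B => P = B
  | k + 1, P, B => ∃ P' : Set (Fin N → ℝ), IsPyramidOver P P' ∧ IsKFoldPyramidOver k P' B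

/-- `P` is a pyramid: the convex hull of one of its facets together with one more vertex. -/
def IsPyramidPolytope {N : ℕ} (P : Set (Fin N → ℝ)) : Prop :=
  ∃ (F : Set (Fin N → ℝ)) (v : Fin N → ℝ),
    IsFacetOf F P ∧ IsVertexOf v P ∧ P = convexHull ℝ (F ∪ {v})

/-- A facet is pyramidal if it contains all vertices of the polytope but one. -/
def IsPyramidalFacet {N : ℕ} (F P : Set (Fin N → ℝ)) : Prop :=
  IsFacetOf F P ∧ ∃ v, IsVertexOf v P ∧ v ∉ F ∧ ∀ w, IsVertexOf w P → w ≠ v → w ∈ F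

/-- The projection `π_d : ℝ^{d+1} → ℝ^d` forgetting the last coordinate. -/
def projFun (d : ℕ) : (Fin (d + 1) → ℝ) → (Fin d → ℝ) :=
  fun x i => x i.castSucc

/-- `c` is an outer normal vector exposing the face `F` of `Q`. -/
def IsOuterNormal {N : ℕ} (Q F : Set (Fin N → ℝ)) (c : Fin N → ℝ) : Prop :=
  ∃ b : ℝ, (∀ x ∈ Q, ∑ i, c i * x i ≤ b) ∧ F = {x ∈ Q | ∑ i, c i * x i = b}

/-- An upper facet: outer normal with positive last coordinate. -/
def IsUpperFacet {d : ℕ} (F Q : Set (Fin (d + 1) → ℝ)) : Prop :=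
  IsFacetOf F Q ∧ ∃ c, IsOuterNormal Q F c ∧ 0 < c (Fin.last d)

/-- A lower facet: outer normal with negative last coordinate. -/
def IsLowerFacet {d : ℕ} (F Q : Set (Fin (d + 1) → ℝ)) : Prop :=
  IsFacetOf F Q ∧ ∃ c, IsOuterNormal Q F c ∧ c (Fin.last d) < 0

/-- A vertical facet: every outer normal has vanishing last coordinate. -/
def IsVerticalFacet {d : ℕ} (F Q : Set (Fin (d + 1) → ℝ)) : Prop :=
  IsFacetOf F Q ∧ ∀ c, IsOuterNormal Q F c → c (Fin.last d) = 0

/-- An equatorial ridge: a ridge that is the intersection of an upper and a lower facet. -/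
def IsEquatorialRidge {d : ℕ} (F Q : Set (Fin (d + 1) → ℝ)) : Prop :=
  IsRidgeOf F Q ∧ ∃ F₁ F₂ : Set (Fin (d + 1) → ℝ),
    IsUpperFacet F₁ Q ∧ IsLowerFacet F₂ Q ∧ F = F₁ ∩ F₂

/-- A face `F` of `Q` is preserved under the projection forgetting the last coordinate. -/
def PreservedFace {d : ℕ} (Q F : Set (Fin (d + 1) → ℝ)) : Prop :=
  IsFaceOf (projFun d '' F) (projFun d '' Q) ∧ projFun d ⁻¹' (projFun d '' F) ∩ Q = F

/-- A face `F` of `Q` is strictly preserved: preserved and of the same dimension as its image. -/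
def StrictlyPreservedFace {d : ℕ} (Q F : Set (Fin (d + 1) → ℝ)) : Prop :=
  PreservedFace Q F ∧ pdim (projFun d '' F) = pdim F

/-- A hexagon: a 2-dimensional polytope with exactly 6 vertices. -/
def IsHexagon {N : ℕ} (P : Set (Fin N → ℝ)) : Prop :=
  IsPolytope P ∧ pdim P = 2 ∧ vertexCount P = 6

/-- Three lines are concurrent: they share a common point, or they are pairwise parallel. -/
def ConcurrentLines {N : ℕ} (L₁ L₂ L₃ : AffineSubspace ℝ (Fin N → ℝ)) : Prop :=
  (∃ x, x ∈ L₁ ∧ x ∈ L₂ ∧ x ∈ L₃) ∨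
    (AffineSubspace.Parallel L₁ L₂ ∧ AffineSubspace.Parallel L₂ L₃ ∧
      AffineSubspace.Parallel L₁ L₃)

/-- A cyclic labeling of the vertices of a hexagon: consecutive points are joined by edges. -/
def CyclicLabeling {N : ℕ} (P : Set (Fin N → ℝ)) (p : Fin 6 → (Fin N → ℝ)) : Prop :=
  Function.Injective p ∧ Set.range p = vertexSet P ∧
    ∀ i : Fin 6, IsFaceOf (segment ℝ (p i) (p (i + 1))) P

/-- A Desarguian hexagon. -/
def Desarguian {N : ℕ} (P : Set (Fin N → ℝ)) : Prop :=
  ∃ p : Fin 6 → (Fin N → ℝ), CyclicLabeling P p ∧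
    ConcurrentLines (affineSpan ℝ {p 0, p 1}) (affineSpan ℝ {p 5, p 2})
      (affineSpan ℝ {p 3, p 4})

/-- A polytope is simplicial if every facet is a simplex. -/
def IsSimplicial {N : ℕ} (P : Set (Fin N → ℝ)) : Prop :=
  ∀ F : Set (Fin N → ℝ), IsFacetOf F P →
    ∃ S : Finset (Fin N → ℝ),
      AffineIndependent ℝ (Subtype.val : {x // x ∈ S} → (Fin N → ℝ)) ∧
      F = convexHull ℝ (S : Set (Fin N → ℝ))

section Faces

variable {N M : ℕ} {P Q F G : Set (Fin N → ℝ)}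

theorem isFaceOf_iff_exists_affineMap :
    IsFaceOf F P ↔ ∃ ℓ : (Fin N → ℝ) →ᵃ[ℝ] ℝ, (∀ x ∈ P, 0 ≤ ℓ x) ∧ F = {x ∈ P | ℓ x = 0} := by
  constructor
  · rintro ⟨c, b, hb, rfl⟩
    have key : ∀ x, (AffineMap.const ℝ (Fin N → ℝ) b -
        (∑ i, c i • LinearMap.proj (R := ℝ) (φ := fun _ : Fin N => ℝ) i).toAffineMap) x
          = b - ∑ i, c i * x i := by
      intro x; simp
    refine ⟨AffineMap.const ℝ (Fin N → ℝ) b -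
      (∑ i, c i • LinearMap.proj (R := ℝ) (φ := fun _ : Fin N => ℝ) i).toAffineMap,
      fun x hx => ?_, ?_⟩
    · rw [key]; linarith [hb x hx]
    · ext x
      simp only [mem_ofPred_eq, key, sub_eq_zero]
      exact and_congr_right fun _ => eq_comm
  · rintro ⟨ℓ, h₀, rfl⟩
    have key : ∀ x, ∑ i, (-ℓ.linear (Pi.single i 1)) * x i = ℓ 0 - ℓ x := by
      intro x
      have h₁ : ℓ x = ℓ.linear x + ℓ 0 := congrFun ℓ.decomp x
      have h₂ : ℓ.linear x = ∑ i, x i * ℓ.linear (Pi.single i 1) := by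
        conv_lhs => rw [pi_eq_sum_univ' x]
        simp
      rw [h₁, h₂]
      simp [mul_comm]
    refine ⟨fun i => -ℓ.linear (Pi.single i 1), ℓ 0, fun x hx => ?_, ?_⟩
    · rw [key]; linarith [h₀ x hx]
    · ext x
      simp only [mem_ofPred_eq, key]
      exact and_congr_right fun _ => ⟨fun h => by linarith, fun h => by linarith⟩

theorem IsFaceOf.subset (h : IsFaceOf F P) : F ⊆ P := by
  obtain ⟨c, b, -, rfl⟩ := h
  exact fun x hx => hx.1

theorem isFaceOf_empty (P : Set (Fin N → ℝ)) : IsFaceOf ∅ P :=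
  isFaceOf_iff_exists_affineMap.2 ⟨AffineMap.const ℝ _ 1, by simp, by ext; simp⟩

theorem isFaceOf_self (P : Set (Fin N → ℝ)) : IsFaceOf P P :=
  isFaceOf_iff_exists_affineMap.2 ⟨0, by simp, by ext; simp⟩

/-- The face lattice of a polytope. -/
abbrev Face (P : Set (Fin N → ℝ)) := {F : Set (Fin N → ℝ) // IsFaceOf F P}

instance (P : Set (Fin N → ℝ)) : BoundedOrder (Face P) where
  top := ⟨P, isFaceOf_self P⟩
  le_top F := F.2.subset
  bot := ⟨∅, isFaceOf_empty P⟩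
  bot_le F := empty_subset F.1

theorem combEquiv_iff_nonempty_orderIso {P : Set (Fin M → ℝ)} {Q : Set (Fin N → ℝ)} :
    CombEquiv P Q ↔ Nonempty (Face P ≃o Face Q) :=
  ⟨fun ⟨φ, h⟩ => ⟨⟨φ, fun {F G} => (h F G).symm⟩⟩, fun ⟨φ⟩ => ⟨φ.toEquiv, fun _ _ =>
    φ.le_iff_le.symm⟩⟩

/-- The subset of `P` where all the functionals `ℓ k`, `k ∈ T`, vanish. -/
def commonZeros {κ : Type*} (P : Set (Fin N → ℝ)) (ℓ : κ → (Fin N → ℝ) →ᵃ[ℝ] ℝ) (T : Set κ) :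
    Set (Fin N → ℝ) :=
  {x ∈ P | ∀ k ∈ T, ℓ k x = 0}

theorem isFaceOf_commonZeros {κ : Type*} [Finite κ] {ℓ : κ → (Fin N → ℝ) →ᵃ[ℝ] ℝ}
    (h₀ : ∀ x ∈ P, ∀ k, 0 ≤ ℓ k x) (T : Set κ) : IsFaceOf (commonZeros P ℓ T) P := by
  classical
  have := Fintype.ofFinite κ
  have key : ∀ x, (∑ k ∈ T.toFinset, ℓ k) x = ∑ k ∈ T.toFinset, ℓ k x := by
    intro x
    induction T.toFinset using Finset.induction_on with
    | empty => simp
    | insert a s ha ih => simp [Finset.sum_insert ha, ih]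
  refine isFaceOf_iff_exists_affineMap.2 ⟨∑ k ∈ T.toFinset, ℓ k, fun x hx => ?_, ?_⟩
  · rw [key]; exact Finset.sum_nonneg fun k _ => h₀ x hx k
  · ext x
    refine and_congr_right fun hx => ?_
    rw [key, Finset.sum_eq_zero_iff_of_nonneg fun k _ => h₀ x hx k]
    simp

/-- A face of a convex hull is the convex hull of the generators it contains. -/
theorem IsFaceOf.eq_convexHull {S : Set (Fin N → ℝ)} (h : IsFaceOf F (convexHull ℝ S)) :
    F = convexHull ℝ (S ∩ F) := by
  obtain ⟨ℓ, h₀, rfl⟩ := isFaceOf_iff_exists_affineMap.1 h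
  apply Subset.antisymm
  · have hsub : convexHull ℝ S ⊆ {x | 0 < ℓ x} ∪
        convexHull ℝ (S ∩ {x ∈ convexHull ℝ S | ℓ x = 0}) := by
      apply convexHull_min
      · intro x hx
        have hx' := subset_convexHull ℝ S hx
        rcases (h₀ x hx').lt_or_eq with h | h
        · exact Or.inl h
        · exact Or.inr (subset_convexHull ℝ _ ⟨hx, hx', h.symm⟩)
      · have hz : ∀ x ∈ convexHull ℝ (S ∩ {x ∈ convexHull ℝ S | ℓ x = 0}), 0 ≤ ℓ x :=
          fun x hx => h₀ x (convexHull_mono inter_subset_left hx)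
        rw [convex_iff_pairwise_pos]
        intro x hx y hy _ a b ha hb hab
        have hc : ℓ (a • x + b • y) = a * ℓ x + b * ℓ y := by
          simpa using Convex.combo_affine_apply (f := ℓ) (x := x) (y := y) hab
        rcases hx with hx | hx
        · left
          have hy' : 0 ≤ ℓ y := by
            rcases hy with hy | hy
            exacts [le_of_lt hy, hz y hy]
          have hx' : 0 < ℓ x := hx
          simp only [mem_ofPred_eq, hc]
          positivity
        · rcases hy with hy | hy
          · left
            have hx' := hz x hx
            have hy' : 0 < ℓ y := hy
            simp only [mem_ofPred_eq, hc]
            positivity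
          · exact Or.inr (convex_convexHull ℝ _ hx hy ha.le hb.le hab)
    intro x hx
    rcases hsub hx.1 with h | h
    · exact absurd hx.2 (ne_of_gt h)
    · exact h
  · refine convexHull_min inter_subset_right ?_
    intro x hx y hy a b ha hb hab
    refine ⟨convex_convexHull ℝ S hx.1 hy.1 ha hb hab, ?_⟩
    rw [Convex.combo_affine_apply hab, hx.2, hy.2]
    simp

theorem IsVertexOf.mem {v : Fin N → ℝ} (h : IsVertexOf v P) : v ∈ P :=
  IsFaceOf.subset h rfl

theorem IsVertexOf.mem_of_convexHull {S : Set (Fin N → ℝ)} {v : Fin N → ℝ}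
    (h : IsVertexOf v (convexHull ℝ S)) : v ∈ S := by
  have h₁ := IsFaceOf.eq_convexHull h
  have h₂ : (S ∩ {v}).Nonempty := by
    rw [← convexHull_nonempty_iff (𝕜 := ℝ), ← h₁]
    exact singleton_nonempty v
  obtain ⟨w, hw, rfl⟩ := h₂
  exact hw

theorem IsPolytope.isCompact (hP : IsPolytope P) : IsCompact P := by
  obtain ⟨S, rfl⟩ := hP
  exact S.finite_toSet.isCompact_convexHull ℝ

theorem IsPolytope.convex (hP : IsPolytope P) : Convex ℝ P := by
  obtain ⟨S, rfl⟩ := hP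
  exact convex_convexHull ℝ _

theorem IsPolytope.finite_vertexSet (hP : IsPolytope P) : (vertexSet P).Finite := by
  obtain ⟨S, rfl⟩ := hP
  exact S.finite_toSet.subset fun v hv => IsVertexOf.mem_of_convexHull hv

theorem exists_affineMap_of_notMem (hP : Convex ℝ P) (hc : IsClosed P) {x : Fin N → ℝ}
    (hx : x ∉ P) : ∃ ℓ : (Fin N → ℝ) →ᵃ[ℝ] ℝ, (∀ y ∈ P, 0 < ℓ y) ∧ ℓ x < 0 := by
  obtain ⟨f, u, hf, hu⟩ := geometric_hahn_banach_closed_point hP hc hx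
  refine ⟨AffineMap.const ℝ _ u - f.toLinearMap.toAffineMap, fun y hy => ?_, ?_⟩
  · simpa using hf y hy
  · simpa using hu

/-- A polytope is the convex hull of its vertices. -/
theorem IsPolytope.eq_convexHull_vertexSet (hP : IsPolytope P) :
    P = convexHull ℝ (vertexSet P) := by
  classical
  obtain ⟨S, hS⟩ := hP
  induction S using Finset.strongInduction with
  | H S ih =>
    by_cases hmin : ∃ s ∈ S, s ∈ convexHull ℝ ((S.erase s : Finset _) : Set (Fin N → ℝ))
    · obtain ⟨s, hs, hsc⟩ := hmin
      refine ih (S.erase s) (Finset.erase_ssubset hs) ?_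
      rw [hS]
      refine Subset.antisymm (convexHull_min (fun t ht => ?_) (convex_convexHull ℝ _))
        (convexHull_mono (by simp))
      by_cases hts : t = s
      · rwa [hts]
      · exact subset_convexHull ℝ _ (by simpa [hts] using ht)
    · push Not at hmin
      have hv : ∀ s ∈ S, IsVertexOf s P := by
        intro s hs
        obtain ⟨ℓ, h₁, h₂⟩ := exists_affineMap_of_notMem (convex_convexHull ℝ _)
          ((S.erase s).finite_toSet.isClosed_convexHull ℝ) (hmin s hs)
        obtain ⟨g, hg⟩ : ∃ g : (Fin N → ℝ) →ᵃ[ℝ] ℝ, ∀ t, g t = ℓ t - ℓ s :=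
          ⟨ℓ - AffineMap.const ℝ _ (ℓ s), fun t => by simp⟩
        have hpos : ∀ t ∈ S, t ≠ s → 0 < g t := by
          intro t ht hts
          have := h₁ t (subset_convexHull ℝ _ (by simpa [hts] using ht))
          rw [hg]
          linarith
        have h₀ : ∀ x ∈ P, 0 ≤ g x := by
          rw [hS]
          refine fun x hx => convexHull_min (t := {x | 0 ≤ g x})
            (fun t ht => ?_) ((convex_Ici (0 : ℝ)).affine_preimage g) hx
          by_cases hts : t = s
          · simp [hts, hg]
          · exact (hpos t ht hts).le
        have hF := isFaceOf_iff_exists_affineMap.2 ⟨_, h₀, rfl⟩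
        have hF' := hF
        rw [hS] at hF'
        have h₃ := hF'.eq_convexHull
        rw [← hS] at h₃
        have h₄ : (S : Set (Fin N → ℝ)) ∩ {x ∈ P | g x = 0} = {s} := by
          ext t
          constructor
          · rintro ⟨ht, -, h⟩
            by_contra hts
            exact (hpos t ht hts).ne' h
          · rintro rfl
            exact ⟨hs, hS ▸ subset_convexHull ℝ _ hs, by simp [hg]⟩
        rw [h₄, convexHull_singleton] at h₃
        rw [h₃] at hF
        exact hF
      apply Subset.antisymm
      · conv_lhs => rw [hS]
        exact convexHull_mono hv
      · refine convexHull_min (fun v hv => IsVertexOf.mem hv) ?_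
        rw [hS]; exact convex_convexHull ℝ _

theorem IsFaceOf.exists_vertex (hP : IsPolytope P) (hF : IsFaceOf F P) (hne : F.Nonempty) :
    ∃ v ∈ F, IsVertexOf v P := by
  rw [hP.eq_convexHull_vertexSet] at hF
  have h₁ := hF.eq_convexHull
  rw [h₁, convexHull_nonempty_iff] at hne
  obtain ⟨v, hv, hvF⟩ := hne
  exact ⟨v, hvF, hv⟩

theorem IsPolytope.finite_face (hP : IsPolytope P) : Finite (Face P) := by
  have hf : Finite (𝒫 (vertexSet P)) := (hP.finite_vertexSet.powerset).to_subtype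
  have h₁ : ∀ F : Face P, F.1 = convexHull ℝ (vertexSet P ∩ F.1) := by
    rintro ⟨F, hF⟩
    rw [hP.eq_convexHull_vertexSet] at hF
    exact hF.eq_convexHull
  refine Finite.of_injective
    (fun F : Face P => (⟨vertexSet P ∩ F.1, inter_subset_left⟩ : 𝒫 (vertexSet P))) ?_
  intro F G hFG
  have h₂ : vertexSet P ∩ F.1 = vertexSet P ∩ G.1 := congrArg Subtype.val hFG
  ext1
  rw [h₁ F, h₁ G, h₂]

theorem IsPolytope.vertexCount_eq_card_isAtom (hP : IsPolytope P) :
    vertexCount P = Nat.card {F : Face P // IsAtom F} := by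
  unfold vertexCount
  rw [← Nat.card_coe_set_eq]
  refine Nat.card_congr (Equiv.ofBijective
    (fun v : vertexSet P => (⟨⟨{v.1}, v.2⟩, ?_, ?_⟩ : {F : Face P // IsAtom F})) ⟨?_, ?_⟩)
  · intro h
    exact singleton_ne_empty v.1 (congrArg Subtype.val h)
  · intro F hF
    ext1
    rcases subset_singleton_iff_eq.1 hF.le with h | h
    · exact h
    · exact absurd (Subtype.ext h) hF.ne
  · intro v w h
    exact Subtype.ext (singleton_injective (congrArg (fun F => F.1.1) h))
  · rintro ⟨F, hF⟩
    have hne : F.1.Nonempty := nonempty_iff_ne_empty.2 fun h => hF.1 (Subtype.ext h)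
    obtain ⟨v, hv, hvP⟩ := F.2.exists_vertex hP hne
    refine ⟨⟨v, hvP⟩, Subtype.ext ?_⟩
    by_contra hne'
    have hlt : (⟨{v}, hvP⟩ : Face P) < F :=
      lt_of_le_of_ne (singleton_subset_iff.2 hv) hne'
    exact singleton_ne_empty v (congrArg Subtype.val (hF.2 _ hlt))

end Faces

section Facets

variable {N : ℕ} {P F G : Set (Fin N → ℝ)}

theorem pdim_of_nonempty (h : P.Nonempty) :
    pdim P = Module.finrank ℝ (affineSpan ℝ P).direction := by
  simp [pdim, h]

theorem Set.Nontrivial.direction_ne_bot (h : P.Nontrivial) :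
    (affineSpan ℝ P).direction ≠ ⊥ := by
  obtain ⟨x, hx, y, hy, hxy⟩ := h
  rw [Submodule.ne_bot_iff]
  exact ⟨x -ᵥ y, AffineSubspace.vsub_mem_direction (mem_affineSpan ℝ hx) (mem_affineSpan ℝ hy),
    by simpa [sub_eq_zero] using hxy⟩

/-- A polytope contains no ray. -/
theorem IsPolytope.eq_zero_of_ray (hP : IsPolytope P) {p v : Fin N → ℝ}
    (h : ∀ t : ℝ, 0 ≤ t → p + t • v ∈ P) : v = 0 := by
  by_contra hv
  obtain ⟨C, hC⟩ := hP.isCompact.isBounded.exists_norm_le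
  have hv' : 0 < ‖v‖ := norm_pos_iff.2 hv
  have hC0 : 0 ≤ C := (norm_nonneg _).trans (hC _ (h 0 le_rfl))
  have ht : 0 ≤ (C + ‖p‖ + 1) / ‖v‖ := by positivity
  have h₁ := hC _ (h _ ht)
  have h₂ : ‖((C + ‖p‖ + 1) / ‖v‖) • v‖ = C + ‖p‖ + 1 := by
    rw [norm_smul, Real.norm_of_nonneg ht, div_mul_cancel₀ _ hv'.ne']
  have h₃ := norm_sub_le (p + ((C + ‖p‖ + 1) / ‖v‖) • v) p
  rw [add_sub_cancel_left, h₂] at h₃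
  linarith

theorem IsFacetOf.nonempty (hF : IsFacetOf F P) (hnt : P.Nontrivial) : F.Nonempty := by
  by_contra h
  have h₁ := hF.2
  rw [pdim_of_nonempty hnt.nonempty, pdim, if_neg h] at h₁
  have h₂ : Module.finrank ℝ (affineSpan ℝ P).direction = 0 := by
    exact_mod_cast (by linarith : (Module.finrank ℝ (affineSpan ℝ P).direction : ℤ) = 0)
  exact hnt.direction_ne_bot (Submodule.finrank_eq_zero.1 h₂)

theorem IsFacetOf.ne (hF : IsFacetOf F P) : F ≠ P := by
  rintro rfl
  have := hF.2
  linarith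

theorem IsFacetOf.affineSpan_insert (hF : IsFacetOf F P) (hne : F.Nonempty) {q : Fin N → ℝ}
    (hq : q ∈ P) (hqF : q ∉ F) : affineSpan ℝ (insert q F) = affineSpan ℝ P := by
  obtain ⟨ℓ, -, hℓ⟩ := isFaceOf_iff_exists_affineMap.1 hF.1
  have hsub : insert q F ⊆ P := insert_subset hq hF.1.subset
  have hq' : q ∉ affineSpan ℝ F := by
    intro h
    have h₁ : EqOn ℓ (AffineMap.const ℝ (Fin N → ℝ) (0 : ℝ)) F := by
      intro x hx
      rw [hℓ] at hx
      exact hx.2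
    have h₂ := AffineMap.eqOn_affineSpan h₁ h
    exact hqF (hℓ ▸ ⟨hq, h₂⟩)
  have hlt : affineSpan ℝ F < affineSpan ℝ (insert q F) := by
    refine lt_of_le_of_ne (affineSpan_mono ℝ (subset_insert q F)) fun h => hq' ?_
    rw [h]
    exact mem_affineSpan ℝ (mem_insert q F)
  have h₁ := Submodule.finrank_lt_finrank_of_lt
    (AffineSubspace.direction_lt_of_nonempty hlt (hne.affineSpan ℝ))
  have h₂ := hF.2
  rw [pdim_of_nonempty hne, pdim_of_nonempty ⟨q, hq⟩] at h₂
  refine AffineSubspace.eq_of_direction_eq_of_nonempty_of_le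
    (Submodule.eq_of_le_of_finrank_le (AffineSubspace.direction_le (affineSpan_mono ℝ hsub)) ?_)
    ((insert_nonempty q F).affineSpan ℝ) (affineSpan_mono ℝ hsub)
  omega

/-- A linear functional bounded by `1` on a positively spanning family can be moved, without
decreasing its value at a given point, until it attains the bound on a spanning subfamily. -/
theorem exists_dual_span_active_eq_top {V ι : Type*} [AddCommGroup V] [Module ℝ V]
    [FiniteDimensional ℝ V] [Finite ι] (w : ι → V)
    (hpos : ∀ e : Module.Dual ℝ V, e ≠ 0 → ∃ i, 0 < e (w i)) (x : V)
    (g : Module.Dual ℝ V) (hg : ∀ i, g (w i) ≤ 1) :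
    ∃ g' : Module.Dual ℝ V, (∀ i, g' (w i) ≤ 1) ∧ g x ≤ g' x ∧
      Submodule.span ℝ (w '' {i | g' (w i) = 1}) = ⊤ := by
  classical
  have := Fintype.ofFinite ι
  induction hn : Module.finrank ℝ V - Module.finrank ℝ (Submodule.span ℝ (w '' {i | g (w i) = 1}))
    using Nat.strong_induction_on generalizing g with
  | _ n ih =>
    by_cases htop : Submodule.span ℝ (w '' {i | g (w i) = 1}) = ⊤
    · exact ⟨g, hg, le_rfl, htop⟩
    obtain ⟨f, hf, hfx, hker⟩ : ∃ f : Module.Dual ℝ V, f ≠ 0 ∧ 0 ≤ f x ∧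
        Submodule.span ℝ (w '' {i | g (w i) = 1}) ≤ LinearMap.ker f := by
      obtain ⟨f, hf, hker⟩ := Submodule.exists_le_ker_of_lt_top _ (lt_top_iff_ne_top.2 htop)
      rcases le_total 0 (f x) with h | h
      · exact ⟨f, hf, h, hker⟩
      · refine ⟨-f, neg_ne_zero.2 hf, by simpa using h, fun y hy => ?_⟩
        simpa using hker hy
    have hI : (Finset.univ.filter fun i => 0 < f (w i)).Nonempty := by
      obtain ⟨i, hi⟩ := hpos f hf
      exact ⟨i, by simpa using hi⟩
    obtain ⟨i₀, hi₀, hmin⟩ := Finset.exists_min_image _ (fun i => (1 - g (w i)) / f (w i)) hI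
    simp only [Finset.mem_filter, Finset.mem_univ, true_and] at hi₀ hmin
    set t := (1 - g (w i₀)) / f (w i₀) with ht
    have ht₀ : 0 ≤ t := div_nonneg (by linarith [hg i₀]) hi₀.le
    have hact : ∀ i, g (w i) = 1 → f (w i) = 0 := fun i hi =>
      hker (Submodule.subset_span ⟨i, hi, rfl⟩)
    have hg' : ∀ i, (g + t • f) (w i) ≤ 1 := by
      intro i
      simp only [LinearMap.add_apply, LinearMap.smul_apply, smul_eq_mul]
      rcases le_or_gt (f (w i)) 0 with h | h
      · nlinarith [hg i]
      · have := hmin i h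
        rw [le_div_iff₀ h] at this
        linarith
    have hi₀' : (g + t • f) (w i₀) = 1 := by
      simp only [LinearMap.add_apply, LinearMap.smul_apply, smul_eq_mul, ht]
      field_simp
      ring
    have hsub : w '' {i | g (w i) = 1} ⊆ w '' {i | (g + t • f) (w i) = 1} := by
      refine image_mono fun i (hi : g (w i) = 1) => ?_
      simp [hi, hact i hi]
    have hlt : Submodule.span ℝ (w '' {i | g (w i) = 1}) <
        Submodule.span ℝ (w '' {i | (g + t • f) (w i) = 1}) := by
      refine lt_of_le_of_ne (Submodule.span_mono hsub) fun h => hi₀.ne' (hker ?_)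
      rw [h]
      exact Submodule.subset_span ⟨i₀, hi₀', rfl⟩
    have h₁ := Submodule.finrank_lt_finrank_of_lt hlt
    have h₂ := Submodule.finrank_le (Submodule.span ℝ (w '' {i | (g + t • f) (w i) = 1}))
    obtain ⟨g', h₃, h₄, h₅⟩ := ih _ (by omega) (g + t • f) hg' rfl
    refine ⟨g', h₃, le_trans ?_ h₄, h₅⟩
    simp only [LinearMap.add_apply, LinearMap.smul_apply, smul_eq_mul]
    nlinarith

/-- A point of the affine hull outside a polytope is separated from it by a facet. -/
theorem IsPolytope.exists_isFacetOf_of_notMem (hP : IsPolytope P) (hnt : P.Nontrivial)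
    {x : Fin N → ℝ} (hx : x ∈ affineSpan ℝ P) (hxP : x ∉ P) :
    ∃ ℓ : (Fin N → ℝ) →ᵃ[ℝ] ℝ, (∀ y ∈ P, 0 ≤ ℓ y) ∧ ℓ x < 0 ∧ IsFacetOf {y ∈ P | ℓ y = 0} P := by
  classical
  obtain ⟨S, hS⟩ := id hP
  have hSP : ∀ s ∈ S, s ∈ P := fun s hs => hS ▸ subset_convexHull ℝ _ hs
  have hSne : S.Nonempty := by
    have := hnt.nonempty
    rw [hS, convexHull_nonempty_iff] at this
    exact_mod_cast this
  have hcard : (0 : ℝ) < S.card := by exact_mod_cast hSne.card_pos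
  obtain ⟨p, hpP, hp⟩ : ∃ p ∈ P, ∑ s ∈ S, s = (S.card : ℝ) • p := by
    refine ⟨∑ s ∈ S, (S.card : ℝ)⁻¹ • s, ?_, ?_⟩
    · rw [hS]
      refine (convex_convexHull ℝ _).sum_mem (fun _ _ => by positivity) ?_
        fun s hs => subset_convexHull ℝ _ hs
      rw [Finset.sum_const, nsmul_eq_mul, mul_inv_cancel₀ hcard.ne']
    · rw [← Finset.smul_sum, smul_smul, mul_inv_cancel₀ hcard.ne', one_smul]
  set V := (affineSpan ℝ P).direction with hV
  have hmem : ∀ y ∈ affineSpan ℝ P, y - p ∈ V := fun y hy =>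
    AffineSubspace.vsub_mem_direction hy (mem_affineSpan ℝ hpP)
  let w : S → V := fun s => ⟨s.1 - p, hmem _ (mem_affineSpan ℝ (hSP s.1 s.2))⟩
  have hsum : ∑ s, w s = 0 := by
    ext1
    rw [AddSubmonoidClass.coe_finsetSum, Finset.univ_eq_attach, Finset.sum_attach S (fun s => s - p),
      Finset.sum_sub_distrib, hp]
    simp [← Nat.cast_smul_eq_nsmul ℝ]
  have hpos : ∀ e : Module.Dual ℝ V, e ≠ 0 → ∃ i, 0 < e (w i) := by
    intro e he
    by_contra! hcon
    apply he
    have h₀ : ∀ s, e (w s) = 0 := by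
      have h₁ : ∑ s, e (w s) = 0 := by rw [← map_sum, hsum, map_zero]
      intro s
      exact (Finset.sum_eq_zero_iff_of_nonpos fun s _ => hcon s).1 h₁ s (Finset.mem_univ s)
    obtain ⟨e', rfl⟩ := LinearMap.exists_extend e
    have h₁ : EqOn e'.toAffineMap (AffineMap.const ℝ (Fin N → ℝ) (e' p))
        (S : Set (Fin N → ℝ)) := by
      intro s hs
      have := h₀ ⟨s, hs⟩
      simpa [w, sub_eq_zero] using this
    have h₂ := AffineMap.eqOn_affineSpan h₁
    rw [← affineSpan_convexHull, ← hS] at h₂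
    ext v
    have h₃ := h₂ (AffineSubspace.vadd_mem_of_mem_direction v.2 (mem_affineSpan ℝ hpP))
    simpa using h₃
  obtain ⟨ℓ₁, hℓ₁, hℓx⟩ := exists_affineMap_of_notMem hP.convex hP.isCompact.isClosed hxP
  have hlin : ∀ y, ℓ₁.linear (y - p) = ℓ₁ y - ℓ₁ p := fun y => ℓ₁.linearMap_vsub y p
  have hp₁ := hℓ₁ p hpP
  obtain ⟨g, hg, hgx, hspan⟩ := exists_dual_span_active_eq_top w hpos ⟨x - p, hmem x hx⟩
    (-(ℓ₁ p)⁻¹ • ℓ₁.linear ∘ₗ V.subtype) (by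
      intro s
      have h := hℓ₁ s (hSP s.1 s.2)
      have : -(ℓ₁ p)⁻¹ * (ℓ₁ s - ℓ₁ p) = 1 - (ℓ₁ p)⁻¹ * ℓ₁ s := by field_simp; ring
      simp only [w, LinearMap.smul_apply, LinearMap.comp_apply, Submodule.subtype_apply, hlin,
        smul_eq_mul, this]
      have : 0 < (ℓ₁ p)⁻¹ * ℓ₁ s := by positivity
      linarith)
  have hgx' : 1 < g ⟨x - p, hmem x hx⟩ := by
    refine lt_of_lt_of_le ?_ hgx
    have : -(ℓ₁ p)⁻¹ * (ℓ₁ x - ℓ₁ p) = 1 + (ℓ₁ p)⁻¹ * -ℓ₁ x := by field_simp; ring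
    simp only [LinearMap.smul_apply, LinearMap.comp_apply, Submodule.subtype_apply, hlin,
      smul_eq_mul, this]
    have : 0 < (ℓ₁ p)⁻¹ * -ℓ₁ x := mul_pos (by positivity) (by linarith)
    linarith
  obtain ⟨f, rfl⟩ := LinearMap.exists_extend g
  simp only [LinearMap.comp_apply, Submodule.subtype_apply, w] at hg hgx' hspan
  obtain ⟨ℓ, hℓ⟩ : ∃ ℓ : (Fin N → ℝ) →ᵃ[ℝ] ℝ, ∀ y, ℓ y = 1 - f (y - p) :=
    ⟨AffineMap.const ℝ _ (1 + f p) - f.toAffineMap, fun y => by simp; ring⟩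
  have hℓP : ∀ y ∈ P, 0 ≤ ℓ y := by
    rw [hS]
    refine fun y hy => convexHull_min (t := {y | 0 ≤ ℓ y})
      (fun s hs => ?_) ((convex_Ici (0 : ℝ)).affine_preimage ℓ) hy
    have := hg ⟨s, hs⟩
    simp only [mem_ofPred_eq, hℓ]
    linarith
  refine ⟨ℓ, hℓP, by rw [hℓ]; linarith, isFaceOf_iff_exists_affineMap.2 ⟨ℓ, hℓP, rfl⟩, ?_⟩
  obtain ⟨s₀, hs₀⟩ : ∃ s₀ : S, f (s₀ - p) = 1 := by
    by_contra! h
    have hempty : {s : S | f (s - p) = 1} = ∅ := eq_empty_iff_forall_notMem.2 h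
    rw [hempty, image_empty, Submodule.span_empty] at hspan
    refine hnt.direction_ne_bot ((Submodule.eq_bot_iff _).2 fun v hv => ?_)
    have : (⟨v, hv⟩ : V) ∈ (⊥ : Submodule ℝ V) := hspan ▸ Submodule.mem_top
    simpa using this
  set F := {y ∈ P | ℓ y = 0} with hF
  have hmemF : ∀ s : S, f (s - p) = 1 → s.1 ∈ F := fun s hs => ⟨hSP s.1 s.2, by rw [hℓ, hs, sub_self]⟩
  rw [pdim_of_nonempty ⟨_, hmemF s₀ hs₀⟩, pdim_of_nonempty hnt.nonempty]
  have hle : (affineSpan ℝ F).direction ≤ V :=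
    AffineSubspace.direction_le (affineSpan_mono ℝ fun y hy => hy.1)
  have hker : (affineSpan ℝ F).direction ≤ LinearMap.ker f := by
    rw [direction_affineSpan, vectorSpan, Submodule.span_le]
    rintro _ ⟨y, hy, z, hz, rfl⟩
    have h₁ := hy.2
    have h₂ := hz.2
    rw [hℓ, map_sub] at h₁ h₂
    simp only [vsub_eq_sub, SetLike.mem_coe, LinearMap.mem_ker, map_sub]
    linarith
  have hlt : (affineSpan ℝ F).direction < V := by
    refine lt_of_le_of_ne hle fun h => ?_
    have h₁ : s₀.1 - p ∈ (affineSpan ℝ F).direction := h ▸ (w s₀).2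
    have h₂ : f (s₀ - p) = 0 := hker h₁
    linarith
  have hge : V ≤ (affineSpan ℝ F).direction ⊔ Submodule.span ℝ {s₀.1 - p} := by
    have h₁ : V = Submodule.map V.subtype ⊤ := by simp
    rw [h₁, ← hspan, Submodule.map_span, Submodule.span_le]
    rintro _ ⟨_, ⟨s, hs, rfl⟩, rfl⟩
    have h₂ : s.1 - p = (s.1 - s₀.1) + (s₀.1 - p) := by abel
    simp only [Submodule.subtype_apply, SetLike.mem_coe]
    rw [h₂]
    exact add_mem (Submodule.mem_sup_left (AffineSubspace.vsub_mem_direction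
      (mem_affineSpan ℝ (hmemF s hs)) (mem_affineSpan ℝ (hmemF s₀ hs₀))))
      (Submodule.mem_sup_right (Submodule.mem_span_singleton_self _))
  have h₁ := Submodule.finrank_lt_finrank_of_lt hlt
  have h₂ := (Submodule.finrank_mono hge).trans (Submodule.finrank_add_le_finrank_add_finrank _ _)
  have h₃ := finrank_span_le_card (R := ℝ) ({s₀.1 - p} : Set (Fin N → ℝ))
  simp only [toFinset_singleton, Finset.card_singleton] at h₃
  rw [← hV]
  omega

/-- A polytope is cut out of its affine hull by any functionals defining its facets. -/
theorem IsPolytope.mem_of_forall_nonneg (hP : IsPolytope P) (hnt : P.Nontrivial) {κ : Type*}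
    {ℓ : κ → (Fin N → ℝ) →ᵃ[ℝ] ℝ} (hℓ : ∀ y ∈ P, ∀ k, 0 ≤ ℓ k y)
    (hall : ∀ F, IsFacetOf F P → ∃ k, F = {y ∈ P | ℓ k y = 0}) {x : Fin N → ℝ}
    (hx : x ∈ affineSpan ℝ P) (h : ∀ k, 0 ≤ ℓ k x) : x ∈ P := by
  by_contra hxP
  obtain ⟨m, hm, hmx, hF⟩ := hP.exists_isFacetOf_of_notMem hnt hx hxP
  obtain ⟨k, hk⟩ := hall _ hF
  obtain ⟨q, hq, hqF⟩ := exists_of_ssubset (hF.1.subset.ssubset_of_ne hF.ne)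
  have hmq : 0 < m q := lt_of_le_of_ne (hm q hq) fun h => hqF ⟨hq, h.symm⟩
  have hkq : 0 < ℓ k q := lt_of_le_of_ne (hℓ q hq k) fun h => hqF (hk ▸ ⟨hq, h.symm⟩)
  have heq : EqOn (m q • ℓ k : (Fin N → ℝ) →ᵃ[ℝ] ℝ) (ℓ k q • m : (Fin N → ℝ) →ᵃ[ℝ] ℝ)
      (insert q {y ∈ P | m y = 0}) := by
    intro y hy
    rcases hy with rfl | hy
    · simp [mul_comm]
    · have h₁ : m y = 0 := hy.2
      rw [hk] at hy
      have h₂ : ℓ k y = 0 := hy.2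
      simp [h₁, h₂]
  have h₁ := AffineMap.eqOn_affineSpan heq
  rw [hF.affineSpan_insert (hF.nonempty hnt) hq hqF] at h₁
  have h₂ : m q * ℓ k x = ℓ k q * m x := by simpa using h₁ hx
  nlinarith [h k]

/-- A nonempty face of a set cut out by finitely many inequalities is obtained by turning some of
them into equalities. -/
theorem IsFaceOf.eq_commonZeros {κ : Type*} [Finite κ] {ℓ : κ → (Fin N → ℝ) →ᵃ[ℝ] ℝ}
    (hP : Convex ℝ P) (hℓ : ∀ y ∈ P, ∀ k, 0 ≤ ℓ k y)
    (hmem : ∀ x ∈ affineSpan ℝ P, (∀ k, 0 ≤ ℓ k x) → x ∈ P) (hF : IsFaceOf F P)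
    (hne : F.Nonempty) : F = commonZeros P ℓ {k | ∀ x ∈ F, ℓ k x = 0} := by
  classical
  have := Fintype.ofFinite κ
  obtain ⟨m, hm, rfl⟩ := isFaceOf_iff_exists_affineMap.1 hF
  apply Subset.antisymm
  · exact fun x hx => ⟨hx.1, fun k hk => hk x hx⟩
  obtain ⟨x, hxF, hx⟩ : ∃ x ∈ {x ∈ P | m x = 0},
      ∀ k, (∃ y ∈ {x ∈ P | m x = 0}, ℓ k y ≠ 0) → 0 < ℓ k x := by
    have hconv : Convex ℝ {x ∈ P | m x = 0} :=
      hP.inter ((convex_singleton (0 : ℝ)).affine_preimage m)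
    suffices ∀ s : Finset κ, ∃ x ∈ {x ∈ P | m x = 0},
        ∀ k ∈ s, (∃ y ∈ {x ∈ P | m x = 0}, ℓ k y ≠ 0) → 0 < ℓ k x by
      simpa using this Finset.univ
    intro s
    induction s using Finset.induction_on with
    | empty => exact ⟨hne.some, hne.some_mem, by simp⟩
    | insert k s hk ih =>
      obtain ⟨x, hx, hxs⟩ := ih
      by_cases hy : ∃ y ∈ {x ∈ P | m x = 0}, ℓ k y ≠ 0
      · obtain ⟨y, hyF, hyk⟩ := hy
        have hab : (1 / 2 : ℝ) + 1 / 2 = 1 := by norm_num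
        refine ⟨(1 / 2 : ℝ) • x + (1 / 2 : ℝ) • y,
          hconv hx hyF (by norm_num) (by norm_num) hab, fun j hj hj' => ?_⟩
        rw [Convex.combo_affine_apply hab, smul_eq_mul, smul_eq_mul]
        have h₁ := hℓ x hx.1 j
        have h₂ := hℓ y hyF.1 j
        rcases Finset.mem_insert.1 hj with rfl | hj
        · have := lt_of_le_of_ne h₂ hyk.symm
          linarith
        · have := hxs j hj hj'
          linarith
      · refine ⟨x, hx, fun j hj hj' => ?_⟩
        rcases Finset.mem_insert.1 hj with rfl | hj
        · exact absurd hj' hy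
        · exact hxs j hj hj'
  rintro y ⟨hyP, hy⟩
  refine ⟨hyP, le_antisymm ?_ (hm y hyP)⟩
  obtain ⟨ε, hε, hε'⟩ : ∃ ε : ℝ, 0 < ε ∧ ∀ k, 0 ≤ ℓ k x + ε * (ℓ k x - ℓ k y) := by
    suffices ∀ s : Finset κ, ∃ ε : ℝ, 0 < ε ∧ ∀ k ∈ s, 0 ≤ ℓ k x + ε * (ℓ k x - ℓ k y) by
      simpa using this Finset.univ
    intro s
    induction s using Finset.induction_on with
    | empty => exact ⟨1, one_pos, by simp⟩
    | insert k s hk ih =>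
      obtain ⟨ε, hε, hs⟩ := ih
      obtain ⟨δ, hδ, hk'⟩ : ∃ δ : ℝ, 0 < δ ∧ 0 ≤ ℓ k x + δ * (ℓ k x - ℓ k y) := by
        by_cases h : ∃ z ∈ {x ∈ P | m x = 0}, ℓ k z ≠ 0
        · have h₁ := hx k h
          have h₂ := hℓ y hyP k
          refine ⟨ℓ k x / (ℓ k y + 1), by positivity, ?_⟩
          have h₃ : ℓ k x + ℓ k x / (ℓ k y + 1) * (ℓ k x - ℓ k y) =
              ℓ k x * (ℓ k x + 1) / (ℓ k y + 1) := by
            field_simp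
            ring
          rw [h₃]
          positivity
        · push Not at h
          exact ⟨1, one_pos, by simp [h x hxF, hy k h]⟩
      refine ⟨min ε δ, lt_min hε hδ, fun j hj => ?_⟩
      have hmono : ∀ j (η : ℝ), 0 < η → min ε δ ≤ η → 0 ≤ ℓ j x + η * (ℓ j x - ℓ j y) →
          0 ≤ ℓ j x + min ε δ * (ℓ j x - ℓ j y) := by
        intro j η _ hle h₀
        have := hℓ x hxF.1 j
        have := lt_min hε hδ
        rcases le_total 0 (ℓ j x - ℓ j y) with h | h
        · positivity
        · nlinarith
      rcases Finset.mem_insert.1 hj with rfl | hj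
      · exact hmono j δ hδ (min_le_right _ _) hk'
      · exact hmono j ε hε (min_le_left _ _) (hs j hj)
  have hval : ∀ n : (Fin N → ℝ) →ᵃ[ℝ] ℝ, n (AffineMap.lineMap x y (-ε)) =
      n x + ε * (n x - n y) := by
    intro n
    rw [AffineMap.apply_lineMap, AffineMap.lineMap_apply_ring']
    ring
  have hz : AffineMap.lineMap x y (-ε) ∈ P := by
    refine hmem _ (AffineMap.lineMap_mem _ (mem_affineSpan ℝ hxF.1) (mem_affineSpan ℝ hyP)) ?_
    intro k
    rw [hval]
    exact hε' k
  have := hm _ hz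
  rw [hval, hxF.2] at this
  nlinarith

theorem IsPolytope.exists_facet_functionals (P : Set (Fin N → ℝ)) :
    ∃ ℓ : {F // IsFacetOf F P} → (Fin N → ℝ) →ᵃ[ℝ] ℝ,
      (∀ y ∈ P, ∀ k, 0 ≤ ℓ k y) ∧ ∀ k, k.1 = {y ∈ P | ℓ k y = 0} := by
  have h : ∀ k : {F // IsFacetOf F P}, ∃ ℓ : (Fin N → ℝ) →ᵃ[ℝ] ℝ,
      (∀ x ∈ P, 0 ≤ ℓ x) ∧ k.1 = {x ∈ P | ℓ x = 0} := fun k =>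
    isFaceOf_iff_exists_affineMap.1 k.2.1
  choose ℓ h₁ h₂ using h
  exact ⟨ℓ, fun y hy k => h₁ k y hy, h₂⟩

theorem IsPolytope.finite_facets (hP : IsPolytope P) : Finite {F // IsFacetOf F P} := by
  have := hP.finite_face
  exact Finite.of_injective (fun F : {F // IsFacetOf F P} => (⟨F.1, F.2.1⟩ : Face P))
    fun F G h => Subtype.ext (show F.1 = G.1 from congrArg (fun x : Face P => x.1) h)

theorem IsPolytope.isCoatom_iff_isFacetOf (hP : IsPolytope P) (hnt : P.Nontrivial) (F : Face P) :
    IsCoatom F ↔ IsFacetOf F.1 P := by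
  constructor
  · intro hF
    have hne : F.1.Nonempty := by
      by_contra h
      rw [not_nonempty_iff_eq_empty] at h
      obtain ⟨v, -, hv⟩ := (isFaceOf_self P).exists_vertex hP hnt.nonempty
      have hlt : F < (⟨{v}, hv⟩ : Face P) := by
        refine lt_of_le_of_ne ?_ ?_
        · change F.1 ⊆ _
          simp [h]
        · rintro rfl
          exact singleton_ne_empty v h
      have h₁ : ({v} : Set (Fin N → ℝ)) = P := congrArg Subtype.val (hF.2 _ hlt)
      rw [← h₁] at hnt
      exact not_nontrivial_singleton hnt
    have := hP.finite_facets
    obtain ⟨ℓ, h₁, h₂⟩ := IsPolytope.exists_facet_functionals P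
    have h₃ := F.2.eq_commonZeros hP.convex h₁
      (fun x hx h => hP.mem_of_forall_nonneg hnt h₁ (fun G hG => ⟨⟨G, hG⟩, h₂ ⟨G, hG⟩⟩) hx h) hne
    obtain ⟨k, hk⟩ : {k | ∀ x ∈ F.1, ℓ k x = 0}.Nonempty := by
      by_contra h
      rw [not_nonempty_iff_eq_empty] at h
      rw [h] at h₃
      refine hF.1 (Subtype.ext (h₃.trans ?_))
      ext x
      simp [commonZeros, show ((⊤ : Face P) : Set (Fin N → ℝ)) = P from rfl]
    have hle : F ≤ (⟨k.1, k.2.1⟩ : Face P) := by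
      intro x hx
      change x ∈ k.1
      rw [h₂ k]
      exact ⟨F.2.subset hx, hk x hx⟩
    rcases hle.eq_or_lt with h | h
    · rw [h]; exact k.2
    · exact absurd (congrArg Subtype.val (hF.2 _ h)) k.2.ne
  · intro hF
    refine ⟨fun h => hF.ne (congrArg Subtype.val h), fun G hG => ?_⟩
    obtain ⟨q, hq, hqF⟩ := exists_of_ssubset (show F.1 ⊂ G.1 from hG)
    obtain ⟨m, hm, hG'⟩ := isFaceOf_iff_exists_affineMap.1 G.2
    have h₀ : EqOn m (AffineMap.const ℝ (Fin N → ℝ) (0 : ℝ)) (insert q F.1) := by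
      intro x hx
      have h₁ : x ∈ G.1 := insert_subset hq hG.le hx
      rw [hG'] at h₁
      exact h₁.2
    have h₁ := AffineMap.eqOn_affineSpan h₀
    rw [hF.affineSpan_insert (hF.nonempty hnt) (G.2.subset hq) hqF] at h₁
    refine Subtype.ext (Subset.antisymm G.2.subset fun x hx => ?_)
    rw [hG']
    exact ⟨hx, h₁ (mem_affineSpan ℝ hx)⟩

theorem IsPolytope.facetCount_eq_card_isCoatom (hP : IsPolytope P) (hnt : P.Nontrivial) :
    facetCount P = Nat.card {F : Face P // IsCoatom F} := by
  unfold facetCount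
  rw [← Nat.card_coe_set_eq]
  exact Nat.card_congr
    { toFun := fun F => ⟨⟨F.1, F.2.1⟩, (hP.isCoatom_iff_isFacetOf hnt _).2 F.2⟩
      invFun := fun F => ⟨F.1.1, (hP.isCoatom_iff_isFacetOf hnt _).1 F.2⟩
      left_inv := fun _ => rfl
      right_inv := fun _ => rfl }

end Facets

section Presentations

variable {N M : ℕ}

/-- A presentation of `P` as the convex hull of the points `v i` and, inside its affine hull, as
the solution set of the inequalities `0 ≤ ℓ k x`. -/
structure IsPresentation {ι κ : Type*} (P : Set (Fin N → ℝ)) (v : ι → Fin N → ℝ)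
    (ℓ : κ → (Fin N → ℝ) →ᵃ[ℝ] ℝ) : Prop where
  eq_hull : P = convexHull ℝ (range v)
  nonneg : ∀ x ∈ P, ∀ k, 0 ≤ ℓ k x
  mem : ∀ x ∈ affineSpan ℝ P, (∀ k, 0 ≤ ℓ k x) → x ∈ P
  ne_zero : ∀ x ∈ P, ∃ k, ℓ k x ≠ 0

namespace IsPresentation

variable {ι κ ι' κ' : Type*} {P F : Set (Fin N → ℝ)} {v : ι → Fin N → ℝ}
  {ℓ : κ → (Fin N → ℝ) →ᵃ[ℝ] ℝ} {Q : Set (Fin M → ℝ)} {v' : ι' → Fin M → ℝ}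
  {ℓ' : κ' → (Fin M → ℝ) →ᵃ[ℝ] ℝ}

theorem point_mem (h : IsPresentation P v ℓ) (i : ι) : v i ∈ P := by
  rw [h.eq_hull]
  exact subset_convexHull ℝ _ (mem_range_self i)

theorem exists_eq_commonZeros [Finite κ] (h : IsPresentation P v ℓ) (hF : IsFaceOf F P) :
    ∃ T, F = commonZeros P ℓ T := by
  rcases F.eq_empty_or_nonempty with rfl | hne
  · refine ⟨univ, (eq_empty_iff_forall_notMem.2 ?_).symm⟩
    rintro x ⟨hx, hk⟩
    obtain ⟨k, hk'⟩ := h.ne_zero x hx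
    exact hk' (hk k (mem_univ k))
  · refine ⟨_, hF.eq_commonZeros ?_ h.nonneg h.mem hne⟩
    rw [h.eq_hull]
    exact convex_convexHull ℝ _

theorem commonZeros_subset_iff [Finite κ] (h : IsPresentation P v ℓ) {T T' : Set κ} :
    commonZeros P ℓ T ⊆ commonZeros P ℓ T' ↔
      ∀ i, (∀ k ∈ T, ℓ k (v i) = 0) → ∀ k ∈ T', ℓ k (v i) = 0 := by
  constructor
  · exact fun hsub i hi => (hsub ⟨h.point_mem i, hi⟩).2
  · intro hi
    have h₁ := isFaceOf_commonZeros h.nonneg T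
    have h₂ := isFaceOf_commonZeros h.nonneg T'
    have h₃ : range v ∩ commonZeros P ℓ T ⊆ range v ∩ commonZeros P ℓ T' := by
      rintro _ ⟨⟨i, rfl⟩, hT⟩
      exact ⟨⟨i, rfl⟩, hT.1, hi i hT.2⟩
    have h₄ : ∀ T, commonZeros P ℓ T = convexHull ℝ (range v ∩ commonZeros P ℓ T) := by
      intro T
      have h₅ := isFaceOf_commonZeros h.nonneg T
      have h₆ : IsFaceOf (commonZeros P ℓ T) (convexHull ℝ (range v)) := h.eq_hull ▸ h₅
      exact h₆.eq_convexHull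
    rw [h₄ T, h₄ T']
    exact convexHull_mono h₃

/-- The combinatorial type is determined by the incidences of a presentation. -/
theorem combEquiv [Finite κ] [Finite κ'] (h : IsPresentation P v ℓ) (h' : IsPresentation Q v' ℓ')
    (e : ι ≃ ι') (σ : κ ≃ κ') (hinc : ∀ k i, ℓ k (v i) = 0 ↔ ℓ' (σ k) (v' (e i)) = 0) :
    CombEquiv P Q := by
  have key : ∀ T T' : Set κ, commonZeros P ℓ T ⊆ commonZeros P ℓ T' ↔
      commonZeros Q ℓ' (σ '' T) ⊆ commonZeros Q ℓ' (σ '' T') := by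
    intro T T'
    rw [h.commonZeros_subset_iff, h'.commonZeros_subset_iff, e.forall_congr_left]
    simp only [hinc, Equiv.apply_symm_apply, forall_mem_image]
  choose T hT using fun F : Face P => h.exists_eq_commonZeros F.2
  let φ : Face P → Face Q := fun F =>
    ⟨commonZeros Q ℓ' (σ '' T F), isFaceOf_commonZeros h'.nonneg _⟩
  have hφ : ∀ F G : Face P, F.1 ⊆ G.1 ↔ (φ F).1 ⊆ (φ G).1 := by
    intro F G
    rw [hT F, hT G]
    exact key _ _
  have hbij : Function.Bijective φ := by
    constructor
    · intro F G hFG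
      exact Subtype.ext (Subset.antisymm ((hφ F G).2 (hFG ▸ Subset.rfl))
        ((hφ G F).2 (hFG ▸ Subset.rfl)))
    · intro G
      obtain ⟨T', hT'⟩ := h'.exists_eq_commonZeros G.2
      have himg : σ '' (σ ⁻¹' T') = T' := σ.image_preimage T'
      refine ⟨⟨commonZeros P ℓ (σ ⁻¹' T'), isFaceOf_commonZeros h.nonneg _⟩, ?_⟩
      have h₁ := hT ⟨commonZeros P ℓ (σ ⁻¹' T'), isFaceOf_commonZeros h.nonneg _⟩
      refine Subtype.ext ?_
      rw [hT']
      conv_rhs => rw [← himg]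
      exact Subset.antisymm ((key _ _).1 h₁.symm.subset) ((key _ _).1 h₁.subset)
  exact ⟨Equiv.ofBijective φ hbij, hφ⟩

end IsPresentation

/-- A presentation with the incidences of a product of two simplices, whose vertices are indexed
by `I` and `J`. -/
structure IsProductPresentation {I J : Type*} (P : Set (Fin N → ℝ)) (v : I × J → Fin N → ℝ)
    (ℓ : I ⊕ J → (Fin N → ℝ) →ᵃ[ℝ] ℝ) : Prop extends IsPresentation P v ℓ where
  inl_iff : ∀ i p, ℓ (Sum.inl i) (v p) = 0 ↔ p.1 ≠ i
  inr_iff : ∀ j p, ℓ (Sum.inr j) (v p) = 0 ↔ p.2 ≠ j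

namespace IsProductPresentation

variable {I J I' J' : Type*} {P : Set (Fin N → ℝ)}
  {v : I × J → Fin N → ℝ} {ℓ : I ⊕ J → (Fin N → ℝ) →ᵃ[ℝ] ℝ}
  {Q : Set (Fin M → ℝ)} {v' : I' × J' → Fin M → ℝ} {ℓ' : I' ⊕ J' → (Fin M → ℝ) →ᵃ[ℝ] ℝ}

theorem injective (h : IsProductPresentation P v ℓ) : Function.Injective v := by
  rintro ⟨i, j⟩ ⟨i', j'⟩ hv
  have h₁ := h.inl_iff i (i, j)
  have h₂ := h.inr_iff j (i, j)
  rw [hv, h.inl_iff] at h₁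
  rw [hv, h.inr_iff] at h₂
  ext1
  · simpa [eq_comm] using h₁
  · simpa [eq_comm] using h₂

theorem exists_apply_eq_zero_of_ne [Nontrivial I] [Nontrivial J] (h : IsProductPresentation P v ℓ)
    {k k' : I ⊕ J} (hk : k ≠ k') : ∃ p, ℓ k (v p) = 0 ∧ ℓ k' (v p) ≠ 0 := by
  rcases k with i | j <;> rcases k' with i' | j'
  · obtain ⟨j⟩ := (inferInstance : Nonempty J)
    refine ⟨(i', j), (h.inl_iff _ _).2 fun h => hk (congrArg _ h.symm), ?_⟩
    simp [h.inl_iff]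
  · obtain ⟨i', hi'⟩ := exists_ne i
    exact ⟨(i', j'), (h.inl_iff _ _).2 hi', by simp [h.inr_iff]⟩
  · obtain ⟨j', hj'⟩ := exists_ne j
    exact ⟨(i', j'), (h.inr_iff _ _).2 hj', by simp [h.inl_iff]⟩
  · obtain ⟨i⟩ := (inferInstance : Nonempty I)
    refine ⟨(i, j'), (h.inr_iff _ _).2 fun h => hk (congrArg _ h.symm), ?_⟩
    simp [h.inr_iff]

variable [Finite I] [Finite J]

theorem combEquiv [Finite I'] [Finite J'] (h : IsProductPresentation P v ℓ)
    (h' : IsProductPresentation Q v' ℓ') (e : I ≃ I') (f : J ≃ J') : CombEquiv P Q := by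
  refine h.toIsPresentation.combEquiv h'.toIsPresentation (e.prodCongr f) (e.sumCongr f) ?_
  rintro (i | j) p
  · simp [h.inl_iff, h'.inl_iff]
  · simp [h.inr_iff, h'.inr_iff]

theorem combEquiv_swap [Finite I'] [Finite J'] (h : IsProductPresentation P v ℓ)
    (h' : IsProductPresentation Q v' ℓ') (e : I ≃ J') (f : J ≃ I') : CombEquiv P Q := by
  refine h.toIsPresentation.combEquiv h'.toIsPresentation
    ((e.prodCongr f).trans (Equiv.prodComm _ _)) ((e.sumCongr f).trans (Equiv.sumComm _ _)) ?_
  rintro (i | j) p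
  · simp [h.inl_iff, h'.inr_iff]
  · simp [h.inr_iff, h'.inl_iff]

theorem isPolytope (h : IsProductPresentation P v ℓ) : IsPolytope P :=
  ⟨(finite_range v).toFinset, by simpa using h.eq_hull⟩

theorem vertexSet_eq (h : IsProductPresentation P v ℓ) : vertexSet P = range v := by
  apply Subset.antisymm
  · intro x hx
    rw [h.eq_hull] at hx
    exact IsVertexOf.mem_of_convexHull hx
  · rintro _ ⟨p, rfl⟩
    have h₁ := isFaceOf_commonZeros h.nonneg {k | ℓ k (v p) = 0}
    have h₂ : IsFaceOf (commonZeros P ℓ {k | ℓ k (v p) = 0}) (convexHull ℝ (range v)) :=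
      h.eq_hull ▸ h₁
    have h₃ : range v ∩ commonZeros P ℓ {k | ℓ k (v p) = 0} = {v p} := by
      ext x
      constructor
      · rintro ⟨⟨q, rfl⟩, -, hq⟩
        by_contra hne
        have hpq : q.1 ≠ p.1 ∨ q.2 ≠ p.2 := by
          by_contra! hcon
          exact hne (congrArg v (Prod.ext hcon.1 hcon.2))
        rcases hpq with hpq | hpq
        · exact (h.inl_iff q.1 q).1 (hq _ ((h.inl_iff q.1 p).2 hpq.symm)) rfl
        · exact (h.inr_iff q.2 q).1 (hq _ ((h.inr_iff q.2 p).2 hpq.symm)) rfl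
      · rintro rfl
        exact ⟨mem_range_self p, h.point_mem p, fun k hk => hk⟩
    have h₄ := h₂.eq_convexHull
    rw [h₃, convexHull_singleton] at h₄
    exact show IsFaceOf {v p} P from h₄ ▸ h₁

theorem vertexCount_eq (h : IsProductPresentation P v ℓ) :
    vertexCount P = Nat.card I * Nat.card J := by
  rw [vertexCount, h.vertexSet_eq, ← Nat.card_coe_set_eq, Nat.card_range_of_injective h.injective,
    Nat.card_prod]

theorem card_isCoatom [Nontrivial I] [Nontrivial J] (h : IsProductPresentation P v ℓ) :
    Nat.card {F : Face P // IsCoatom F} = Nat.card I + Nat.card J := by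
  have hzero : ∀ k, ∃ p, ℓ k (v p) ≠ 0 := by
    intro k
    obtain ⟨i⟩ := (inferInstance : Nonempty I)
    obtain ⟨j⟩ := (inferInstance : Nonempty J)
    rcases k with i' | j'
    · exact ⟨(i', j), by simp [h.inl_iff]⟩
    · exact ⟨(i, j'), by simp [h.inr_iff]⟩
  let f : I ⊕ J → Face P := fun k => ⟨commonZeros P ℓ {k}, isFaceOf_commonZeros h.nonneg _⟩
  have hf_le : ∀ k k', f k ≤ f k' → k = k' := by
    intro k k' hle
    by_contra hne
    obtain ⟨p, hp, hp'⟩ := h.exists_apply_eq_zero_of_ne hne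
    exact hp' (h.commonZeros_subset_iff.1 hle p (by simpa using hp) k' rfl)
  have hf_top : ∀ k, f k ≠ ⊤ := by
    intro k hk
    obtain ⟨p, hp⟩ := hzero k
    have h₁ : commonZeros P ℓ {k} = P := congrArg Subtype.val hk
    have h₂ := h.point_mem p
    rw [← h₁] at h₂
    exact hp (h₂.2 k rfl)
  have hle_f : ∀ F : Face P, F ≠ ⊤ → ∃ k, F ≤ f k := by
    intro F hF
    obtain ⟨T, hT⟩ := h.exists_eq_commonZeros F.2
    obtain ⟨k, hk⟩ : T.Nonempty := by
      by_contra hcon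
      rw [not_nonempty_iff_eq_empty] at hcon
      refine hF (Subtype.ext (hT.trans ?_))
      ext x
      simp [commonZeros, hcon, show ((⊤ : Face P) : Set (Fin N → ℝ)) = P from rfl]
    refine ⟨k, fun x hx => ?_⟩
    rw [hT] at hx
    exact ⟨hx.1, fun k' hk' => hx.2 k' (mem_singleton_iff.1 hk' ▸ hk)⟩
  have hf : ∀ k, IsCoatom (f k) := by
    refine fun k => ⟨hf_top k, fun F hF => ?_⟩
    by_contra hne
    obtain ⟨k', hk'⟩ := hle_f F hne
    have := hf_le k k' (hF.le.trans hk')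
    subst this
    exact absurd hk' hF.not_ge
  rw [← Nat.card_sum]
  refine (Nat.card_congr (Equiv.ofBijective
    (fun k => (⟨f k, hf k⟩ : {F : Face P // IsCoatom F})) ⟨fun k k' hkk => ?_, ?_⟩)).symm
  · exact hf_le k k' (Subtype.ext_iff.1 hkk).le
  · rintro ⟨F, hF⟩
    obtain ⟨k, hk⟩ := hle_f F hF.1
    refine ⟨k, Subtype.ext ?_⟩
    by_contra hne
    exact hf_top k (hF.2 _ (lt_of_le_of_ne hk (Ne.symm hne)))

end IsProductPresentation

end Presentations

section ProductOfSimplices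

/-- The vertices of `simplexF n`. -/
def simplexVertex (n : ℕ) : Option (Fin n) → Fin n → ℝ
  | none => fun _ => -1
  | some i => Pi.single i 1

/-- The barycentric coordinates with respect to the vertices of `simplexF n`. -/
def simplexCoord (n : ℕ) : Option (Fin n) → (Fin n → ℝ) →ᵃ[ℝ] ℝ
  | none => ((n : ℝ) + 1)⁻¹ • (AffineMap.const ℝ _ 1 - (∑ j, LinearMap.proj j :
      (Fin n → ℝ) →ₗ[ℝ] ℝ).toAffineMap)
  | some i => (LinearMap.proj i : (Fin n → ℝ) →ₗ[ℝ] ℝ).toAffineMap + simplexCoord n none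

variable {n m : ℕ}

theorem simplexCoord_none (x : Fin n → ℝ) :
    simplexCoord n none x = ((n : ℝ) + 1)⁻¹ * (1 - ∑ j, x j) := by
  simp [simplexCoord]

theorem simplexCoord_some (i : Fin n) (x : Fin n → ℝ) :
    simplexCoord n (some i) x = x i + simplexCoord n none x := by
  simp [simplexCoord]

theorem sum_simplexCoord (x : Fin n → ℝ) : ∑ o, simplexCoord n o x = 1 := by
  have hn : (n : ℝ) + 1 ≠ 0 := by positivity
  rw [Fintype.sum_option]
  simp only [simplexCoord_some, simplexCoord_none, Finset.sum_add_distrib, Finset.sum_const,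
    Finset.card_univ, Fintype.card_fin, nsmul_eq_mul]
  field_simp
  ring

theorem sum_simplexCoord_smul (x : Fin n → ℝ) :
    ∑ o, simplexCoord n o x • simplexVertex n o = x := by
  ext i
  rw [Fintype.sum_option]
  simp [simplexVertex, simplexCoord_some, Finset.sum_apply, Pi.single_apply]

theorem simplexCoord_simplexVertex (o o' : Option (Fin n)) :
    simplexCoord n o (simplexVertex n o') = if o' = o then 1 else 0 := by
  have hn : (n : ℝ) + 1 ≠ 0 := by positivity
  have h₀ : simplexCoord n none (simplexVertex n o') = if o' = none then 1 else 0 := by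
    rw [simplexCoord_none]
    cases o' with
    | none => simp [simplexVertex]; field_simp; ring
    | some j => simp [simplexVertex]
  cases o with
  | none => exact h₀
  | some i =>
    rw [simplexCoord_some, h₀]
    cases o' with
    | none => simp [simplexVertex]
    | some j => simp [simplexVertex, Pi.single_apply, eq_comm]

theorem simplexF_eq : simplexF n = convexHull ℝ (range (simplexVertex n)) := by
  rw [simplexF]
  congr 1
  ext x
  simp only [mem_union, mem_range, mem_singleton_iff, Option.exists, simplexVertex]
  rw [or_comm, eq_comm (a := x)]

theorem mem_simplexF_iff {x : Fin n → ℝ} : x ∈ simplexF n ↔ ∀ o, 0 ≤ simplexCoord n o x := by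
  rw [simplexF_eq]
  constructor
  · have hconv : Convex ℝ {x : Fin n → ℝ | ∀ o, 0 ≤ simplexCoord n o x} := by
      rw [Set.ofPred_forall]
      exact convex_iInter fun o => (convex_Ici (0 : ℝ)).affine_preimage (simplexCoord n o)
    refine fun hx => convexHull_min ?_ hconv hx
    rintro _ ⟨o', rfl⟩ o
    rw [simplexCoord_simplexVertex]
    split_ifs <;> norm_num
  · intro hx
    rw [← sum_simplexCoord_smul x]
    exact (convex_convexHull ℝ _).sum_mem (fun o _ => hx o) (sum_simplexCoord x)
      fun o _ => subset_convexHull ℝ _ (mem_range_self o)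

/-- The vertices of `prodP n m`. -/
def prodVertex (n m : ℕ) (p : Option (Fin n) × Option (Fin m)) : Fin (n + m) → ℝ :=
  Fin.append (simplexVertex n p.1) (simplexVertex m p.2)

/-- The functionals defining the facets of `prodP n m`. -/
def prodCoord (n m : ℕ) : Option (Fin n) ⊕ Option (Fin m) → (Fin (n + m) → ℝ) →ᵃ[ℝ] ℝ
  | Sum.inl o => (simplexCoord n o).comp (LinearMap.funLeft ℝ ℝ (Fin.castAdd m)).toAffineMap
  | Sum.inr o => (simplexCoord m o).comp (LinearMap.funLeft ℝ ℝ (Fin.natAdd n)).toAffineMap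

theorem prodCoord_inl_append (o : Option (Fin n)) (a : Fin n → ℝ) (b : Fin m → ℝ) :
    prodCoord n m (Sum.inl o) (Fin.append a b) = simplexCoord n o a := by
  have h : LinearMap.funLeft ℝ ℝ (Fin.castAdd m) (Fin.append a b) = a := by
    ext i; simp [LinearMap.funLeft_apply]
  simp [prodCoord, h]

theorem prodCoord_inr_append (o : Option (Fin m)) (a : Fin n → ℝ) (b : Fin m → ℝ) :
    prodCoord n m (Sum.inr o) (Fin.append a b) = simplexCoord m o b := by
  have h : LinearMap.funLeft ℝ ℝ (Fin.natAdd n) (Fin.append a b) = b := by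
    ext i; simp [LinearMap.funLeft_apply]
  simp [prodCoord, h]

theorem exists_eq_append (z : Fin (n + m) → ℝ) :
    ∃ (a : Fin n → ℝ) (b : Fin m → ℝ), z = Fin.append a b :=
  ⟨_, _, (Fin.append_castAdd_natAdd (f := z)).symm⟩

theorem append_mem_prodP_iff {a : Fin n → ℝ} {b : Fin m → ℝ} :
    Fin.append a b ∈ prodP n m ↔ a ∈ simplexF n ∧ b ∈ simplexF m := by
  constructor
  · rintro ⟨a', ha', b', hb', hab⟩
    have h₁ : a = a' := by
      ext i; simpa using congrFun hab (Fin.castAdd m i)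
    have h₂ : b = b' := by
      ext i; simpa using congrFun hab (Fin.natAdd n i)
    exact ⟨h₁ ▸ ha', h₂ ▸ hb'⟩
  · exact fun h => ⟨a, h.1, b, h.2, rfl⟩

theorem mem_prodP_iff {z : Fin (n + m) → ℝ} : z ∈ prodP n m ↔ ∀ k, 0 ≤ prodCoord n m k z := by
  obtain ⟨a, b, rfl⟩ := exists_eq_append z
  simp only [append_mem_prodP_iff, mem_simplexF_iff, Sum.forall, prodCoord_inl_append,
    prodCoord_inr_append]

theorem isProductPresentation_prodP :
    IsProductPresentation (prodP n m) (prodVertex n m) (prodCoord n m) where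
  eq_hull := by
    apply Subset.antisymm
    · rintro _ ⟨a, ha, b, hb, rfl⟩
      rw [mem_simplexF_iff] at ha hb
      have hsum : ∑ p : Option (Fin n) × Option (Fin m),
          simplexCoord n p.1 a * simplexCoord m p.2 b = 1 := by
        simp only [Fintype.sum_prod_type, ← Finset.mul_sum, sum_simplexCoord, mul_one]
      have heq : Fin.append a b = ∑ p : Option (Fin n) × Option (Fin m),
          (simplexCoord n p.1 a * simplexCoord m p.2 b) • prodVertex n m p := by
        ext i
        refine Fin.addCases (fun i => ?_) (fun i => ?_) i
        · conv_lhs => rw [Fin.append_left, ← sum_simplexCoord_smul a]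
          simp only [Finset.sum_apply, Pi.smul_apply, prodVertex, Fin.append_left, smul_eq_mul,
            Fintype.sum_prod_type]
          refine Finset.sum_congr rfl fun o _ => ?_
          rw [← Finset.sum_mul, ← Finset.mul_sum, sum_simplexCoord, mul_one]
        · conv_lhs => rw [Fin.append_right, ← sum_simplexCoord_smul b]
          simp only [Finset.sum_apply, Pi.smul_apply, prodVertex, Fin.append_right, smul_eq_mul,
            Fintype.sum_prod_type_right]
          refine Finset.sum_congr rfl fun o _ => ?_
          rw [← Finset.sum_mul, ← Finset.sum_mul, sum_simplexCoord, one_mul]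
      rw [heq]
      exact (convex_convexHull ℝ _).sum_mem (fun p _ => mul_nonneg (ha _) (hb _)) hsum
        fun p _ => subset_convexHull ℝ _ (mem_range_self p)
    · have hconv : Convex ℝ (prodP n m) := by
        have h : prodP n m = {z | ∀ k, 0 ≤ prodCoord n m k z} := ext fun _ => mem_prodP_iff
        rw [h, Set.ofPred_forall]
        exact convex_iInter fun k => (convex_Ici (0 : ℝ)).affine_preimage (prodCoord n m k)
      refine convexHull_min ?_ hconv
      rintro _ ⟨p, rfl⟩
      refine append_mem_prodP_iff.2 ⟨?_, ?_⟩ <;> rw [simplexF_eq] <;>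
        exact subset_convexHull ℝ _ (mem_range_self _)
  nonneg _ hx := mem_prodP_iff.1 hx
  mem _ _ hx := mem_prodP_iff.2 hx
  ne_zero := by
    rintro _ ⟨a, -, b, -, rfl⟩
    by_contra! hcon
    have h := sum_simplexCoord a
    simp only [← prodCoord_inl_append _ a b, hcon, Finset.sum_const_zero] at h
    exact zero_ne_one h
  inl_iff i p := by
    rw [prodVertex, prodCoord_inl_append, simplexCoord_simplexVertex]
    simp
  inr_iff j p := by
    rw [prodVertex, prodCoord_inr_append, simplexCoord_simplexVertex]
    simp

end ProductOfSimplices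

section HyperplaneForm

/-- Stiemke's lemma. -/
theorem exists_pos_forall_sum_mul_eq_zero {κ : Type*} [Fintype κ] (U : Submodule ℝ (κ → ℝ))
    (hU : ∀ u ∈ U, (∀ k, 0 ≤ u k) → u = 0) :
    ∃ w : κ → ℝ, (∀ k, 0 < w k) ∧ ∀ u ∈ U, ∑ k, w k * u k = 0 := by
  classical
  have hdisj : Disjoint (stdSimplex ℝ κ) (U : Set (κ → ℝ)) := by
    rw [Set.disjoint_left]
    intro y hy hyU
    have h := hU y hyU hy.1
    have h₁ := hy.2
    simp [h] at h₁
  obtain ⟨f, s, t, hs, hst, ht⟩ := geometric_hahn_banach_compact_closed (convex_stdSimplex ℝ κ)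
    (isCompact_stdSimplex ℝ κ) U.convex U.closed_of_finiteDimensional hdisj
  have ht₀ : t < 0 := by simpa using ht 0 U.zero_mem
  have hfU : ∀ u ∈ U, f u = 0 := by
    intro u hu
    by_contra hne
    have h := ht ((t / f u) • u) (U.smul_mem _ hu)
    rw [map_smul, smul_eq_mul, div_mul_cancel₀ _ hne] at h
    exact lt_irrefl _ h
  refine ⟨fun k => -f (Pi.single k 1), fun k => ?_, fun u hu => ?_⟩
  · have h := hs _ (single_mem_stdSimplex ℝ k)
    linarith
  · have h := f.toLinearMap.pi_apply_eq_sum_univ u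
    have h₁ := hfU u hu
    simp only [ContinuousLinearMap.coe_coe, smul_eq_mul] at h
    rw [h₁] at h
    have h₂ : ∀ k, (fun j => if k = j then (1 : ℝ) else 0) = (Pi.single k 1 : κ → ℝ) := by
      intro k; ext j; simp [Pi.single_apply, eq_comm]
    simp only [h₂] at h
    calc ∑ k, -f (Pi.single k 1) * u k = -∑ k, u k * f (Pi.single k 1) := by
          rw [← Finset.sum_neg_distrib]; exact Finset.sum_congr rfl fun k _ => by ring
      _ = 0 := by rw [← h, neg_zero]

theorem Submodule.exists_forall_mem_iff_sum_mul_eq_zero {κ : Type*} [Fintype κ]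
    (W : Submodule ℝ (κ → ℝ)) (hW : Module.finrank ℝ W + 1 = Fintype.card κ) :
    ∃ a : κ → ℝ, ∀ y, y ∈ W ↔ ∑ k, a k * y k = 0 := by
  classical
  have hfin : Module.finrank ℝ (κ → ℝ) = Fintype.card κ := Module.finrank_fintype_fun_eq_card ℝ
  obtain ⟨f, hf, hWf⟩ := W.exists_le_ker_of_lt_top (Submodule.lt_top_of_finrank_lt_finrank
    (by omega))
  have hker := Module.Dual.finrank_ker_add_one_of_ne_zero (f := f) hf
  have heq : W = LinearMap.ker f := Submodule.eq_of_le_of_finrank_eq hWf (by omega)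
  refine ⟨fun k => f (Pi.single k 1), fun y => ?_⟩
  have h := f.pi_apply_eq_sum_univ y
  have h₂ : ∀ k, (fun j => if k = j then (1 : ℝ) else 0) = (Pi.single k 1 : κ → ℝ) := by
    intro k; ext j; simp [Pi.single_apply, eq_comm]
  simp only [h₂, smul_eq_mul] at h
  rw [heq, LinearMap.mem_ker, h]
  simp only [mul_comm]

theorem AffineMap.map_sum_smul {ι E : Type*} [AddCommGroup E] [Module ℝ E] (f : E →ᵃ[ℝ] ℝ)
    (s : Finset ι) (w : ι → ℝ) (v : ι → E) (hw : ∑ i ∈ s, w i = 1) :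
    f (∑ i ∈ s, w i • v i) = ∑ i ∈ s, w i * f (v i) := by
  have h : ∀ x, f x = f.linear x + f 0 := fun x => congrFun f.decomp x
  rw [h, map_sum]
  calc _ = ∑ i ∈ s, w i * f.linear (v i) + (∑ i ∈ s, w i) * f 0 := by simp [hw]
    _ = _ := by
      rw [Finset.sum_mul, ← Finset.sum_add_distrib]
      exact Finset.sum_congr rfl fun i _ => by rw [h (v i)]; ring

variable {N : ℕ}

/-- Affine coordinates `ℓ` identifying the affine hull of `P` with the affine subspace of `κ → ℝ`
cut out by `∑ k, y k = 1` and `∑ k, a k * y k = 0`, and `P` with the points of this subspace with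
nonnegative coordinates. -/
structure IsHyperplaneForm {κ : Type*} [Fintype κ] (P : Set (Fin N → ℝ))
    (ℓ : κ → (Fin N → ℝ) →ᵃ[ℝ] ℝ) (a : κ → ℝ) : Prop where
  nonneg : ∀ x ∈ P, ∀ k, 0 ≤ ℓ k x
  isFacetOf : ∀ k, IsFacetOf {x ∈ P | ℓ k x = 0} P
  mem : ∀ x ∈ affineSpan ℝ P, (∀ k, 0 ≤ ℓ k x) → x ∈ P
  sum_eq_one : ∀ x ∈ affineSpan ℝ P, ∑ k, ℓ k x = 1
  sum_mul_eq_zero : ∀ x ∈ affineSpan ℝ P, ∑ k, a k * ℓ k x = 0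
  eq_of_forall : ∀ x ∈ affineSpan ℝ P, ∀ x' ∈ affineSpan ℝ P, (∀ k, ℓ k x = ℓ k x') → x = x'
  exists_eq : ∀ y : κ → ℝ, ∑ k, y k = 1 → ∑ k, a k * y k = 0 →
    ∃ x ∈ affineSpan ℝ P, ∀ k, ℓ k x = y k

theorem IsPolytope.exists_isHyperplaneForm {P : Set (Fin N → ℝ)} {d : ℕ} (hP : IsPolytope P)
    (hnt : P.Nontrivial) (hdP : pdim P = d) [Fintype {F // IsFacetOf F P}]
    (hcard : Fintype.card {F // IsFacetOf F P} = d + 2) :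
    ∃ (ℓ : {F // IsFacetOf F P} → (Fin N → ℝ) →ᵃ[ℝ] ℝ) (a : {F // IsFacetOf F P} → ℝ),
      IsHyperplaneForm P ℓ a := by
  obtain ⟨ℓ₀, hnonneg, hfacet⟩ := IsPolytope.exists_facet_functionals P
  obtain ⟨p, hp⟩ := hnt.nonempty
  have hpA : p ∈ affineSpan ℝ P := subset_affineSpan ℝ P hp
  have hmem : ∀ x ∈ affineSpan ℝ P, (∀ k, 0 ≤ ℓ₀ k x) → x ∈ P := fun x hx h =>
    hP.mem_of_forall_nonneg hnt hnonneg (fun F hF => ⟨⟨F, hF⟩, hfacet ⟨F, hF⟩⟩) hx h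
  set V := (affineSpan ℝ P).direction with hV
  have happly : ∀ (f : (Fin N → ℝ) →ᵃ[ℝ] ℝ) v, f (p + v) = f.linear v + f p := by
    intro f v
    rw [add_comm p v]
    exact f.map_vadd p v
  have hAmem : ∀ v ∈ V, p + v ∈ affineSpan ℝ P := by
    intro v hv
    rw [add_comm p v]
    exact AffineSubspace.vadd_mem_of_mem_direction hv hpA
  have hAex : ∀ x ∈ affineSpan ℝ P, ∃ v : V, x = p + v := fun x hx =>
    ⟨⟨x - p, AffineSubspace.vsub_mem_direction hx hpA⟩, by simp⟩
  have hcone : ∀ v ∈ V, (∀ k, 0 ≤ (ℓ₀ k).linear v) → v = 0 := by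
    intro v hv hk
    refine hP.eq_zero_of_ray (p := p) fun t ht => hmem _ (hAmem _ (V.smul_mem t hv)) fun k => ?_
    rw [happly, map_smul, smul_eq_mul]
    have := mul_nonneg ht (hk k)
    have := hnonneg p hp k
    linarith
  have hpos : ∃ k, 0 < ℓ₀ k p := by
    by_contra! hcon
    obtain ⟨q, hq, hqp⟩ := hnt.exists_ne p
    obtain ⟨v, rfl⟩ := hAex q (subset_affineSpan ℝ P hq)
    refine hqp ?_
    rw [hcone v v.2 fun k => ?_, add_zero]
    have h := hnonneg _ hq k
    rw [happly] at h
    linarith [hcon k]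
  let A : V →ₗ[ℝ] ({F // IsFacetOf F P} → ℝ) :=
    LinearMap.pi fun k => (ℓ₀ k).linear ∘ₗ V.subtype
  obtain ⟨w, hw, hw₀⟩ := exists_pos_forall_sum_mul_eq_zero (LinearMap.range A) (by
    rintro _ ⟨v, rfl⟩ hk
    have hv : v = 0 := Subtype.ext (hcone v v.2 hk)
    rw [hv, map_zero])
  have hwV : ∀ v ∈ V, ∑ k, w k * (ℓ₀ k).linear v = 0 := fun v hv => hw₀ _ ⟨⟨v, hv⟩, rfl⟩
  set C := ∑ k, w k * ℓ₀ k p with hC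
  have hCpos : 0 < C := by
    obtain ⟨k, hk⟩ := hpos
    exact Finset.sum_pos' (fun k _ => mul_nonneg (hw k).le (hnonneg p hp k))
      ⟨k, Finset.mem_univ k, mul_pos (hw k) hk⟩
  let ℓ : {F // IsFacetOf F P} → (Fin N → ℝ) →ᵃ[ℝ] ℝ := fun k => (w k / C) • ℓ₀ k
  have hℓ : ∀ k x, ℓ k x = w k / C * ℓ₀ k x := fun k x => rfl
  have hℓ' : ∀ k v, (ℓ k).linear v = w k / C * (ℓ₀ k).linear v := fun k v => rfl
  have hwC : ∀ k, 0 < w k / C := fun k => div_pos (hw k) hCpos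
  have hsum_p : ∑ k, ℓ k p = 1 := by
    simp only [hℓ, div_mul_eq_mul_div]
    rw [← Finset.sum_div, ← hC, div_self hCpos.ne']
  have hsum_V : ∀ v ∈ V, ∑ k, (ℓ k).linear v = 0 := by
    intro v hv
    simp only [hℓ', div_mul_eq_mul_div]
    rw [← Finset.sum_div, hwV v hv, zero_div]
  have hinj : ∀ v ∈ V, (∀ k, (ℓ k).linear v = 0) → v = 0 := by
    refine fun v hv h => hcone v hv fun k => ?_
    have h₁ := h k
    rw [hℓ', mul_eq_zero, or_iff_right (hwC k).ne'] at h₁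
    exact h₁.ge
  let L : V × ℝ →ₗ[ℝ] ({F // IsFacetOf F P} → ℝ) :=
    LinearMap.coprod (LinearMap.pi fun k => (ℓ k).linear ∘ₗ V.subtype)
      (LinearMap.toSpanSingleton ℝ _ fun k => ℓ k p)
  have hL : ∀ v t k, L (v, t) k = (ℓ k).linear v + t * ℓ k p := fun v t k => by
    simp [L]
  have hLsum : ∀ v t, ∑ k, L (v, t) k = t := by
    intro v t
    simp only [hL, Finset.sum_add_distrib, ← Finset.mul_sum, hsum_p, hsum_V v v.2, zero_add,
      mul_one]
  have hLinj : Function.Injective L := by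
    rw [← LinearMap.ker_eq_bot, LinearMap.ker_eq_bot']
    rintro ⟨v, t⟩ h
    have ht : t = 0 := by rw [← hLsum v t, h]; simp
    subst ht
    refine Prod.ext (Subtype.ext (hinj v v.2 fun k => ?_)) rfl
    have := congrFun h k
    simpa [hL] using this
  have hfin : Module.finrank ℝ V = d := by
    have h := pdim_of_nonempty hnt.nonempty
    rw [hdP] at h
    exact_mod_cast h.symm
  obtain ⟨a, ha⟩ := (LinearMap.range L).exists_forall_mem_iff_sum_mul_eq_zero (by
    rw [LinearMap.finrank_range_of_inj hLinj, Module.finrank_prod, hfin, Module.finrank_self,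
      hcard])
  have hLapply : ∀ v : V, L (v, 1) = fun k => ℓ k (p + v) := by
    intro v
    ext k
    rw [hL, happly, one_mul]
  refine ⟨ℓ, a, ?_, ?_, ?_, ?_, ?_, ?_, ?_⟩
  · exact fun x hx k => mul_nonneg (hwC k).le (hnonneg x hx k)
  · intro k
    have h : {x ∈ P | ℓ k x = 0} = k.1 := by
      rw [hfacet k]
      ext x
      simp [hℓ, (hwC k).ne']
    exact h ▸ k.2
  · exact fun x hx h => hmem x hx fun k => nonneg_of_mul_nonneg_right (h k) (hwC k)
  · intro x hx
    obtain ⟨v, rfl⟩ := hAex x hx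
    simpa only [hLapply] using hLsum v 1
  · intro x hx
    obtain ⟨v, rfl⟩ := hAex x hx
    simpa only [hLapply] using (ha _).1 ⟨(v, 1), rfl⟩
  · intro x hx x' hx' h
    obtain ⟨v, rfl⟩ := hAex x hx
    obtain ⟨v', rfl⟩ := hAex x' hx'
    have h₁ : (v, (1 : ℝ)) = (v', 1) := hLinj (by rw [hLapply, hLapply]; exact funext h)
    exact congrArg (fun u : V × ℝ => p + (u.1 : Fin N → ℝ)) h₁
  · intro y hy hay
    obtain ⟨⟨v, t⟩, rfl⟩ := (ha y).2 hay
    rw [hLsum] at hy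
    subst hy
    exact ⟨p + v, hAmem v v.2, fun k => (congrFun (hLapply v) k).symm⟩

end HyperplaneForm

namespace IsHyperplaneForm

variable {N : ℕ} {κ : Type*} [Fintype κ] {P : Set (Fin N → ℝ)}
  {ℓ : κ → (Fin N → ℝ) →ᵃ[ℝ] ℝ} {a : κ → ℝ}

/-- A vanishing coefficient of the linear relation exhibits `P` as a pyramid. -/
theorem isPyramidPolytope (h : IsHyperplaneForm P ℓ a) (hconv : Convex ℝ P) {k : κ}
    (hk : a k = 0) : IsPyramidPolytope P := by
  classical
  obtain ⟨x₀, hx₀, hℓx₀⟩ := h.exists_eq (Pi.single k 1) (by simp) (by simp [Pi.single_apply, hk])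
  have hx₀P : x₀ ∈ P := h.mem x₀ hx₀ fun k' => by
    rw [hℓx₀, Pi.single_apply]
    split_ifs <;> norm_num
  have hspan : ∀ {x}, x ∈ P → x ∈ affineSpan ℝ P := fun hx => subset_affineSpan ℝ P hx
  have hunique : ∀ x ∈ P, (∀ k' ≠ k, ℓ k' x = 0) → x = x₀ := by
    intro x hx hx'
    refine h.eq_of_forall x (hspan hx) x₀ hx₀ fun k' => ?_
    rw [hℓx₀, Pi.single_apply]
    split_ifs with hkk
    · subst hkk
      rw [← h.sum_eq_one x (hspan hx), Finset.sum_eq_single_of_mem k' (Finset.mem_univ _)]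
      exact fun j _ hj => hx' j hj
    · exact hx' k' hkk
  refine ⟨{x ∈ P | ℓ k x = 0}, x₀, h.isFacetOf k, ?_, ?_⟩
  · have heq : {x₀} = commonZeros P ℓ {k}ᶜ := by
      ext x
      constructor
      · rintro rfl
        refine ⟨hx₀P, fun k' hk' => ?_⟩
        rw [hℓx₀, Pi.single_eq_of_ne hk']
      · exact fun hx => hunique x hx.1 fun k' hk' => hx.2 k' hk'
    rw [IsVertexOf, heq]
    exact isFaceOf_commonZeros h.nonneg _
  · apply Subset.antisymm
    · intro x hx
      set s := ℓ k x with hs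
      have hs₀ : 0 ≤ s := h.nonneg x hx k
      have hs₁ : s ≤ 1 := by
        rw [← h.sum_eq_one x (hspan hx)]
        exact Finset.single_le_sum (f := fun k => ℓ k x) (fun j _ => h.nonneg x hx j)
          (Finset.mem_univ k)
      rcases hs₁.eq_or_lt with hs₁ | hs₁
      · have hxx : x = x₀ := by
          refine hunique x hx fun k' hk' => ?_
          have hsum := h.sum_eq_one x (hspan hx)
          rw [← Finset.add_sum_erase _ _ (Finset.mem_univ k), ← hs, hs₁, add_eq_left,
            Finset.sum_eq_zero_iff_of_nonneg fun j _ => h.nonneg x hx j] at hsum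
          exact hsum k' (Finset.mem_erase.2 ⟨hk', Finset.mem_univ _⟩)
        rw [hxx]
        exact subset_convexHull ℝ _ (Or.inr rfl)
      · have hs₂ : 1 - s ≠ 0 := by linarith
        obtain ⟨z, hz, hℓz⟩ := h.exists_eq
          (fun j => (ℓ j x - s * (Pi.single k 1 : κ → ℝ) j) / (1 - s))
          (by
            rw [← Finset.sum_div, Finset.sum_sub_distrib, h.sum_eq_one x (hspan hx),
              ← Finset.mul_sum]
            simp [hs₂])
          (by
            simp only [← mul_div_assoc, mul_sub]
            rw [← Finset.sum_div, Finset.sum_sub_distrib, h.sum_mul_eq_zero x (hspan hx)]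
            simp [Pi.single_apply, hk])
        have hzP : z ∈ P := by
          refine h.mem z hz fun j => ?_
          rw [hℓz]
          refine div_nonneg ?_ (by linarith)
          rcases eq_or_ne j k with rfl | hj
          · simp [hs]
          · simpa [Pi.single_eq_of_ne hj] using h.nonneg x hx j
        have hx_eq : x = AffineMap.lineMap z x₀ s := by
          refine h.eq_of_forall x (hspan hx) _ (AffineMap.lineMap_mem s hz hx₀) fun j => ?_
          rw [AffineMap.apply_lineMap, AffineMap.lineMap_apply_ring, hℓz, hℓx₀]
          field_simp
          ring
        rw [hx_eq]
        refine Convex.lineMap_mem (convex_convexHull ℝ _) ?_ ?_ ⟨hs₀, hs₁.le⟩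
        · refine subset_convexHull ℝ _ (Or.inl ⟨hzP, ?_⟩)
          simp [hℓz, hs]
        · exact subset_convexHull ℝ _ (Or.inr rfl)
    · refine convexHull_min ?_ hconv
      rintro x (hx | rfl)
      · exact hx.1
      · exact hx₀P

theorem exists_isProductPresentation (h : IsHyperplaneForm P ℓ a) (hconv : Convex ℝ P)
    (ha : ∀ k, a k ≠ 0) :
    ∃ v, IsProductPresentation (I := {k // 0 < a k}) (J := {k // ¬ 0 < a k}) P v
      (Sum.elim (fun i => ℓ i) fun j => ℓ j) := by
  classical
  have hJ : ∀ j : {k // ¬ 0 < a k}, a j < 0 := fun j => lt_of_le_of_ne (not_lt.1 j.2) (ha j)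
  have hIJ : ∀ (i : {k // 0 < a k}) (j : {k // ¬ 0 < a k}), 0 < a i - a j :=
    fun i j => by linarith [i.2, hJ j]
  have hne : ∀ (i : {k // 0 < a k}) (j : {k // ¬ 0 < a k}), (j : κ) ≠ i :=
    fun i j hij => j.2 (hij ▸ i.2)
  have hspan : ∀ {x}, x ∈ P → x ∈ affineSpan ℝ P := fun hx => subset_affineSpan ℝ P hx
  choose v hv hℓv using fun p : {k // 0 < a k} × {k // ¬ 0 < a k} => h.exists_eq
    (fun k => (Pi.single p.1.1 (-a p.2 / (a p.1 - a p.2)) : κ → ℝ) k +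
      (Pi.single p.2.1 (a p.1 / (a p.1 - a p.2)) : κ → ℝ) k)
    (by
      have := (hIJ p.1 p.2).ne'
      rw [Finset.sum_add_distrib, Fintype.sum_pi_single', Fintype.sum_pi_single']
      field_simp
      ring)
    (by
      have := (hIJ p.1 p.2).ne'
      simp only [mul_add, Finset.sum_add_distrib, Pi.single_apply, mul_ite, mul_zero,
        Finset.sum_ite_eq', Finset.mem_univ, if_true]
      field_simp
      ring)
  have hvI : ∀ (i : {k // 0 < a k}) p, ℓ i (v p) = if p.1 = i then -a p.2 / (a p.1 - a p.2)
      else 0 := by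
    intro i p
    rw [hℓv, Pi.single_eq_of_ne (hne i p.2).symm, add_zero, Pi.single_apply]
    simp [Subtype.ext_iff, eq_comm]
  have hvJ : ∀ (j : {k // ¬ 0 < a k}) p, ℓ j (v p) = if p.2 = j then a p.1 / (a p.1 - a p.2)
      else 0 := by
    intro j p
    rw [hℓv, Pi.single_eq_of_ne (hne p.1 j), zero_add, Pi.single_apply]
    simp [Subtype.ext_iff, eq_comm]
  have hcoef₁ : ∀ p : {k // 0 < a k} × {k // ¬ 0 < a k}, 0 < -a p.2 / (a p.1 - a p.2) :=
    fun p => div_pos (neg_pos.2 (hJ p.2)) (hIJ p.1 p.2)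
  have hcoef₂ : ∀ p : {k // 0 < a k} × {k // ¬ 0 < a k}, 0 < a p.1 / (a p.1 - a p.2) :=
    fun p => div_pos p.1.2 (hIJ p.1 p.2)
  have hvP : ∀ p, v p ∈ P := by
    refine fun p => h.mem _ (hv p) fun k => ?_
    by_cases hk : 0 < a k
    · rw [hvI ⟨k, hk⟩]
      split_ifs
      · exact (hcoef₁ p).le
      · exact le_rfl
    · rw [hvJ ⟨k, hk⟩]
      split_ifs
      · exact (hcoef₂ p).le
      · exact le_rfl
  have hsplit : ∀ f : κ → ℝ, ∑ i : {k // 0 < a k}, f i + ∑ j : {k // ¬ 0 < a k}, f j = ∑ k, f k :=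
    fun f => Fintype.sum_subtype_add_sum_subtype (fun k => 0 < a k) f
  refine ⟨v, ⟨⟨?_, ?_, ?_, ?_⟩, ?_, ?_⟩⟩
  · refine Subset.antisymm (fun x hx => ?_)
      (convexHull_min (by rintro _ ⟨p, rfl⟩; exact hvP p) hconv)
    set c := ∑ i : {k // 0 < a k}, a i * ℓ i x with hc
    have hsum := h.sum_eq_one x (hspan hx)
    rw [← hsplit] at hsum
    have hc' : ∑ j : {k // ¬ 0 < a k}, -a j * ℓ j x = c := by
      have h₁ := h.sum_mul_eq_zero x (hspan hx)
      rw [← hsplit] at h₁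
      simp only [neg_mul, Finset.sum_neg_distrib]
      linarith
    have hnI : ∀ i : {k // 0 < a k}, 0 ≤ a i * ℓ i x :=
      fun i => mul_nonneg i.2.le (h.nonneg x hx i)
    have hnJ : ∀ j : {k // ¬ 0 < a k}, 0 ≤ -a j * ℓ j x :=
      fun j => mul_nonneg (neg_nonneg.2 (hJ j).le) (h.nonneg x hx j)
    have hc_pos : 0 < c := by
      refine lt_of_le_of_ne (Finset.sum_nonneg fun i _ => hnI i) fun h₀ => ?_
      rw [← h₀, Finset.sum_eq_zero_iff_of_nonneg fun j _ => hnJ j] at hc'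
      rw [hc, eq_comm, Finset.sum_eq_zero_iff_of_nonneg fun i _ => hnI i] at h₀
      have hI₀ : ∀ i : {k // 0 < a k}, ℓ i x = 0 := fun i =>
        (mul_eq_zero.1 (h₀ i (Finset.mem_univ i))).resolve_left (ha i)
      have hJ₀ : ∀ j : {k // ¬ 0 < a k}, ℓ j x = 0 := fun j =>
        (mul_eq_zero.1 (hc' j (Finset.mem_univ j))).resolve_left (neg_ne_zero.2 (ha j))
      simp [hI₀, hJ₀] at hsum
    let θ : {k // 0 < a k} × {k // ¬ 0 < a k} → ℝ :=
      fun p => ℓ p.1 x * ℓ p.2 x * (a p.1 - a p.2) / c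
    have hθ : ∀ p, 0 ≤ θ p := fun p => div_nonneg (mul_nonneg (mul_nonneg (h.nonneg x hx _)
      (h.nonneg x hx _)) (hIJ _ _).le) hc_pos.le
    have hθI : ∀ i, ∑ j, θ (i, j) * (-a j / (a i - a j)) = ℓ i x := by
      intro i
      calc ∑ j, θ (i, j) * (-a j / (a i - a j)) = ∑ j : {k // ¬ 0 < a k},
            ℓ i x / c * (-a j * ℓ j x) := by
            refine Finset.sum_congr rfl fun j _ => ?_
            have := (hIJ i j).ne'
            simp only [θ]
            field_simp
        _ = ℓ i x := by rw [← Finset.mul_sum, hc', div_mul_cancel₀ _ hc_pos.ne']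
    have hθJ : ∀ j, ∑ i, θ (i, j) * (a i / (a i - a j)) = ℓ j x := by
      intro j
      calc ∑ i, θ (i, j) * (a i / (a i - a j)) = ∑ i : {k // 0 < a k},
            ℓ j x / c * (a i * ℓ i x) := by
            refine Finset.sum_congr rfl fun i _ => ?_
            have := (hIJ i j).ne'
            simp only [θ]
            field_simp
        _ = ℓ j x := by rw [← Finset.mul_sum, ← hc, div_mul_cancel₀ _ hc_pos.ne']
    have hθsum : ∑ p, θ p = 1 := by
      rw [← hsum]
      simp only [← hθI, ← hθJ]
      rw [Finset.sum_comm (γ := {k // ¬ 0 < a k}), ← Finset.sum_add_distrib,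
        Fintype.sum_prod_type]
      refine Finset.sum_congr rfl fun i _ => ?_
      rw [← Finset.sum_add_distrib]
      refine Finset.sum_congr rfl fun j _ => ?_
      have := (hIJ i j).ne'
      field_simp
      ring
    have hx_eq : x = ∑ p, θ p • v p := by
      refine h.eq_of_forall x (hspan hx) _
        (hspan (hconv.sum_mem (fun p _ => hθ p) hθsum fun p _ => hvP p)) fun k => ?_
      rw [AffineMap.map_sum_smul _ _ _ _ hθsum]
      by_cases hk : 0 < a k
      · simp only [hvI ⟨k, hk⟩, Fintype.sum_prod_type_right, mul_ite, mul_zero,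
          Finset.sum_ite_eq', Finset.mem_univ, if_true]
        exact (hθI ⟨k, hk⟩).symm
      · simp only [hvJ ⟨k, hk⟩, Fintype.sum_prod_type, mul_ite, mul_zero,
          Finset.sum_ite_eq', Finset.mem_univ, if_true]
        exact (hθJ ⟨k, hk⟩).symm
    rw [hx_eq]
    exact (convex_convexHull ℝ _).sum_mem (fun p _ => hθ p) hθsum
      fun p _ => subset_convexHull ℝ _ (mem_range_self p)
  · rintro x hx (i | j)
    · exact h.nonneg x hx i
    · exact h.nonneg x hx j
  · refine fun x hx hk => h.mem x hx fun k => ?_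
    by_cases hk' : 0 < a k
    · exact hk (Sum.inl ⟨k, hk'⟩)
    · exact hk (Sum.inr ⟨k, hk'⟩)
  · intro x hx
    by_contra! hcon
    have hsum := h.sum_eq_one x (hspan hx)
    rw [← hsplit] at hsum
    have hI₀ : ∀ i : {k // 0 < a k}, ℓ i x = 0 := fun i => hcon (Sum.inl i)
    have hJ₀ : ∀ j : {k // ¬ 0 < a k}, ℓ j x = 0 := fun j => hcon (Sum.inr j)
    simp [hI₀, hJ₀] at hsum
  · intro i p
    rw [Sum.elim_inl, hvI]
    simp [(hcoef₁ p).ne']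
  · intro j p
    rw [Sum.elim_inr, hvJ]
    simp [(hcoef₂ p).ne']

end IsHyperplaneForm

theorem vertexCount_prodP (n m : ℕ) : vertexCount (prodP n m) = (n + 1) * (m + 1) := by
  simpa using (isProductPresentation_prodP (n := n) (m := m)).vertexCount_eq

theorem nonpyramid_d_plus_two_facets (N d : ℕ) (P : Set (Fin N → ℝ))
    (hP : IsPolytope P) (hdP : pdim P = d) (hv : vertexCount P = d + 4)
    (hnp : ¬ IsPyramidPolytope P) :
    (facetCount P = d + 2 ↔ CombEquiv P (prodP 1 3)) ∧
    (facetCount P = d + 2 → d = 4) := by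
  classical
  have hnt : P.Nontrivial := by
    have hlt : 1 < (vertexSet P).ncard := by
      have : (vertexSet P).ncard = d + 4 := hv
      omega
    exact (one_lt_ncard_iff_nontrivial_and_finite.1 hlt).1.mono fun x hx =>
      IsVertexOf.mem hx
  have hQ := isProductPresentation_prodP (n := 1) (m := 3)
  have hforward : facetCount P = d + 2 → CombEquiv P (prodP 1 3) ∧ d = 4 := by
    intro hf
    have := hP.finite_facets
    have := Fintype.ofFinite {F // IsFacetOf F P}
    have hcard : Fintype.card {F // IsFacetOf F P} = d + 2 := by
      rw [← Nat.card_eq_fintype_card, ← hf]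
      rfl
    obtain ⟨ℓ, a, h⟩ := hP.exists_isHyperplaneForm hnt hdP hcard
    obtain ⟨v, hpres⟩ := h.exists_isProductPresentation hP.convex
      fun k hk => hnp (h.isPyramidPolytope hP.convex hk)
    have hprod := hpres.vertexCount_eq
    have hsum := Nat.card_congr (Equiv.sumCompl fun k => 0 < a k)
    rw [Nat.card_sum, Nat.card_eq_fintype_card (α := {F // IsFacetOf F P}), hcard] at hsum
    rw [hv] at hprod
    have hcases : ∀ p q : ℕ, d + 4 = p * q → p + q = d + 2 →
        (p = 2 ∧ q = 4 ∨ p = 4 ∧ q = 2) ∧ d = 4 := by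
      intro p q hpq hpq'
      have hp : 2 ≤ p := by
        by_contra! hp
        interval_cases p <;> omega
      have hq : 2 ≤ q := by
        by_contra! hq
        interval_cases q <;> omega
      have hp' : p ≤ 4 := by nlinarith
      interval_cases p <;> omega
    obtain ⟨hpq, hd⟩ := hcases _ _ hprod hsum
    refine ⟨?_, hd⟩
    have hcard₂ : Nat.card (Option (Fin 1)) = 2 := by simp
    have hcard₄ : Nat.card (Option (Fin 3)) = 4 := by simp
    rcases hpq with ⟨hI, hJ⟩ | ⟨hI, hJ⟩
    · obtain ⟨e⟩ := Finite.card_eq.1 (hI.trans hcard₂.symm)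
      obtain ⟨f⟩ := Finite.card_eq.1 (hJ.trans hcard₄.symm)
      exact hpres.combEquiv hQ e f
    · obtain ⟨e⟩ := Finite.card_eq.1 (hI.trans hcard₄.symm)
      obtain ⟨f⟩ := Finite.card_eq.1 (hJ.trans hcard₂.symm)
      exact hpres.combEquiv_swap hQ e f
  refine ⟨⟨fun hf => (hforward hf).1, fun hcomb => ?_⟩, fun hf => (hforward hf).2⟩
  obtain ⟨e⟩ := combEquiv_iff_nonempty_orderIso.1 hcomb
  have hatoms : vertexCount P = vertexCount (prodP 1 3) := by
    rw [hP.vertexCount_eq_card_isAtom, hQ.isPolytope.vertexCount_eq_card_isAtom]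
    exact Nat.card_congr (e.toEquiv.subtypeEquiv fun F => (e.isAtom_iff F).symm)
  have hcoatoms : facetCount P = 6 := by
    rw [hP.facetCount_eq_card_isCoatom hnt,
      Nat.card_congr (e.toEquiv.subtypeEquiv fun F => (e.isCoatom_iff F).symm), hQ.card_isCoatom]
    simp
  rw [hv, vertexCount_prodP] at hatoms
  omega

end
end

section
/- Let P be a simplicial d-dimensional polytope with n vertices. For every ε > 0 there exists a simplicial d-dimensional polytope P', combinatorially equivalent to P, with all vertex coordinates rational, whose Hausdorff distance to P is less than ε, and such that xc(P') ≥ 2·√(d·n − d) − d + 1. -/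
open Set

noncomputable section

section

open Module Filter Topology

/-- Rational functions in fewer variables than there are functions satisfy a nontrivial
polynomial relation at every point where all denominators are nonzero. -/
theorem exists_polynomial_relation {σ τ : Type} [Fintype σ] [Fintype τ]
    (hcard : Fintype.card σ < Fintype.card τ) (num den : τ → MvPolynomial σ ℝ) :
    ∃ R : MvPolynomial τ ℝ, R ≠ 0 ∧ ∀ x : σ → ℝ, (∀ t, MvPolynomial.eval x (den t) ≠ 0) →
      MvPolynomial.eval
        (fun t => MvPolynomial.eval x (num t) / MvPolynomial.eval x (den t)) R = 0 := by
  classical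
  by_cases hden : ∃ t, den t = 0
  · obtain ⟨t, ht⟩ := hden
    exact ⟨1, one_ne_zero, fun x hx => absurd (by simp [ht]) (hx t)⟩
  push Not at hden
  set q : MvPolynomial σ ℝ := ∏ t, den t with hq
  have hq0 : q ≠ 0 := Finset.prod_ne_zero_iff.mpr fun t _ => hden t
  have hM : Submonoid.powers q ≤ nonZeroDivisors (MvPolynomial σ ℝ) :=
    powers_le_nonZeroDivisors_of_noZeroDivisors hq0
  set S := Localization.Away q
  have : IsDomain S := IsLocalization.isDomain_localization hM
  have hinj : Function.Injective (algebraMap (MvPolynomial σ ℝ) S) := IsLocalization.injective S hM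
  have : FaithfulSMul (MvPolynomial σ ℝ) S := (faithfulSMul_iff_algebraMap_injective _ S).mpr hinj
  have : Algebra.IsAlgebraic (MvPolynomial σ ℝ) S :=
    IsLocalization.isAlgebraic S (Submonoid.powers q)
  have htr : Algebra.trdeg ℝ S = (Fintype.card σ : Cardinal) := by
    rw [← trdeg_add_eq ℝ (MvPolynomial σ ℝ) (A := S),
      trdeg_eq_zero (R := MvPolynomial σ ℝ) (A := S), add_zero,
      MvPolynomial.trdeg_of_isDomain]
    simp
  have hdvd : ∀ t, den t * ∏ t' ∈ Finset.univ.erase t, den t' = q := fun t =>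
    Finset.mul_prod_erase _ _ (Finset.mem_univ t)
  set r : τ → S := fun t => IsLocalization.mk' S (num t * ∏ t' ∈ Finset.univ.erase t, den t')
    (⟨q, Submonoid.mem_powers q⟩ : Submonoid.powers q) with hr
  have hdep : ¬ AlgebraicIndependent ℝ r := by
    intro h
    have := h.lift_cardinalMk_le_trdeg
    rw [htr] at this
    simp at this
    omega
  rw [algebraicIndependent_iff] at hdep
  push Not at hdep
  obtain ⟨R, hR, hR0⟩ := hdep
  refine ⟨R, hR0, fun x hx => ?_⟩
  have hqx : ∀ y : Submonoid.powers q,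
      IsUnit (MvPolynomial.aeval (R := ℝ) x (y : MvPolynomial σ ℝ)) := by
    rintro ⟨_, k, rfl⟩
    simp only [map_pow, hq, map_prod]
    refine IsUnit.pow _ (IsUnit.mk0 _ (Finset.prod_ne_zero_iff.mpr fun t _ => ?_))
    simpa [MvPolynomial.aeval_eq_eval] using hx t
  set ψ : S →ₐ[ℝ] ℝ := IsLocalization.liftAlgHom (M := Submonoid.powers q) (S := S) hqx with hψ
  have key : ∀ t, ψ (r t) = MvPolynomial.eval x (num t) / MvPolynomial.eval x (den t) := by
    intro t
    have hmul : algebraMap (MvPolynomial σ ℝ) S (den t) * r t =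
        algebraMap (MvPolynomial σ ℝ) S (num t) := by
      rw [hr]
      simp only
      rw [← IsLocalization.mk'_one (M := Submonoid.powers q) S (den t), ← IsLocalization.mk'_mul,
        ← IsLocalization.mk'_one (M := Submonoid.powers q) S (num t), IsLocalization.mk'_eq_iff_eq]
      congr 1
      simp only [Submonoid.coe_one, one_mul]
      rw [← hdvd t]; ring
    have h2 := congrArg ψ hmul
    have hev : ∀ a : MvPolynomial σ ℝ,
        ψ (algebraMap (MvPolynomial σ ℝ) S a) = MvPolynomial.eval x a := fun a => by
      rw [hψ, IsLocalization.liftAlgHom_apply, IsLocalization.lift_eq]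
      rfl
    rw [map_mul, hev, hev] at h2
    rw [eq_div_iff (hx t), mul_comm, h2]
  have h3 := congrArg ψ hR
  rw [map_zero, MvPolynomial.aeval_def, ← AlgHom.coe_toRingHom, MvPolynomial.hom_eval₂] at h3
  rw [← h3, MvPolynomial.eval, MvPolynomial.coe_eval₂Hom]
  congr 1
  · ext a; simp
  · funext t; exact (key t).symm

/-- A nonzero polynomial does not vanish at some rational point close to any given point. -/
theorem exists_rat_eval_ne_zero {τ : Type} [Fintype τ] {R : MvPolynomial τ ℝ} (hR : R ≠ 0)
    (x : τ → ℝ) {δ : ℝ} (hδ : 0 < δ) :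
    ∃ q : τ → ℚ, (∀ t, |(q t : ℝ) - x t| < δ) ∧ MvPolynomial.eval (fun t => (q t : ℝ)) R ≠ 0 := by
  by_contra! h
  refine hR (MvPolynomial.funext_set
    (fun t => ((↑) : ℚ → ℝ) '' {q : ℚ | |(q : ℝ) - x t| < δ}) (fun t => ?_) (fun y hy => ?_))
  · refine Set.Infinite.image (Rat.cast_injective.injOn) ?_
    obtain ⟨a, ha1, ha2⟩ := exists_rat_btwn (show x t - δ < x t by linarith)
    obtain ⟨b, hb1, hb2⟩ := exists_rat_btwn (show x t < x t + δ by linarith)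
    have hab : a < b := by exact_mod_cast ha2.trans hb1
    refine (Set.Ioo_infinite hab).mono fun q hq => ?_
    have h1 : (a : ℝ) < q := by exact_mod_cast hq.1
    have h2 : (q : ℝ) < b := by exact_mod_cast hq.2
    simp only [Set.mem_ofPred_eq, abs_lt]
    constructor <;> linarith
  · choose q hq1 hq2 using fun t => hy t (Set.mem_univ t)
    have : y = fun t => (q t : ℝ) := funext fun t => (hq2 t).symm
    rw [this, map_zero]
    exact h q hq1

/-- The index sets of the faces of the cone spanned by a family of vectors. -/
def faceSets {ι V : Type*} [AddCommGroup V] [Module ℝ V] (w : ι → V) : Set (Set ι) :=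
  {I | ∃ g : Dual ℝ V, (∀ i, 0 ≤ g (w i)) ∧ I = {i | g (w i) = 0}}

/-- A functional which is nonnegative on a family of vectors and whose zeros among these vectors
span a subspace of codimension one in the span of the family. -/
def IsFacetFunctional {ι V : Type*} [AddCommGroup V] [Module ℝ V] (w : ι → V)
    (g : Dual ℝ V) : Prop :=
  (∀ i, 0 ≤ g (w i)) ∧
    finrank ℝ (Submodule.span ℝ (w '' {i | g (w i) = 0})) + 1 =
      finrank ℝ (Submodule.span ℝ (range w))

section Cones

variable {ι V : Type*} [AddCommGroup V] [Module ℝ V]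

theorem univ_mem_faceSets (w : ι → V) : univ ∈ faceSets w :=
  ⟨0, fun _ => le_rfl, by simp⟩

theorem faceSets_comp {V' : Type*} [AddCommGroup V'] [Module ℝ V'] (w : ι → V)
    {Φ : V →ₗ[ℝ] V'} (hΦ : Function.Injective Φ) : faceSets (fun i => Φ (w i)) = faceSets w := by
  obtain ⟨Ψ, hΨ⟩ := Φ.exists_leftInverse_of_injective (LinearMap.ker_eq_bot.mpr hΦ)
  have hval : ∀ x, Ψ (Φ x) = x := fun x => LinearMap.congr_fun hΨ x
  ext I
  constructor
  · rintro ⟨g, hg, rfl⟩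
    exact ⟨g ∘ₗ Φ, hg, rfl⟩
  · rintro ⟨g, hg, rfl⟩
    exact ⟨g ∘ₗ Ψ, by simpa [hval] using hg, by simp [hval]⟩

/-- A nonnegative functional can be moved in a direction vanishing on its zeros until it
acquires a new zero. -/
theorem exists_add_smul_nonneg [Finite ι] (w : ι → V) (g h : Dual ℝ V) (hg : ∀ i, 0 ≤ g (w i))
    (hh : ∀ i, g (w i) = 0 → h (w i) = 0) (hneg : ∃ i, h (w i) < 0) :
    ∃ t : ℝ, (∀ i, 0 ≤ (g + t • h) (w i)) ∧ ∃ i, g (w i) ≠ 0 ∧ (g + t • h) (w i) = 0 := by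
  obtain ⟨i, hi, hmin⟩ := Set.exists_min_image {i | h (w i) < 0}
    (fun i => g (w i) / (-h (w i))) (toFinite _) hneg
  simp only [Set.mem_ofPred_eq] at hi hmin
  refine ⟨g (w i) / (-h (w i)), fun j => ?_, i, fun h0 => hi.ne (hh i h0), ?_⟩
  · simp only [LinearMap.add_apply, LinearMap.smul_apply, smul_eq_mul]
    rcases lt_or_ge (h (w j)) 0 with hj | hj
    · have := hmin j hj
      rw [le_div_iff₀ (by linarith)] at this
      linarith
    · have : 0 ≤ g (w i) / (-h (w i)) := div_nonneg (hg i) (by linarith)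
      have := mul_nonneg this hj
      have := hg j
      linarith
  · simp only [LinearMap.add_apply, LinearMap.smul_apply, smul_eq_mul]
    rw [div_neg, neg_mul, div_mul_cancel₀ _ hi.ne, add_neg_cancel]

theorem exists_isFacetFunctional [Finite ι] [FiniteDimensional ℝ V] (w : ι → V) {x : V}
    (hx : x ∈ Submodule.span ℝ (range w)) (g : Dual ℝ V) (hg : ∀ i, 0 ≤ g (w i)) (hgx : g x < 0) :
    ∃ f : Dual ℝ V, IsFacetFunctional w f ∧ (∀ i, g (w i) = 0 → f (w i) = 0) ∧ f x < 0 := by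
  induction hk : {i | g (w i) ≠ 0}.ncard using Nat.strong_induction_on generalizing g with
  | _ k ih =>
    set Z := Submodule.span ℝ (w '' {i | g (w i) = 0}) with hZ
    set W := Submodule.span ℝ (range w) with hW
    have hZker : Z ≤ g.ker := Submodule.span_le.mpr (by rintro _ ⟨i, hi, rfl⟩; exact hi)
    have hZW : Z < W := by
      refine lt_of_le_of_ne (Submodule.span_mono (image_subset_range _ _)) fun h => ?_
      exact hgx.ne (hZker (h ▸ hx))
    by_cases hcod : finrank ℝ Z + 1 = finrank ℝ W
    · exact ⟨g, ⟨hg, hcod⟩, fun i hi => hi, hgx⟩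
    have hlt : finrank ℝ Z + 1 < finrank ℝ W := by
      have := Submodule.finrank_lt_finrank_of_lt hZW
      omega
    have hnot : ¬ W ≤ Z ⊔ Submodule.span ℝ {x} := by
      intro h
      have h1 := Submodule.finrank_mono h
      have h2 := Submodule.finrank_add_le_finrank_add_finrank Z (Submodule.span ℝ {x})
      have h3 := finrank_span_le_card (R := ℝ) ({x} : Set V)
      simp only [toFinset_singleton, Finset.card_singleton] at h3
      omega
    obtain ⟨h, hhW, hhZ⟩ : ∃ h : Dual ℝ V, ¬ W ≤ h.ker ∧ Z ⊔ Submodule.span ℝ {x} ≤ h.ker := by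
      obtain ⟨y, hyW, hy⟩ := SetLike.not_le_iff_exists.mp hnot
      obtain ⟨h, hhy, hh⟩ := Submodule.exists_dual_map_eq_bot_of_notMem hy inferInstance
      refine ⟨h, fun hle => hhy (hle hyW), ?_⟩
      rwa [LinearMap.le_ker_iff_map]
    have hexi : ∃ i, h (w i) ≠ 0 := by
      by_contra! hall
      exact hhW (Submodule.span_le.mpr (by rintro _ ⟨i, rfl⟩; exact hall i))
    have hhx : h x = 0 := hhZ (Submodule.mem_sup_right (Submodule.mem_span_singleton_self x))
    have hhz : ∀ i, g (w i) = 0 → h (w i) = 0 := fun i hi =>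
      hhZ (Submodule.mem_sup_left (Submodule.subset_span ⟨i, hi, rfl⟩))
    obtain ⟨h', hh'x, hh'z, hneg⟩ : ∃ h' : Dual ℝ V, h' x = 0 ∧
        (∀ i, g (w i) = 0 → h' (w i) = 0) ∧ ∃ i, h' (w i) < 0 := by
      obtain ⟨i, hi⟩ := hexi
      rcases lt_or_gt_of_ne hi with hi | hi
      · exact ⟨h, hhx, hhz, i, hi⟩
      · exact ⟨-h, by simp [hhx], fun j hj => by simp [hhz j hj], i, by simpa using hi⟩
    obtain ⟨t, ht, i, hi0, hit⟩ := exists_add_smul_nonneg w g h' hg hh'z hneg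
    have hsub : ∀ j, g (w j) = 0 → (g + t • h') (w j) = 0 := fun j hj => by simp [hj, hh'z j hj]
    have hcard : {i | (g + t • h') (w i) ≠ 0}.ncard < k := by
      rw [← hk]
      refine Set.ncard_lt_ncard ⟨fun j hj h0 => hj (hsub j h0), fun hle => ?_⟩ (toFinite _)
      exact hle hi0 hit
    obtain ⟨f, hf, hfz, hfx⟩ := ih _ hcard (g + t • h') ht (by simpa [hh'x] using hgx) rfl
    exact ⟨f, hf, fun j hj => hfz j (hsub j hj), hfx⟩

theorem exists_pos_forall_add_mul_pos [Finite ι] (a b : ι → ℝ) :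
    ∃ δ : ℝ, 0 < δ ∧ ∀ i, 0 < a i → 0 < a i + δ * b i := by
  have h : ∀ i, ∀ᶠ δ in 𝓝[>] (0 : ℝ), 0 < a i → 0 < a i + δ * b i := fun i => by
    by_cases hi : 0 < a i
    · have hc : Tendsto (fun δ : ℝ => a i + δ * b i) (𝓝[>] 0) (𝓝 (a i + 0 * b i)) :=
        (Continuous.tendsto (by fun_prop) 0).mono_left nhdsWithin_le_nhds
      rw [zero_mul, add_zero] at hc
      filter_upwards [hc.eventually_const_lt hi] with δ hδ _ using hδ
    · exact Eventually.of_forall fun δ h => absurd h hi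
  obtain ⟨δ, h1, h2⟩ := ((eventually_all.mpr h).and self_mem_nhdsWithin).exists
  exact ⟨δ, h2, h1⟩

/-- The facets through a vertex meet, within the linear span, only in the line of the vertex. -/
theorem mem_span_singleton_of_facets [Finite ι] [FiniteDimensional ℝ V] (w : ι → V) {t : ι}
    (ht : {t} ∈ faceSets w) {x : V} (hx : x ∈ Submodule.span ℝ (range w))
    (hfx : ∀ f, IsFacetFunctional w f → f (w t) = 0 → f x = 0) :
    x ∈ Submodule.span ℝ {w t} := by
  obtain ⟨g, hg, hgt⟩ := ht
  have hgt0 : g (w t) = 0 := (hgt ▸ mem_singleton t : t ∈ {i | g (w i) = 0})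
  by_contra hxt
  suffices h : ∃ (g' : Dual ℝ V) (y : V), y ∈ Submodule.span ℝ (range w) ∧
      (∀ i, 0 ≤ g' (w i)) ∧ g' (w t) = 0 ∧ g' y < 0 ∧ (y = x ∨ y = -x) by
    obtain ⟨g', y, hy, hg', hg't, hg'y, hyx⟩ := h
    obtain ⟨f, hf, hfz, hfy⟩ := exists_isFacetFunctional w hy g' hg' hg'y
    have := hfx f hf (hfz t hg't)
    rcases hyx with rfl | rfl <;> simp [this] at hfy
  rcases lt_trichotomy (g x) 0 with h | h | h
  · exact ⟨g, x, hx, hg, hgt0, h, Or.inl rfl⟩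
  · obtain ⟨h', hh'x, hh't⟩ := Submodule.exists_dual_map_eq_bot_of_notMem hxt inferInstance
    rw [← LinearMap.le_ker_iff_map, Submodule.span_singleton_le_iff_mem, LinearMap.mem_ker] at hh't
    obtain ⟨δ, hδ, hpos⟩ := exists_pos_forall_add_mul_pos (fun i => g (w i)) (fun i => h' (w i))
    have hval : ∀ i, 0 ≤ (g + δ • h') (w i) := fun i => by
      simp only [LinearMap.add_apply, LinearMap.smul_apply, smul_eq_mul]
      by_cases hi : g (w i) = 0
      · have : i = t := by
          have : i ∈ ({t} : Set ι) := hgt ▸ hi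
          exact this
        subst this
        simp [hgt0, hh't]
      · exact (hpos i (lt_of_le_of_ne (hg i) (Ne.symm hi))).le
    rcases lt_or_gt_of_ne hh'x with h1 | h1
    · exact ⟨g + δ • h', x, hx, hval, by simp [hgt0, hh't], by
        simpa [h] using mul_neg_of_pos_of_neg hδ h1, Or.inl rfl⟩
    · exact ⟨g + δ • h', -x, Submodule.neg_mem _ hx, hval, by simp [hgt0, hh't], by
        simpa [h] using mul_pos hδ h1, Or.inr rfl⟩
  · exact ⟨g, -x, Submodule.neg_mem _ hx, hg, hgt0, by simpa using h, Or.inr rfl⟩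

end Cones

/-- The lift of a point to the affine hyperplane at height one. -/
def homog {N : ℕ} (x : Fin N → ℝ) : (Fin N → ℝ) × ℝ := (x, 1)

section Homogenization

variable {N : ℕ}

theorem dual_homog_sum {κ : Type*} (g : Dual ℝ ((Fin N → ℝ) × ℝ)) (s : Finset κ) (a : κ → ℝ)
    (z : κ → Fin N → ℝ) (ha : ∑ k ∈ s, a k = 1) :
    g (homog (∑ k ∈ s, a k • z k)) = ∑ k ∈ s, a k * g (homog (z k)) := by
  have : homog (∑ k ∈ s, a k • z k) = ∑ k ∈ s, a k • homog (z k) := by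
    ext <;> simp [homog, Prod.fst_sum, Prod.snd_sum, ha]
  rw [this, map_sum]
  simp

theorem convex_dual_homog_nonneg (g : Dual ℝ ((Fin N → ℝ) × ℝ)) :
    Convex ℝ {x : Fin N → ℝ | 0 ≤ g (homog x)} := by
  rw [convex_iff_sum_mem]
  intro s w hw hsum hz
  simp only [Set.mem_ofPred_eq] at hz ⊢
  rw [dual_homog_sum g s w (fun x => x) hsum]
  exact Finset.sum_nonneg fun i hi => mul_nonneg (hw i hi) (hz i hi)

theorem dual_homog_nonneg_of_mem_convexHull {g : Dual ℝ ((Fin N → ℝ) × ℝ)}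
    {X : Set (Fin N → ℝ)} (hg : ∀ x ∈ X, 0 ≤ g (homog x)) {x : Fin N → ℝ}
    (hx : x ∈ convexHull ℝ X) : 0 ≤ g (homog x) :=
  convexHull_min (t := {x : Fin N → ℝ | 0 ≤ g (homog x)}) hg (convex_dual_homog_nonneg g) hx

theorem dual_homog_eq_zero_of_mem_convexHull {g : Dual ℝ ((Fin N → ℝ) × ℝ)}
    {X : Set (Fin N → ℝ)} (hg : ∀ x ∈ X, g (homog x) = 0) {x : Fin N → ℝ}
    (hx : x ∈ convexHull ℝ X) : g (homog x) = 0 := by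
  have h1 := dual_homog_nonneg_of_mem_convexHull (g := g) (fun x hx => (hg x hx).ge) hx
  have h2 := dual_homog_nonneg_of_mem_convexHull (g := -g) (fun x hx => by simp [hg x hx]) hx
  simp only [LinearMap.neg_apply] at h2
  linarith

theorem convexHull_inter_dual_homog_zero {g : Dual ℝ ((Fin N → ℝ) × ℝ)}
    {X : Set (Fin N → ℝ)} (hg : ∀ x ∈ X, 0 ≤ g (homog x)) :
    {x ∈ convexHull ℝ X | g (homog x) = 0} = convexHull ℝ {x ∈ X | g (homog x) = 0} := by
  classical
  ext x
  constructor
  · rintro ⟨hx, hgx⟩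
    rw [mem_convexHull_iff_exists_fintype] at hx
    obtain ⟨κ, _, a, z, ha, hsum, hz, rfl⟩ := hx
    rw [dual_homog_sum g _ a z hsum, Finset.sum_eq_zero_iff_of_nonneg
      (fun i _ => mul_nonneg (ha i) (hg _ (hz i)))] at hgx
    rw [← Finset.sum_filter_of_ne (p := fun i => a i ≠ 0) (fun i _ hi h => hi (by simp [h]))]
    refine (convex_convexHull ℝ _).sum_mem (fun i _ => ha i) ?_ fun i hi => ?_
    · rw [Finset.sum_filter_ne_zero, hsum]
    · refine subset_convexHull ℝ _ ⟨hz i, ?_⟩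
      exact (mul_eq_zero.mp (hgx i (Finset.mem_univ i))).resolve_left (Finset.mem_filter.mp hi).2
  · intro hx
    exact ⟨convexHull_mono (sep_subset _ _) hx,
      dual_homog_eq_zero_of_mem_convexHull (fun y hy => hy.2) hx⟩

theorem isFaceOf_iff {F P : Set (Fin N → ℝ)} :
    IsFaceOf F P ↔ ∃ g : Dual ℝ ((Fin N → ℝ) × ℝ),
      (∀ x ∈ P, 0 ≤ g (homog x)) ∧ F = {x ∈ P | g (homog x) = 0} := by
  constructor
  · rintro ⟨c, b, hP, rfl⟩
    let g : Dual ℝ ((Fin N → ℝ) × ℝ) :=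
      b • LinearMap.snd ℝ _ _ - (∑ i, c i • LinearMap.proj i) ∘ₗ LinearMap.fst ℝ _ _
    have hg : ∀ x, g (homog x) = b - ∑ i, c i * x i := fun x => by
      simp [g, homog]
    refine ⟨g, fun x hx => by rw [hg]; linarith [hP x hx], ?_⟩
    ext x
    simp only [mem_ofPred_eq, hg]
    exact and_congr_right fun _ => ⟨fun h => by linarith, fun h => by linarith⟩
  · rintro ⟨g, hP, rfl⟩
    have hg : ∀ x, g (homog x) =
        g (0, 1) - ∑ i, (-g (Pi.single i 1, 0)) * x i := fun x => by
      have : homog x = ((0, 1) : (Fin N → ℝ) × ℝ) +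
          ∑ i, x i • ((Pi.single i 1, 0) : (Fin N → ℝ) × ℝ) := by
        ext j
        · simp [homog, Prod.fst_sum, Finset.sum_apply, Pi.single_apply]
        · simp [homog, Prod.snd_sum]
      rw [this, map_add, map_sum]
      simp only [map_smul, smul_eq_mul, neg_mul, Finset.sum_neg_distrib, sub_neg_eq_add]
      simp only [mul_comm]
    refine ⟨fun i => -g (Pi.single i 1, 0), g (0, 1), fun x hx => ?_, ?_⟩
    · have := hP x hx
      rw [hg] at this
      linarith
    · ext x
      simp only [mem_ofPred_eq, hg]
      exact and_congr_right fun _ => ⟨fun h => by linarith, fun h => by linarith⟩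

theorem pdim_add_one (X : Set (Fin N → ℝ)) :
    pdim X + 1 = finrank ℝ (Submodule.span ℝ (homog '' X)) := by
  unfold pdim
  split_ifs with h
  · obtain ⟨x₀, hx₀⟩ := h
    rw [direction_affineSpan]
    let D := vectorSpan ℝ X
    let f : D × ℝ →ₗ[ℝ] (Fin N → ℝ) × ℝ :=
      LinearMap.prod (D.subtype.coprod (LinearMap.toSpanSingleton ℝ _ x₀))
        (LinearMap.snd ℝ _ _)
    have hf : ∀ y s, f (y, s) = ((y : Fin N → ℝ) + s • x₀, s) := fun y s => by simp [f]
    have hinj : Function.Injective f := by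
      rintro ⟨y, s⟩ ⟨y', s'⟩ h
      rw [hf, hf, Prod.mk.injEq] at h
      obtain ⟨h1, rfl⟩ := h
      simpa using h1
    have hrange : LinearMap.range f = Submodule.span ℝ (homog '' X) := by
      apply le_antisymm
      · have hD : ∀ y ∈ D, ((y, 0) : (Fin N → ℝ) × ℝ) ∈ Submodule.span ℝ (homog '' X) := by
          intro y hy
          have : D ≤ (Submodule.span ℝ (homog '' X)).comap (LinearMap.inl ℝ _ _) := by
            refine Submodule.span_le.mpr ?_
            rintro _ ⟨a, ha, b, hb, rfl⟩
            have : LinearMap.inl ℝ (Fin N → ℝ) ℝ (a -ᵥ b) = homog a - homog b := by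
              simp [homog]
            simp only [SetLike.mem_coe, Submodule.mem_comap, this]
            exact Submodule.sub_mem _ (Submodule.subset_span ⟨a, ha, rfl⟩)
              (Submodule.subset_span ⟨b, hb, rfl⟩)
          exact this hy
        rintro _ ⟨⟨y, s⟩, rfl⟩
        have : f (y, s) = ((y : Fin N → ℝ), (0 : ℝ)) + s • homog x₀ := by
          simp [hf, homog]
        rw [this]
        exact Submodule.add_mem _ (hD _ y.2)
          (Submodule.smul_mem _ _ (Submodule.subset_span ⟨x₀, hx₀, rfl⟩))
      · refine Submodule.span_le.mpr ?_
        rintro _ ⟨x, hx, rfl⟩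
        refine ⟨(⟨x - x₀, vsub_mem_vectorSpan ℝ hx hx₀⟩, 1), ?_⟩
        simp [hf, homog]
    rw [← hrange, LinearMap.finrank_range_of_inj hinj, finrank_prod]
    simp [D]
  · rw [not_nonempty_iff_eq_empty.mp h, image_empty, Submodule.span_empty, finrank_bot]
    simp

theorem pdim_convexHull (X : Set (Fin N → ℝ)) : pdim (convexHull ℝ X) = pdim X := by
  by_cases h : X.Nonempty
  · simp only [pdim, convexHull_nonempty_iff, h, if_true]
    rw [affineSpan_convexHull]
  · simp [pdim, h]

variable {ι : Type*}

theorem linearIndependent_homog_iff {v : ι → Fin N → ℝ} :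
    LinearIndependent ℝ (fun i => homog (v i)) ↔ AffineIndependent ℝ v := by
  rw [affineIndependent_iff, linearIndependent_iff']
  refine forall₂_congr fun s w => ?_
  have : ∑ i ∈ s, w i • homog (v i) = (∑ i ∈ s, w i • v i, ∑ i ∈ s, w i) := by
    ext <;> simp [homog, Prod.fst_sum, Prod.snd_sum]
  rw [this, Prod.mk_eq_zero]
  tauto

end Homogenization

section Faces

variable {N : ℕ} {ι : Type*} {v : ι → Fin N → ℝ}

theorem isFaceOf_convexHull_image {I : Set ι} (hI : I ∈ faceSets fun i => homog (v i)) :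
    IsFaceOf (convexHull ℝ (v '' I)) (convexHull ℝ (range v)) ∧
      {i | v i ∈ convexHull ℝ (v '' I)} = I := by
  obtain ⟨g, hg, rfl⟩ := hI
  constructor
  · refine isFaceOf_iff.mpr ⟨g, fun x hx => dual_homog_nonneg_of_mem_convexHull ?_ hx, ?_⟩
    · rintro _ ⟨i, rfl⟩
      exact hg i
    · rw [convexHull_inter_dual_homog_zero (by rintro _ ⟨i, rfl⟩; exact hg i)]
      congr 1
      ext x
      constructor
      · rintro ⟨i, hi, rfl⟩
        exact ⟨⟨i, rfl⟩, hi⟩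
      · rintro ⟨⟨i, rfl⟩, hi⟩
        exact ⟨i, hi, rfl⟩
  · ext i
    refine ⟨fun hi => dual_homog_eq_zero_of_mem_convexHull ?_ hi,
      fun hi => subset_convexHull ℝ _ ⟨i, hi, rfl⟩⟩
    rintro _ ⟨j, hj, rfl⟩
    exact hj

theorem IsFaceOf.mem_faceSets {F : Set (Fin N → ℝ)} (hF : IsFaceOf F (convexHull ℝ (range v))) :
    {i | v i ∈ F} ∈ (faceSets fun i => homog (v i)) ∧ convexHull ℝ (v '' {i | v i ∈ F}) = F := by
  obtain ⟨g, hg, rfl⟩ := isFaceOf_iff.mp hF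
  have hv : ∀ i, v i ∈ convexHull ℝ (range v) := fun i => subset_convexHull ℝ _ ⟨i, rfl⟩
  constructor
  · exact ⟨g, fun i => hg _ (hv i), by ext i; simp [hv i]⟩
  · rw [convexHull_inter_dual_homog_zero (by rintro _ ⟨i, rfl⟩; exact hg _ (hv i))]
    congr 1
    ext x
    constructor
    · rintro ⟨i, hi, rfl⟩
      exact ⟨⟨i, rfl⟩, dual_homog_eq_zero_of_mem_convexHull (fun y hy => hy.2) hi⟩
    · rintro ⟨⟨i, rfl⟩, hi⟩
      exact ⟨i, subset_convexHull ℝ _ ⟨⟨i, rfl⟩, hi⟩, rfl⟩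

/-- The faces of the convex hull of a family of points correspond to their index sets. -/
def faceEquiv (v : ι → Fin N → ℝ) :
    {F : Set (Fin N → ℝ) // IsFaceOf F (convexHull ℝ (range v))} ≃
      {I : Set ι // I ∈ faceSets fun i => homog (v i)} where
  toFun F := ⟨{i | v i ∈ F.1}, F.2.mem_faceSets.1⟩
  invFun I := ⟨convexHull ℝ (v '' I.1), (isFaceOf_convexHull_image I.2).1⟩
  left_inv F := Subtype.ext F.2.mem_faceSets.2
  right_inv I := Subtype.ext (isFaceOf_convexHull_image I.2).2

theorem faceEquiv_subset_iff (v : ι → Fin N → ℝ)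
    (F₁ F₂ : {F : Set (Fin N → ℝ) // IsFaceOf F (convexHull ℝ (range v))}) :
    (faceEquiv v F₁).1 ⊆ (faceEquiv v F₂).1 ↔ F₁.1 ⊆ F₂.1 := by
  refine ⟨fun h => ?_, fun h i hi => h hi⟩
  rw [← F₁.2.mem_faceSets.2, ← F₂.2.mem_faceSets.2]
  exact convexHull_mono (image_mono h)

theorem combEquiv_of_faceSets_eq {M : ℕ} {u : ι → Fin M → ℝ}
    (h : (faceSets fun i => homog (v i)) = faceSets fun i => homog (u i)) :
    CombEquiv (convexHull ℝ (range v)) (convexHull ℝ (range u)) := by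
  refine ⟨((faceEquiv v).trans (Equiv.subtypeEquivRight fun I => by rw [h])).trans
    (faceEquiv u).symm, fun F₁ F₂ => ?_⟩
  rw [← faceEquiv_subset_iff u, ← faceEquiv_subset_iff v]
  simp

theorem IsFaceOf.mem_of_mem_convexHull {x : Fin N → ℝ} {P X : Set (Fin N → ℝ)}
    (hx : IsFaceOf {x} P) (hX : X ⊆ P) (hmem : x ∈ convexHull ℝ X) : x ∈ X := by
  obtain ⟨g, hg, hxg⟩ := isFaceOf_iff.mp hx
  have hgx : g (homog x) = 0 := ((hxg ▸ mem_singleton x : x ∈ {x ∈ P | g (homog x) = 0})).2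
  have h := convexHull_inter_dual_homog_zero (g := g) (X := X) fun y hy => hg y (hX hy)
  have hmem' : x ∈ convexHull ℝ {y ∈ X | g (homog y) = 0} := h ▸ ⟨hmem, hgx⟩
  obtain ⟨y, hyX, hy⟩ := convexHull_nonempty_iff.mp ⟨x, hmem'⟩
  have : y ∈ ({x} : Set (Fin N → ℝ)) := hxg ▸ ⟨hX hyX, hy⟩
  rwa [mem_singleton_iff.mp this] at hyX

theorem vertexSet_convexHull_subset (X : Set (Fin N → ℝ)) : vertexSet (convexHull ℝ X) ⊆ X := by
  intro x hx
  have hxP : x ∈ convexHull ℝ X := by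
    obtain ⟨g, hg, hxg⟩ := isFaceOf_iff.mp (show IsFaceOf {x} (convexHull ℝ X) from hx)
    exact (hxg ▸ mem_singleton x : x ∈ {x ∈ convexHull ℝ X | g (homog x) = 0}).1
  exact IsFaceOf.mem_of_mem_convexHull hx (subset_convexHull ℝ X) hxP

theorem IsPolytope.exists_finset_eq_vertexSet {P : Set (Fin N → ℝ)} (hP : IsPolytope P) :
    ∃ T : Finset (Fin N → ℝ), P = convexHull ℝ (T : Set (Fin N → ℝ)) ∧
      (T : Set (Fin N → ℝ)) = vertexSet P := by
  classical
  obtain ⟨T, hT, hmin⟩ := WellFounded.has_min (measure Finset.card).wf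
    {T : Finset (Fin N → ℝ) | P = convexHull ℝ (T : Set (Fin N → ℝ))} hP
  refine ⟨T, hT, Subset.antisymm (fun t ht => ?_) ?_⟩
  · have ht' : t ∉ convexHull ℝ ((T.erase t : Finset _) : Set (Fin N → ℝ)) := by
      intro hmem
      refine hmin (T.erase t) ?_ (Finset.card_erase_lt_of_mem ht)
      rw [Set.mem_ofPred_eq, hT]
      apply Subset.antisymm
      · refine convexHull_min (fun s hs => ?_) (convex_convexHull ℝ _)
        by_cases hst : s = t
        · rwa [hst]
        · exact subset_convexHull ℝ _ (Finset.mem_erase.mpr ⟨hst, hs⟩)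
      · exact convexHull_mono (Finset.erase_subset _ _)
    obtain ⟨f, b, hf, hft⟩ := geometric_hahn_banach_closed_point (convex_convexHull ℝ _)
      ((T.erase t).finite_toSet.isCompact_convexHull (𝕜 := ℝ)).isClosed ht'
    let g : Dual ℝ ((Fin N → ℝ) × ℝ) :=
      f t • LinearMap.snd ℝ _ _ - f.toLinearMap ∘ₗ LinearMap.fst ℝ _ _
    have hg : ∀ x, g (homog x) = f t - f x := fun x => by simp [g, homog]
    have hgT : ∀ s ∈ (T : Set (Fin N → ℝ)), s ≠ t → 0 < g (homog s) := fun s hs hst => by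
      have := hf s (subset_convexHull ℝ _ (Finset.mem_erase.mpr ⟨hst, hs⟩))
      rw [hg]
      linarith
    have hgT' : ∀ s ∈ (T : Set (Fin N → ℝ)), 0 ≤ g (homog s) := fun s hs => by
      by_cases hst : s = t
      · simp [hg, hst]
      · exact (hgT s hs hst).le
    refine isFaceOf_iff.mpr ⟨g, fun x hx => ?_, ?_⟩
    · rw [hT] at hx
      exact dual_homog_nonneg_of_mem_convexHull hgT' hx
    · rw [hT, convexHull_inter_dual_homog_zero hgT']
      have : {x ∈ (T : Set (Fin N → ℝ)) | g (homog x) = 0} = {t} := by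
        ext s
        constructor
        · rintro ⟨hs, hs0⟩
          by_contra hst
          exact (hgT s hs hst).ne' hs0
        · rintro rfl
          exact ⟨ht, by simp [hg]⟩
      rw [this, convexHull_singleton]
  · rw [hT]
    exact vertexSet_convexHull_subset _

theorem IsPolytope.exists_vertex_enumeration {P : Set (Fin N → ℝ)} (hP : IsPolytope P) :
    ∃ v : Fin (vertexCount P) → Fin N → ℝ, P = convexHull ℝ (range v) ∧
      ∀ i, {i} ∈ faceSets fun i => homog (v i) := by
  obtain ⟨T, hT, hTv⟩ := hP.exists_finset_eq_vertexSet
  have hcard : vertexCount P = T.card := by rw [vertexCount, ← hTv, ncard_coe_finset]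
  rw [hcard]
  have hrange : range (fun i => (T.equivFin.symm i : Fin N → ℝ)) = T := by
    ext x
    constructor
    · rintro ⟨i, rfl⟩
      exact (T.equivFin.symm i).2
    · intro hx
      exact ⟨T.equivFin ⟨x, hx⟩, by simp⟩
  refine ⟨fun i => T.equivFin.symm i, by rw [hrange, hT], fun i => ?_⟩
  have hi : IsFaceOf {(T.equivFin.symm i : Fin N → ℝ)} P :=
    (hTv ▸ (T.equivFin.symm i).2 : (T.equivFin.symm i : Fin N → ℝ) ∈ vertexSet P)
  rw [hT, ← hrange] at hi
  convert hi.mem_faceSets.1 using 1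
  ext j
  simp

theorem pdim_convexHull_image_add_one (I : Set ι) :
    pdim (convexHull ℝ (v '' I)) + 1 =
      finrank ℝ (Submodule.span ℝ ((fun i => homog (v i)) '' I)) := by
  rw [pdim_convexHull, pdim_add_one, image_image]

theorem pdim_convexHull_range_add_one :
    pdim (convexHull ℝ (range v)) + 1 =
      finrank ℝ (Submodule.span ℝ (range fun i => homog (v i))) := by
  rw [← image_univ, pdim_convexHull_image_add_one, image_univ]

theorem isFacetOf_iff_finrank {I : Set ι} (hI : I ∈ faceSets fun i => homog (v i)) :
    IsFacetOf (convexHull ℝ (v '' I)) (convexHull ℝ (range v)) ↔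
      finrank ℝ (Submodule.span ℝ ((fun i => homog (v i)) '' I)) + 1 =
        finrank ℝ (Submodule.span ℝ (range fun i => homog (v i))) := by
  have h1 := pdim_convexHull_image_add_one (v := v) I
  have h2 := pdim_convexHull_range_add_one (v := v)
  rw [IsFacetOf, and_iff_right (isFaceOf_convexHull_image hI).1]
  omega

theorem exists_facet_functionals [Finite ι] (v : ι → Fin N → ℝ) :
    ∃ f : Fin (facetCount (convexHull ℝ (range v))) → Dual ℝ ((Fin N → ℝ) × ℝ),
      (∀ j, IsFacetFunctional (fun i => homog (v i)) (f j)) ∧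
      ∀ g, IsFacetFunctional (fun i => homog (v i)) g →
        ∃ j, ∀ i, f j (homog (v i)) = 0 ↔ g (homog (v i)) = 0 := by
  set P := convexHull ℝ (range v) with hP
  have hfin : {F | IsFacetOf F P}.Finite := by
    refine Set.Finite.of_finite_image (f := fun F => {i | v i ∈ F}) (toFinite _) ?_
    intro F hF G hG hFG
    have h1 := hF.1.mem_faceSets.2
    have h2 := hG.1.mem_faceSets.2
    simp only at hFG
    rw [← h1, ← h2, hFG]
  have := hfin.to_subtype
  have e : Fin (facetCount P) ≃ {F | IsFacetOf F P} :=
    (Finite.equivFinOfCardEq (by rw [facetCount, Nat.card_coe_set_eq])).symm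
  choose g hg hgI using fun j => (e j).2.1.mem_faceSets.1
  refine ⟨g, fun j => ⟨hg j, ?_⟩, fun g' hg' => ?_⟩
  · have hface := (e j).2.1.mem_faceSets
    rw [← hgI j, ← isFacetOf_iff_finrank hface.1, hface.2]
    exact (e j).2
  · have hI : {i | g' (homog (v i)) = 0} ∈ faceSets fun i => homog (v i) := ⟨g', hg'.1, rfl⟩
    obtain ⟨j, hj⟩ := e.surjective ⟨_, (isFacetOf_iff_finrank hI).mpr hg'.2⟩
    refine ⟨j, fun i => ?_⟩
    have h1 := hgI j
    rw [hj, (isFaceOf_convexHull_image hI).2] at h1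
    exact (Set.ext_iff.mp h1 i).symm

end Faces

section Perturbation

variable {ι V : Type*} [NormedAddCommGroup V] [NormedSpace ℝ V]

theorem exists_dual_of_linearIndepOn {w : ι → V} {J : Set ι} (hJ : LinearIndepOn ℝ w J)
    (c : ι → ℝ) : ∃ h : Dual ℝ V, ∀ j ∈ J, h (w j) = c j := by
  have hli : LinearIndependent ℝ fun j : J => w j := hJ
  obtain ⟨h, hh⟩ := LinearMap.exists_extend ((Basis.span hli).constr ℝ fun j : J => c j)
  refine ⟨h, fun j hj => ?_⟩
  have := LinearMap.congr_fun hh (Basis.span hli ⟨j, hj⟩)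
  rw [Basis.constr_basis] at this
  simpa [Basis.span_apply] using this

theorem mem_faceSets_of_subset [Finite ι] {w : ι → V} {I J : Set ι} (hJ : J ∈ faceSets w)
    (hli : LinearIndepOn ℝ w J) (hIJ : I ⊆ J) : I ∈ faceSets w := by
  classical
  have := Fintype.ofFinite ι
  obtain ⟨g, hg, rfl⟩ := hJ
  obtain ⟨h, hh⟩ := exists_dual_of_linearIndepOn hli fun j => if j ∈ I then 0 else 1
  obtain ⟨δ, hδ, hpos⟩ := exists_pos_forall_add_mul_pos (fun i => g (w i)) fun i => h (w i)
  have key : ∀ i, (i ∈ I → (g + δ • h) (w i) = 0) ∧ (i ∉ I → 0 < (g + δ • h) (w i)) := by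
    intro i
    simp only [LinearMap.add_apply, LinearMap.smul_apply, smul_eq_mul]
    refine ⟨fun hi => ?_, fun hi => ?_⟩
    · rw [hh i (hIJ hi), show g (w i) = 0 from hIJ hi]
      simp [hi]
    · rcases (hg i).eq_or_lt with h0 | h0
      · rw [hh i h0.symm, ← h0]
        simpa [hi] using hδ
      · exact hpos i h0
  refine ⟨g + δ • h, fun i => ?_, ?_⟩
  · by_cases hi : i ∈ I
    · exact ((key i).1 hi).ge
    · exact ((key i).2 hi).le
  · ext i
    exact ⟨fun hi => (key i).1 hi, fun h0 => by_contra fun hi => ((key i).2 hi).ne' h0⟩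

variable [FiniteDimensional ℝ V]

theorem eventually_mem_faceSets [Finite ι] {w : ι → V} {I : Set ι} (hI : I ∈ faceSets w)
    (hli : LinearIndepOn ℝ w I) : ∀ᶠ w' in 𝓝 w, I ∈ faceSets w' := by
  classical
  have := Fintype.ofFinite ι
  obtain ⟨g, hg, hIg⟩ := hI
  choose h hh using fun i : I => exists_dual_of_linearIndepOn hli fun j => if i.1 = j then 1 else 0
  let H (w' : ι → V) : Matrix I I ℝ := Matrix.of fun i j => h i (w' j)
  let c (w' : ι → V) : I → ℝ := Matrix.vecMul (fun j : I => g (w' j)) (H w').adjugate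
  let G (w' : ι → V) : Dual ℝ V := (H w').det • g - ∑ i, c w' i • h i
  have hcont (f : Dual ℝ V) (k : ι) : Continuous fun w' : ι → V => f (w' k) :=
    f.continuous_of_finiteDimensional.comp (continuous_apply k)
  have hH : Continuous H := continuous_matrix fun i j => hcont (h i) j
  have hc : Continuous c := (continuous_pi fun j : I => hcont g j).matrix_vecMul hH.matrix_adjugate
  have hG (k : ι) : Continuous fun w' => G w' (w' k) := by
    simp only [G, LinearMap.sub_apply, LinearMap.smul_apply, LinearMap.sum_apply, smul_eq_mul]
    exact (hH.matrix_det.mul (hcont g k)).sub (continuous_finsetSum _ fun i _ =>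
      ((continuous_apply i).comp hc).mul (hcont (h i) k))
  have hGw (k : ι) : G w (w k) = g (w k) := by
    have hH1 : H w = 1 := by
      ext i j
      simp [H, hh i j j.2, Matrix.one_apply, Subtype.ext_iff]
    have hc0 : c w = 0 := by
      have : (fun j : I => g (w j)) = 0 := funext fun j => (hIg ▸ j.2 : j.1 ∈ {i | g (w i) = 0})
      simp only [c, this, Matrix.zero_vecMul]
    simp [G, hH1, hc0]
  have hzero (w' : ι → V) (j : I) : G w' (w' j) = 0 := by
    have : Matrix.vecMul (c w') (H w') j = (H w').det * g (w' j) := by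
      simp only [c, Matrix.vecMul_vecMul, Matrix.adjugate_mul]
      simp [Matrix.vecMul_smul]
    simp only [G, LinearMap.sub_apply, LinearMap.smul_apply, LinearMap.sum_apply, smul_eq_mul,
      ← this]
    simp [Matrix.vecMul, dotProduct, H]
  have hev : ∀ᶠ w' in 𝓝 w, ∀ k ∉ I, 0 < G w' (w' k) := by
    refine eventually_all.mpr fun k => ?_
    by_cases hk : k ∈ I
    · exact Eventually.of_forall fun _ h => absurd hk h
    · have : 0 < G w (w k) := by
        rw [hGw]
        exact (hg k).lt_of_ne fun h0 => hk (hIg ▸ h0.symm)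
      filter_upwards [(hG k).continuousAt.eventually (lt_mem_nhds this)] with w' h _ using h
  filter_upwards [hev] with w' h'
  refine ⟨G w', fun i => ?_, ?_⟩
  · by_cases hi : i ∈ I
    · exact (hzero w' ⟨i, hi⟩).ge
    · exact (h' i hi).le
  · ext i
    exact ⟨fun hi => hzero w' ⟨i, hi⟩, fun h0 => by_contra fun hi => (h' i hi).ne' h0⟩

theorem eventually_notMem_faceSets {w : ι → V} (hspan : Submodule.span ℝ (range w) = ⊤) {I : Set ι}
    (hIu : I ≠ univ) (hI : ∀ J ∈ faceSets w, I ⊆ J → J = univ) :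
    ∀ᶠ w' in 𝓝 w, I ∉ faceSets w' := by
  let K : Set ((ι → V) × Metric.sphere (0 : V →L[ℝ] ℝ) 1) :=
    {p | (∀ i, 0 ≤ p.2.1 (p.1 i)) ∧ ∀ i ∈ I, p.2.1 (p.1 i) = 0}
  have hcont (i : ι) :
      Continuous fun p : (ι → V) × Metric.sphere (0 : V →L[ℝ] ℝ) 1 => p.2.1 (p.1 i) :=
    (continuous_subtype_val.comp continuous_snd).clm_apply
      ((continuous_apply i).comp continuous_fst)
  have hK : IsClosed K := by
    have : K = (⋂ i, {p | 0 ≤ p.2.1 (p.1 i)}) ∩ ⋂ i ∈ I, {p | p.2.1 (p.1 i) = 0} := by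
      ext p
      simp [K]
    rw [this]
    exact (isClosed_iInter fun i => isClosed_le continuous_const (hcont i)).inter
      (isClosed_biInter fun i _ => isClosed_eq (hcont i) continuous_const)
  have := isCompact_iff_compactSpace.mp (isCompact_sphere (0 : V →L[ℝ] ℝ) 1)
  have hw : w ∉ Prod.fst '' K := by
    rintro ⟨⟨w', g⟩, ⟨hg, hgI⟩, rfl⟩
    simp only at hg hgI hspan hI
    have hu := hI {i | g.1 (w' i) = 0} ⟨g.1.toLinearMap, hg, rfl⟩ hgI
    have h0 : (g.1 : V →ₗ[ℝ] ℝ) = 0 := by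
      refine LinearMap.ext_on_range hspan fun i => ?_
      have : i ∈ {i | g.1 (w' i) = 0} := hu ▸ mem_univ i
      simpa using this
    have h1 : g.1 = 0 := by
      ext x
      exact LinearMap.congr_fun h0 x
    have h2 := g.2
    simp [h1] at h2
  filter_upwards [(isClosedMap_fst_of_compactSpace _ hK).isOpen_compl.mem_nhds hw] with w' hw' hmem
  obtain ⟨g, hg, rfl⟩ := hmem
  apply hw'
  let g' : V →L[ℝ] ℝ := LinearMap.toContinuousLinearMap g
  have hg' : g' ≠ 0 := fun h => hIu <| by
    ext i
    have : g' (w' i) = 0 := by simp [h]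
    simpa [g'] using this
  refine ⟨(w', ⟨‖g'‖⁻¹ • g', ?_⟩), ⟨fun i => ?_, fun i hi => ?_⟩, rfl⟩
  · simp [norm_smul, hg']
  · exact mul_nonneg (inv_nonneg.mpr (norm_nonneg _)) (hg i)
  · have : g (w' i) = 0 := hi
    simp [g', this]

theorem eventually_faceSets_eq [Finite ι] {w : ι → V} (hspan : Submodule.span ℝ (range w) = ⊤)
    (hs : ∀ I ∈ faceSets w, I ≠ univ → ∃ J ∈ faceSets w, I ⊆ J ∧ LinearIndepOn ℝ w J) :
    ∀ᶠ w' in 𝓝 w, faceSets w' = faceSets w := by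
  have : ∀ I : Set ι, ∀ᶠ w' in 𝓝 w, (I ∈ faceSets w' ↔ I ∈ faceSets w) := by
    intro I
    by_cases hu : I = univ
    · exact Eventually.of_forall fun w' => by simp [hu, univ_mem_faceSets]
    by_cases hI : I ∈ faceSets w
    · obtain ⟨J, -, hIJ, hJ⟩ := hs I hI hu
      filter_upwards [eventually_mem_faceSets hI (hJ.mono hIJ)] with w' h
      simp [h, hI]
    · have := eventually_notMem_faceSets hspan hu fun J hJ hIJ => by
        by_contra hJu
        obtain ⟨J', hJ', hJJ', hli⟩ := hs J hJ hJu
        exact hI (mem_faceSets_of_subset hJ' hli (hIJ.trans hJJ'))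
      filter_upwards [this] with w' h
      simp [h, hI]
  filter_upwards [eventually_all.mpr this] with w' h
  exact Set.ext h

end Perturbation

/-- Parameters describing a polytope of dimension `e` with `e + r` facets together with a projection
to a space of dimension `d + 1`, up to linear coordinate changes. -/
abbrev ProjParam (e r d : ℕ) : Type := (Fin r × Fin e) ⊕ (Fin (d + 1) ⊕ (Fin e × Fin d))

section Parametrization

variable {e r d : ℕ} {S T : Type*} [CommRing S] [CommRing T]

/-- The facet inequalities, in coordinates in which the first `e` of them and the homogenizing
functional are the coordinate functionals. -/
def facetRow (ρ : Fin r → Fin (e + 1)) (p : ProjParam e r d → S) :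
    Fin e ⊕ Fin r → Fin (e + 1) → S
  | .inl a => Pi.single a.succ 1
  | .inr j => (ρ j).insertNth 1 fun b => p (.inl (j, b))

/-- The equations of a vertex lying on the facets selected by `s`. -/
def vertexMatrix (ρ : Fin r → Fin (e + 1)) (s : Fin e → Fin e ⊕ Fin r)
    (p : ProjParam e r d → S) : Matrix (Fin (e + 1)) (Fin (e + 1)) S :=
  Matrix.of fun i => Fin.cases (Pi.single 0 1) (fun a => facetRow ρ p (s a)) i

/-- The matrix of the projection, normalized in each column but the first. -/
def projMatrix (γ : Fin e → Fin (d + 1)) (δ : Fin e → Bool) (p : ProjParam e r d → S) :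
    Matrix (Fin (d + 1)) (Fin (e + 1)) S :=
  Matrix.of fun c => Fin.cases (p (.inr (.inl c))) fun a =>
    (γ a).insertNth (α := fun _ => S) (if δ a then 1 else 0) (fun c' => p (.inr (.inr (a, c')))) c

theorem map_insertNth (φ : S →+* T) {k : ℕ} (i : Fin (k + 1)) (x : S) (y : Fin k → S)
    (j : Fin (k + 1)) :
    φ (i.insertNth (α := fun _ => S) x y j) =
      i.insertNth (α := fun _ => T) (φ x) (fun b => φ (y b)) j := by
  refine Fin.succAboveCases i ?_ (fun b => ?_) j <;> simp

theorem facetRow_map (φ : S →+* T) (ρ : Fin r → Fin (e + 1)) (p : ProjParam e r d → S)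
    (j : Fin e ⊕ Fin r) (b : Fin (e + 1)) :
    φ (facetRow ρ p j b) = facetRow ρ (fun t => φ (p t)) j b := by
  rcases j with a | j
  · simp only [facetRow, Pi.single_apply]
    split_ifs <;> simp
  · simp only [facetRow, map_insertNth, map_one]

theorem vertexMatrix_map (φ : S →+* T) (ρ : Fin r → Fin (e + 1)) (s : Fin e → Fin e ⊕ Fin r)
    (p : ProjParam e r d → S) :
    φ.mapMatrix (vertexMatrix ρ s p) = vertexMatrix ρ s fun t => φ (p t) := by
  ext i b
  refine Fin.cases ?_ (fun a => ?_) i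
  · simp only [vertexMatrix, RingHom.mapMatrix_apply, Matrix.map_apply, Matrix.of_apply,
      Fin.cases_zero, Pi.single_apply]
    split_ifs <;> simp
  · simp [vertexMatrix, facetRow_map]

theorem projMatrix_map (φ : S →+* T) (γ : Fin e → Fin (d + 1)) (δ : Fin e → Bool)
    (p : ProjParam e r d → S) (c : Fin (d + 1)) (b : Fin (e + 1)) :
    φ (projMatrix γ δ p c b) = projMatrix γ δ (fun t => φ (p t)) c b := by
  refine Fin.cases ?_ (fun a => ?_) b
  · simp [projMatrix]
  · simp only [projMatrix, Matrix.of_apply, Fin.cases_succ, map_insertNth]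
    split_ifs <;> simp

/-- The numerators of the coordinates of a projected vertex. -/
def vertexNum (ρ : Fin r → Fin (e + 1)) (γ : Fin e → Fin (d + 1)) (δ : Fin e → Bool)
    (s : Fin e → Fin e ⊕ Fin r) (p : ProjParam e r d → S) (c : Fin (d + 1)) : S :=
  ∑ b, projMatrix γ δ p c b * (vertexMatrix ρ s p).adjugate b 0

theorem vertexNum_map (φ : S →+* T) (ρ : Fin r → Fin (e + 1)) (γ : Fin e → Fin (d + 1))
    (δ : Fin e → Bool) (s : Fin e → Fin e ⊕ Fin r) (p : ProjParam e r d → S) (c : Fin (d + 1)) :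
    φ (vertexNum ρ γ δ s p c) = vertexNum ρ γ δ s (fun t => φ (p t)) c := by
  simp only [vertexNum, map_sum, map_mul, projMatrix_map, ← vertexMatrix_map,
    ← RingHom.map_adjugate]
  rfl

theorem vertexMatrix_det_map (φ : S →+* T) (ρ : Fin r → Fin (e + 1)) (s : Fin e → Fin e ⊕ Fin r)
    (p : ProjParam e r d → S) :
    φ (vertexMatrix ρ s p).det = (vertexMatrix ρ s fun t => φ (p t)).det := by
  rw [RingHom.map_det, vertexMatrix_map]

theorem exists_vertex_relation {n : ℕ} (hcard : r * e + (d + 1 + e * d) < n * (d + 1))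
    (ρ : Fin r → Fin (e + 1)) (γ : Fin e → Fin (d + 1)) (δ : Fin e → Bool)
    (s : Fin n → Fin e → Fin e ⊕ Fin r) :
    ∃ R : MvPolynomial (Fin n × Fin (d + 1)) ℝ, R ≠ 0 ∧ ∀ p : ProjParam e r d → ℝ,
      (∀ i, (vertexMatrix ρ (s i) p).det ≠ 0) →
      MvPolynomial.eval (fun t => vertexNum ρ γ δ (s t.1) p t.2 / (vertexMatrix ρ (s t.1) p).det)
        R = 0 := by
  obtain ⟨R, hR, h⟩ := exists_polynomial_relation (σ := ProjParam e r d) (τ := Fin n × Fin (d + 1))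
    (by simpa using hcard) (fun t => vertexNum ρ γ δ (s t.1) MvPolynomial.X t.2)
    (fun t => (vertexMatrix ρ (s t.1) (MvPolynomial.X : ProjParam e r d → _)).det)
  refine ⟨R, hR, fun p hp => ?_⟩
  simpa only [vertexNum_map, vertexMatrix_det_map, MvPolynomial.eval_X, hp, Ne, not_false_eq_true,
    implies_true, forall_true_left] using h p

end Parametrization

theorem exists_bound_vertex_relation (d n K : ℕ) :
    ∃ R : MvPolynomial (Fin n × Fin (d + 1)) ℝ, R ≠ 0 ∧
      ∀ e < K, ∀ r < K, r * e + (d + 1 + e * d) < n * (d + 1) →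
      ∀ (ρ : Fin r → Fin (e + 1)) (γ : Fin e → Fin (d + 1)) (δ : Fin e → Bool)
        (s : Fin n → Fin e → Fin e ⊕ Fin r) (p : ProjParam e r d → ℝ),
        (∀ i, (vertexMatrix ρ (s i) p).det ≠ 0) →
        MvPolynomial.eval
          (fun t => vertexNum ρ γ δ (s t.1) p t.2 / (vertexMatrix ρ (s t.1) p).det) R = 0 := by
  have key : ∀ e r : ℕ, ∃ R : MvPolynomial (Fin n × Fin (d + 1)) ℝ, R ≠ 0 ∧
      (r * e + (d + 1 + e * d) < n * (d + 1) →
      ∀ (ρ : Fin r → Fin (e + 1)) (γ : Fin e → Fin (d + 1)) (δ : Fin e → Bool)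
        (s : Fin n → Fin e → Fin e ⊕ Fin r) (p : ProjParam e r d → ℝ),
        (∀ i, (vertexMatrix ρ (s i) p).det ≠ 0) →
        MvPolynomial.eval
          (fun t => vertexNum ρ γ δ (s t.1) p t.2 / (vertexMatrix ρ (s t.1) p).det) R = 0) := by
    intro e r
    by_cases hcard : r * e + (d + 1 + e * d) < n * (d + 1)
    · choose R hR h using exists_vertex_relation (n := n) hcard
      refine ⟨∏ ρ, ∏ γ, ∏ δ, ∏ s, R ρ γ δ s, ?_, fun _ ρ γ δ s p hp => ?_⟩
      · simp only [Finset.prod_ne_zero_iff]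
        exact fun ρ _ γ _ δ _ s _ => hR ρ γ δ s
      · simp only [map_prod]
        refine Finset.prod_eq_zero (Finset.mem_univ ρ) (Finset.prod_eq_zero (Finset.mem_univ γ)
          (Finset.prod_eq_zero (Finset.mem_univ δ) (Finset.prod_eq_zero (Finset.mem_univ s) ?_)))
        exact h ρ γ δ s p hp
    · exact ⟨1, one_ne_zero, fun h => absurd h hcard⟩
  choose R hR h using key
  refine ⟨∏ e ∈ Finset.range K, ∏ r ∈ Finset.range K, R e r, ?_, ?_⟩
  · simp only [Finset.prod_ne_zero_iff]
    exact fun e _ r _ => hR e r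
  · intro e he r hr hcard ρ γ δ s p hp
    simp only [map_prod]
    exact Finset.prod_eq_zero (Finset.mem_range.mpr he) (Finset.prod_eq_zero
      (Finset.mem_range.mpr hr) (h e r hcard ρ γ δ s p hp))

section Coordinates

variable {e r d n : ℕ} {W : Type*} [AddCommGroup W] [Module ℝ W]

theorem exists_param_of_normalized (B : Basis (Fin (e + 1)) ℝ (Dual ℝ W))
    (f : Fin e ⊕ Fin r → Dual ℝ W) (hB : ∀ a : Fin e, B a.succ = f (.inl a))
    (π : Fin (d + 1) → Dual ℝ W) (ρ : Fin r → Fin (e + 1)) (γ : Fin e → Fin (d + 1))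
    (δ : Fin e → Bool) (hρ : ∀ j, B.repr (f (.inr j)) (ρ j) = 1)
    (hγ : ∀ a : Fin e, B.repr (π (γ a)) a.succ = if δ a then 1 else 0) :
    ∃ p : ProjParam e r d → ℝ, ∀ (s : Fin e → Fin e ⊕ Fin r) (x : W),
      LinearIndependent ℝ (Fin.cons (B 0) fun a => f (s a) : Fin (e + 1) → Dual ℝ W) →
      (∀ a, f (s a) x = 0) → B 0 x = 1 →
      (vertexMatrix ρ s p).det ≠ 0 ∧
        ∀ c, π c x = vertexNum ρ γ δ s p c / (vertexMatrix ρ s p).det := by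
  let p : ProjParam e r d → ℝ := Sum.elim
    (fun t => B.repr (f (.inr t.1)) ((ρ t.1).succAbove t.2))
    (Sum.elim (fun c => B.repr (π c) 0) fun t => B.repr (π ((γ t.1).succAbove t.2)) t.1.succ)
  have hrow : ∀ j b, facetRow ρ p j b = B.repr (f j) b := by
    rintro (a | j) b
    · simp [facetRow, ← hB, Finsupp.single_apply, Pi.single_apply, eq_comm]
    · refine Fin.succAboveCases (ρ j) ?_ (fun b => ?_) b
      · simp [facetRow, hρ]
      · simp [facetRow, p]
  have hproj : ∀ c b, projMatrix γ δ p c b = B.repr (π c) b := by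
    intro c b
    refine Fin.cases ?_ (fun a => ?_) b
    · simp [projMatrix, p]
    · simp only [projMatrix, Matrix.of_apply, Fin.cases_succ]
      refine Fin.succAboveCases (γ a) ?_ (fun b => ?_) c
      · simp [hγ]
      · simp [p]
  refine ⟨p, fun s x hli hx h1 => ?_⟩
  set M := vertexMatrix ρ s p with hM
  have hMrow : ∀ i b, M i b =
      B.repr ((Fin.cons (B 0) fun a => f (s a) : Fin (e + 1) → Dual ℝ W) i) b := by
    intro i b
    refine Fin.cases ?_ (fun a => ?_) i
    · simp [hM, vertexMatrix, Finsupp.single_apply, Pi.single_apply, eq_comm]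
    · simp [hM, vertexMatrix, hrow]
  have hdet : M.det ≠ 0 := by
    have h := hli.map' B.equivFun.toLinearMap B.equivFun.ker
    have h2 : LinearIndependent ℝ M.row := by
      have : M.row = B.equivFun ∘ (Fin.cons (B 0) fun a => f (s a) : Fin (e + 1) → Dual ℝ W) := by
        ext i b
        exact hMrow i b
      rw [this]
      exact h
    exact ((Matrix.isUnit_iff_isUnit_det _).mp
      (Matrix.linearIndependent_rows_iff_isUnit.mp h2)).ne_zero
  have heval : ∀ g : Dual ℝ W, g x = ∑ b, B.repr g b * B b x := by
    intro g
    have := LinearMap.congr_fun (B.sum_repr g) x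
    simpa only [LinearMap.sum_apply, LinearMap.smul_apply, smul_eq_mul] using this.symm
  have hMx : M.mulVec (fun b => B b x) = Pi.single 0 1 := by
    ext i
    have : M.mulVec (fun b => B b x) i =
        (Fin.cons (B 0) fun a => f (s a) : Fin (e + 1) → Dual ℝ W) i x := by
      rw [heval]
      simp only [Matrix.mulVec, dotProduct, hMrow]
    rw [this]
    refine Fin.cases ?_ (fun a => ?_) i
    · simp [h1]
    · simp [hx]
  have hadj : ∀ b, M.det * B b x = M.adjugate b 0 := by
    intro b
    have h := congrArg (M.adjugate.mulVec) hMx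
    rw [Matrix.mulVec_mulVec, Matrix.adjugate_mul, Matrix.smul_mulVec, Matrix.one_mulVec] at h
    simpa using congrFun h b
  refine ⟨hdet, fun c => ?_⟩
  rw [eq_div_iff hdet, heval, vertexNum, Finset.sum_mul]
  refine Finset.sum_congr rfl fun b _ => ?_
  rw [hproj, ← hadj]
  ring

theorem exists_parametrization (f : Fin e ⊕ Fin r → Dual ℝ W) (ℓ : Dual ℝ W)
    (hf : ∀ j, f j ≠ 0)
    (B : Basis (Fin (e + 1)) ℝ (Dual ℝ W)) (hB0 : B 0 = ℓ) (hB : ∀ a : Fin e, B a.succ = f (.inl a))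
    (π : Fin (d + 1) → Dual ℝ W) :
    ∃ (ρ : Fin r → Fin (e + 1)) (γ : Fin e → Fin (d + 1)) (δ : Fin e → Bool)
      (p : ProjParam e r d → ℝ), ∀ (s : Fin e → Fin e ⊕ Fin r) (x : W),
      LinearIndependent ℝ (Fin.cons ℓ fun a => f (s a) : Fin (e + 1) → Dual ℝ W) →
      (∀ a, f (s a) x = 0) → ℓ x = 1 →
      (vertexMatrix ρ s p).det ≠ 0 ∧
        ∀ c, π c x = vertexNum ρ γ δ s p c / (vertexMatrix ρ s p).det := by
  have h1 : ∀ a : Fin e, ∃ (c : Fin (d + 1)) (δ : Bool) (u : ℝˣ),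
      (u⁻¹ : ℝˣ) • B.repr (π c) a.succ = if δ then 1 else 0 := by
    intro a
    by_cases h : ∃ c, B.repr (π c) a.succ ≠ 0
    · obtain ⟨c, hc⟩ := h
      exact ⟨c, true, Units.mk0 _ hc, by simp [Units.smul_def, hc]⟩
    · push Not at h
      exact ⟨0, false, 1, by simp [h]⟩
  choose γ δ u hu using h1
  let B' := B.unitsSMul (Fin.cons 1 u)
  have h2 : ∀ j : Fin r, ∃ b, B'.repr (f (.inr j)) b ≠ 0 := by
    intro j
    by_contra! h
    apply hf (.inr j)
    rw [← B'.repr.map_eq_zero_iff]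
    ext b
    exact h b
  choose ρ hρ using h2
  let κ : Fin e ⊕ Fin r → ℝˣ := Sum.elim u fun j => (Units.mk0 _ (hρ j))⁻¹
  have hB'0 : B' 0 = ℓ := by simp [B', Basis.unitsSMul_apply, hB0]
  obtain ⟨p, hp⟩ := exists_param_of_normalized B' (fun j => κ j • f j)
    (fun a => by simp [B', Basis.unitsSMul_apply, hB, κ]) π ρ γ δ
    (fun j => by simp [κ, Units.smul_def, hρ])
    (fun a => by rw [← hu]; simp [B', Basis.repr_unitsSMul])
  refine ⟨ρ, γ, δ, p, fun s x hli hx hℓ => hp s x ?_ ?_ ?_⟩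
  · rw [hB'0]
    convert hli.units_smul (Fin.cons 1 fun a => κ (s a)) using 1
    ext i
    refine Fin.cases ?_ (fun a => ?_) i <;> simp
  · simp [hx]
  · rw [hB'0, hℓ]

end Coordinates

theorem exists_equiv_sum_of_injective {e k : ℕ} {s : Fin e → Fin k} (hs : Function.Injective s) :
    ∃ r, k = e + r ∧ ∃ σ : Fin e ⊕ Fin r ≃ Fin k, ∀ a, σ (.inl a) = s a := by
  classical
  let r := Fintype.card ((range s)ᶜ : Set (Fin k))
  let σ : Fin e ⊕ Fin r ≃ Fin k :=
    (Equiv.sumCongr (Equiv.ofInjective s hs) (Fintype.equivFin _).symm).trans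
      (Equiv.Set.sumCompl (range s))
  refine ⟨r, by simpa using (Fintype.card_congr σ).symm, σ, fun a => ?_⟩
  simp [σ]

section Selection

variable {e k d n : ℕ} {W : Type*} [AddCommGroup W] [Module ℝ W]

theorem exists_vertex_parametrization (hW : finrank ℝ W = e + 1) (f : Fin k → Dual ℝ W)
    (hf : ∀ j, f j ≠ 0) (ℓ : Dual ℝ W) (s : Fin n → Fin e → Fin k) (x : Fin n → W)
    (hs : ∀ i, LinearIndependent ℝ (Fin.cons ℓ fun a => f (s i a) : Fin (e + 1) → Dual ℝ W))
    (hx : ∀ i a, f (s i a) (x i) = 0) (hℓ : ∀ i, ℓ (x i) = 1) (π : Fin (d + 1) → Dual ℝ W)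
    (i₀ : Fin n) :
    ∃ r, k = e + r ∧ ∃ (ρ : Fin r → Fin (e + 1)) (γ : Fin e → Fin (d + 1)) (δ : Fin e → Bool)
      (s' : Fin n → Fin e → Fin e ⊕ Fin r) (p : ProjParam e r d → ℝ), ∀ i,
      (vertexMatrix ρ (s' i) p).det ≠ 0 ∧
        ∀ c, π c (x i) = vertexNum ρ γ δ (s' i) p c / (vertexMatrix ρ (s' i) p).det := by
  have hinj : Function.Injective (s i₀) := fun a b hab => by
    have := (hs i₀).injective (a₁ := a.succ) (a₂ := b.succ) (by simp [hab])
    exact Fin.succ_injective _ this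
  obtain ⟨r, hk, σ, hσ⟩ := exists_equiv_sum_of_injective hinj
  let B := basisOfLinearIndependentOfCardEqFinrank (hs i₀) (by
    rw [Subspace.dual_finrank_eq, hW, Fintype.card_fin])
  obtain ⟨ρ, γ, δ, p, h⟩ := exists_parametrization (fun j => f (σ j)) ℓ (fun j => hf _) B
    (by simp [B]) (fun a => by simp [B, hσ]) π
  refine ⟨r, hk, ρ, γ, δ, fun i a => σ.symm (s i a), p, fun i => h _ (x i) ?_ ?_ (hℓ i)⟩
  · simpa using hs i
  · simpa using hx i

end Selection

section Facets

variable {ι V : Type*} [AddCommGroup V] [Module ℝ V]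

theorem IsFacetFunctional.exists_ne_zero {w : ι → V} {g : Dual ℝ V} (hg : IsFacetFunctional w g) :
    ∃ i, g (w i) ≠ 0 := by
  by_contra! h
  have h2 := hg.2
  have hu : {i | g (w i) = 0} = univ := eq_univ_of_forall h
  rw [hu, image_univ] at h2
  omega

theorem IsFacetFunctional.mem_span_zeros [FiniteDimensional ℝ V] {w : ι → V} {g : Dual ℝ V}
    (hg : IsFacetFunctional w g) {x : V} (hx : x ∈ Submodule.span ℝ (range w)) (hgx : g x = 0) :
    x ∈ Submodule.span ℝ (w '' {i | g (w i) = 0}) := by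
  set Z := Submodule.span ℝ (w '' {i | g (w i) = 0}) with hZ
  set W := Submodule.span ℝ (range w) with hW
  have h1 : Z ≤ W ⊓ g.ker := le_inf (Submodule.span_mono (image_subset_range _ _))
    (Submodule.span_le.mpr (by rintro _ ⟨i, hi, rfl⟩; exact hi))
  have h2 : W ⊓ g.ker < W := by
    refine lt_of_le_of_ne inf_le_left fun h => ?_
    obtain ⟨i, hi⟩ := hg.exists_ne_zero
    have : w i ∈ W := Submodule.subset_span ⟨i, rfl⟩
    rw [← h] at this
    exact hi this.2
  have h3 := Submodule.finrank_lt_finrank_of_lt h2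
  have h4 : finrank ℝ Z + 1 = finrank ℝ W := hg.2
  rw [Submodule.eq_of_le_of_finrank_le h1 (by omega)]
  exact ⟨hx, hgx⟩

theorem exists_selection [Finite ι] [FiniteDimensional ℝ V] {e k : ℕ} (w : ι → V)
    (he : finrank ℝ (Submodule.span ℝ (range w)) = e + 1) (f : Fin k → Dual ℝ V)
    (hf : ∀ j, IsFacetFunctional w (f j))
    (hcomplete : ∀ g, IsFacetFunctional w g → ∃ j, ∀ i, f j (w i) = 0 ↔ g (w i) = 0)
    (ℓ : Dual ℝ V) {t : ι} (ht : {t} ∈ faceSets w) (hℓ : ℓ (w t) = 1) :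
    ∃ s : Fin e → Fin k, (∀ a, f (s a) (w t) = 0) ∧
      LinearIndependent ℝ (Fin.cons (ℓ.domRestrict (Submodule.span ℝ (range w)))
        fun a => (f (s a)).domRestrict _ : Fin (e + 1) → Dual ℝ (Submodule.span ℝ (range w))) := by
  classical
  set W := Submodule.span ℝ (range w) with hW
  let F : Option (Fin k) → Dual ℝ W := fun o =>
    o.elim (ℓ.domRestrict W) fun j => (f j).domRestrict W
  let T : Set (Option (Fin k)) := insert none (some '' {j | f j (w t) = 0})
  have hwt : w t ∈ W := Submodule.subset_span ⟨t, rfl⟩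
  have hspan : Submodule.span ℝ (F '' T) = ⊤ := by
    rw [← Subspace.dualCoannihilator_dualAnnihilator_eq (W := Submodule.span ℝ (F '' T))]
    rw [← Submodule.dualAnnihilator_bot]
    congr 1
    rw [eq_bot_iff]
    rintro ⟨x, hxW⟩ hx
    rw [Submodule.mem_dualCoannihilator] at hx
    have hx' : ∀ o ∈ T, F o ⟨x, hxW⟩ = 0 := fun o ho => hx _ (Submodule.subset_span ⟨o, ho, rfl⟩)
    have hℓx : ℓ x = 0 := hx' none (mem_insert _ _)
    have hxt : x ∈ Submodule.span ℝ {w t} := by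
      refine mem_span_singleton_of_facets w ht hxW fun g hg hgt => ?_
      obtain ⟨j, hj⟩ := hcomplete g hg
      have h0 : f j x = 0 := hx' (some j) (mem_insert_of_mem _ ⟨j, (hj t).mpr hgt, rfl⟩)
      have hmem := (hf j).mem_span_zeros hxW h0
      have hle : Submodule.span ℝ (w '' {i | f j (w i) = 0}) ≤ g.ker :=
        Submodule.span_le.mpr (by rintro _ ⟨i, hi, rfl⟩; exact (hj i).mp hi)
      exact hle hmem
    obtain ⟨c, rfl⟩ := Submodule.mem_span_singleton.mp hxt
    simp only [map_smul, hℓ, smul_eq_mul, mul_one] at hℓx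
    simp [hℓx]
  have hnone : LinearIndepOn ℝ F {none} := by
    refine LinearIndepOn.singleton ?_
    intro h0
    have := LinearMap.congr_fun h0 ⟨w t, hwt⟩
    simp [F, hℓ] at this
  obtain ⟨b, hbT, hnb, hFb, hb⟩ := exists_linearIndepOn_extension hnone
    (show {none} ⊆ T from singleton_subset_iff.mpr (mem_insert _ _))
  have hbtop : Submodule.span ℝ (F '' b) = ⊤ := top_le_iff.mp (hspan ▸ Submodule.span_le.mpr hFb)
  have hcard : b.ncard = e + 1 := by
    have h1 := finrank_span_eq_card (R := ℝ) (b := fun i : b => F i) hb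
    rw [← image_eq_range, hbtop, finrank_top, Subspace.dual_finrank_eq, he] at h1
    rw [h1, ← Nat.card_coe_set_eq, Nat.card_eq_fintype_card]
  let b' : Set (Fin k) := {j | some j ∈ b}
  have hbb' : b = insert none (some '' b') := by
    ext o
    rcases o with _ | j
    · simpa using hnb rfl
    · simp [b']
  have hcard' : Fintype.card b' = e := by
    rw [← Nat.card_eq_fintype_card, Nat.card_coe_set_eq]
    rw [hbb', ncard_insert_of_notMem (by simp),
      ncard_image_of_injective _ (Option.some_injective _)]
      at hcard
    omega
  let s : Fin e → b' := (Fintype.equivFinOfCardEq hcard').symm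
  refine ⟨fun a => s a, fun a => ?_, ?_⟩
  · have := hbT (s a).2
    simpa [T] using this
  · let φ : Fin (e + 1) → b := Fin.cons ⟨none, hnb rfl⟩ fun a => ⟨some (s a), (s a).2⟩
    have hφ : Function.Injective φ := by
      rw [Fin.cons_injective_iff]
      refine ⟨by simp, fun a a' h => ?_⟩
      have : (s a : Fin k) = s a' := by simpa using h
      exact (Fintype.equivFinOfCardEq hcard').symm.injective (Subtype.ext this)
    have hFφ : (Fin.cons (ℓ.domRestrict W) fun a => (f (s a)).domRestrict W :
        Fin (e + 1) → Dual ℝ W) = fun i => F (φ i) := by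
      funext i
      refine Fin.cases ?_ (fun a => ?_) i <;> simp [φ, F]
    rw [hFφ]
    exact LinearIndependent.comp hb φ hφ

end Facets

section Projection

theorem exists_dual_homog_projection {E d : ℕ} (π : (Fin E → ℝ) →ᵃ[ℝ] (Fin d → ℝ)) (c : Fin d) :
    ∃ g : Dual ℝ ((Fin E → ℝ) × ℝ), ∀ x, g (homog x) = π x c := by
  refine ⟨LinearMap.proj c ∘ₗ π.linear ∘ₗ LinearMap.fst ℝ _ _ + π 0 c • LinearMap.snd ℝ _ _,
    fun x => ?_⟩
  conv_rhs => rw [π.decomp]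
  simp [homog]

theorem facetCount_pos {E : ℕ} {Q : Set (Fin E → ℝ)} (hQ : IsPolytope Q) (hne : Q.Nonempty) :
    0 < facetCount Q := by
  obtain ⟨τ, hτ, -⟩ := hQ.exists_vertex_enumeration
  generalize vertexCount Q = m at τ hτ
  subst hτ
  obtain ⟨_, t, rfl⟩ := convexHull_nonempty_iff.mp hne
  obtain ⟨f, -, hcomplete⟩ := exists_facet_functionals τ
  obtain ⟨g, hg, -⟩ := exists_isFacetFunctional (fun i => homog (τ i))
    (x := -homog (τ t)) (neg_mem (Submodule.subset_span ⟨t, rfl⟩)) (LinearMap.snd ℝ _ _)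
    (fun i => by simp [homog]) (by simp [homog])
  obtain ⟨j, -⟩ := hcomplete g hg
  exact Fin.pos j

theorem exists_projection_parametrization {E n d : ℕ} {Q : Set (Fin E → ℝ)} (hQ : IsPolytope Q)
    (π : (Fin E → ℝ) →ᵃ[ℝ] (Fin (d + 1) → ℝ)) (u : Fin n → Fin (d + 1) → ℝ)
    (hu : ∀ i, {i} ∈ faceSets fun i => homog (u i)) (hπ : π '' Q = convexHull ℝ (range u))
    (i₀ : Fin n) :
    ∃ e r, facetCount Q = e + r ∧ ∃ (ρ : Fin r → Fin (e + 1)) (γ : Fin e → Fin (d + 1))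
      (δ : Fin e → Bool) (s : Fin n → Fin e → Fin e ⊕ Fin r) (p : ProjParam e r d → ℝ), ∀ i,
      (vertexMatrix ρ (s i) p).det ≠ 0 ∧
        ∀ c, u i c = vertexNum ρ γ δ (s i) p c / (vertexMatrix ρ (s i) p).det := by
  obtain ⟨τ, hτ, hvert⟩ := hQ.exists_vertex_enumeration
  generalize vertexCount Q = m at τ hτ hvert
  subst hτ
  have hlift : ∀ i, ∃ t, π (τ t) = u i := by
    intro i
    have h1 := (isFaceOf_convexHull_image (hu i)).1
    rw [image_singleton, convexHull_singleton] at h1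
    rw [AffineMap.image_convexHull] at hπ
    have h2 : u i ∈ convexHull ℝ (π '' range τ) := hπ ▸ subset_convexHull ℝ _ ⟨i, rfl⟩
    obtain ⟨_, ⟨t, rfl⟩, ht⟩ := h1.mem_of_mem_convexHull (hπ ▸ subset_convexHull ℝ _) h2
    exact ⟨t, ht⟩
  choose t ht using hlift
  obtain ⟨f, hf, hcomplete⟩ := exists_facet_functionals τ
  set w : Fin m → (Fin E → ℝ) × ℝ := fun i => homog (τ i) with hw
  set W := Submodule.span ℝ (range w) with hW
  have hwW : ∀ i, w i ∈ W := fun i => Submodule.subset_span ⟨i, rfl⟩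
  obtain ⟨e, he⟩ : ∃ e, finrank ℝ W = e + 1 := by
    refine Nat.exists_eq_add_one.mpr (finrank_pos_iff_exists_ne_zero.mpr ⟨⟨w (t i₀), hwW _⟩, ?_⟩)
    intro h
    simpa [hw, homog] using congrArg (fun x : W => x.1.2) h
  choose s hs0 hs using fun i => exists_selection w he f hf hcomplete (LinearMap.snd ℝ _ _)
    (hvert (t i)) (by simp [hw, homog])
  choose g hg using exists_dual_homog_projection π
  have hf0 : ∀ j, (f j).domRestrict W ≠ 0 := fun j h0 => by
    obtain ⟨i, hi⟩ := (hf j).exists_ne_zero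
    exact hi (LinearMap.congr_fun h0 ⟨w i, hwW i⟩)
  obtain ⟨r, hk, ρ, γ, δ, s', p, h⟩ := exists_vertex_parametrization he
    (fun j => (f j).domRestrict W) hf0 _ s (fun i => ⟨w (t i), hwW _⟩) hs
    (fun i a => hs0 i a) (fun i => by simp [hw, homog]) (fun c => (g c).domRestrict W) i₀
  refine ⟨e, r, hk, ρ, γ, δ, s', p, fun i => ⟨(h i).1, fun c => ?_⟩⟩
  rw [← (h i).2 c, ← ht]
  exact (hg c _).symm

theorem card_lt_of_lt_sqrt {d n e r : ℕ} (hn : 0 < n)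
    (h : ((e + r : ℕ) : ℝ) <
      2 * Real.sqrt (((d + 1 : ℕ) : ℝ) * n - (d + 1 : ℕ)) - (d + 1 : ℕ) + 1) :
    r * e + (d + 1 + e * d) < n * (d + 1) ∧ e + r < (d + 1) * n + 2 := by
  have hn' : (1 : ℝ) ≤ n := by exact_mod_cast hn
  have hd : (0 : ℝ) ≤ d := Nat.cast_nonneg d
  have he : (0 : ℝ) ≤ e := Nat.cast_nonneg e
  have hr : (0 : ℝ) ≤ r := Nat.cast_nonneg r
  push_cast at h
  have hx : 0 ≤ ((d : ℝ) + 1) * n - (d + 1) := by nlinarith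
  have hsq := Real.sq_sqrt hx
  set q := Real.sqrt (((d : ℝ) + 1) * n - (d + 1))
  constructor
  · have : (r * e + (d + 1 + e * d) : ℝ) < n * (d + 1) := by
      nlinarith [sq_nonneg ((e : ℝ) - (r + d))]
    exact_mod_cast this
  · have : (e + r : ℝ) < (d + 1) * n + 2 := by nlinarith [sq_nonneg (q - 1)]
    exact_mod_cast this

theorem exists_generic_lower_bound {n : ℕ} (d : ℕ) (hn : 0 < n) :
    ∃ R : MvPolynomial (Fin n × Fin d) ℝ, R ≠ 0 ∧ ∀ u : Fin n → Fin d → ℝ,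
      (∀ i, {i} ∈ faceSets fun i => homog (u i)) →
      MvPolynomial.eval (fun t => u t.1 t.2) R ≠ 0 →
      ∀ (E : ℕ) (Q : Set (Fin E → ℝ)) (π : (Fin E → ℝ) →ᵃ[ℝ] (Fin d → ℝ)), IsPolytope Q →
        π '' Q = convexHull ℝ (range u) →
        2 * Real.sqrt ((d : ℝ) * n - d) - d + 1 ≤ facetCount Q := by
  rcases d with _ | d
  · refine ⟨1, one_ne_zero, fun u _ _ E Q π hQ hπ => ?_⟩
    have hne : Q.Nonempty := by
      rw [← image_nonempty (f := π), hπ]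
      exact ⟨u ⟨0, hn⟩, subset_convexHull ℝ _ ⟨_, rfl⟩⟩
    have : (1 : ℝ) ≤ facetCount Q := by exact_mod_cast facetCount_pos hQ hne
    simpa using this
  · obtain ⟨R, hR, h⟩ := exists_bound_vertex_relation d n ((d + 1) * n + 2)
    refine ⟨R, hR, fun u hu hRu E Q π hQ hπ => ?_⟩
    by_contra! hlt
    obtain ⟨e, r, hk, ρ, γ, δ, s, p, hp⟩ :=
      exists_projection_parametrization hQ π u hu hπ ⟨0, hn⟩
    rw [hk] at hlt
    obtain ⟨hcard, hK⟩ := card_lt_of_lt_sqrt hn hlt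
    apply hRu
    rw [← h e (by omega) r (by omega) hcard ρ γ δ s p fun i => (hp i).1]
    congr 2
    funext t
    exact (hp t.1).2 t.2

end Projection

section AffineCoordinates

variable {N d : ℕ} {ι : Type*}

/-- The point with coordinates `y` in the affine frame with origin `p` and directions `b`. -/
def frameMap (p : Fin N → ℝ) (b : Fin d → Fin N → ℝ) (y : Fin d → ℝ) : Fin N → ℝ :=
  p + ∑ k, y k • b k

theorem exists_homog_frameMap (p : Fin N → ℝ) {b : Fin d → Fin N → ℝ}
    (hb : LinearIndependent ℝ b) :
    ∃ Φ : ((Fin d → ℝ) × ℝ) →ₗ[ℝ] ((Fin N → ℝ) × ℝ), Function.Injective Φ ∧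
      ∀ y, Φ (homog y) = homog (frameMap p b y) := by
  let L : (Fin d → ℝ) →ₗ[ℝ] (Fin N → ℝ) := Fintype.linearCombination ℝ b
  have hL : Function.Injective L := linearIndependent_iff_injective_fintypeLinearCombination.mp hb
  refine ⟨((LinearMap.toSpanSingleton ℝ _ p) ∘ₗ LinearMap.snd ℝ _ _ +
    L ∘ₗ LinearMap.fst ℝ _ _).prod (LinearMap.snd ℝ _ _), ?_, fun y => ?_⟩
  · rintro ⟨y, s⟩ ⟨y', s'⟩ h
    obtain rfl : s = s' := congrArg Prod.snd h
    have : L y = L y' := by simpa using congrArg Prod.fst h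
    rw [hL this]
  · simp [homog, frameMap, L, Fintype.linearCombination_apply]

theorem exists_frameMap_leftInverse (p : Fin N → ℝ) {b : Fin d → Fin N → ℝ}
    (hb : LinearIndependent ℝ b) :
    ∃ ψ : (Fin N → ℝ) →ᵃ[ℝ] (Fin d → ℝ), ∀ y, ψ (frameMap p b y) = y := by
  obtain ⟨L, hL⟩ := (Fintype.linearCombination ℝ b).exists_leftInverse_of_injective
    (LinearMap.ker_eq_bot.mpr (linearIndependent_iff_injective_fintypeLinearCombination.mp hb))
  refine ⟨L.toAffineMap - AffineMap.const ℝ _ (L p), fun y => ?_⟩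
  have := LinearMap.congr_fun hL y
  simpa [frameMap, Fintype.linearCombination_apply] using this

theorem exists_frameMap_eq [Nonempty ι] (v : ι → Fin N → ℝ)
    (hd : pdim (convexHull ℝ (range v)) = d) :
    ∃ (p : Fin N → ℝ) (b : Fin d → Fin N → ℝ) (u : ι → Fin d → ℝ), LinearIndependent ℝ b ∧
      ∀ i, v i = frameMap p b (u i) := by
  obtain ⟨i₀⟩ := ‹Nonempty ι›
  have hfin : finrank ℝ (vectorSpan ℝ (range v)) = d := by
    rw [pdim_convexHull, pdim, if_pos ⟨v i₀, i₀, rfl⟩, direction_affineSpan] at hd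
    exact_mod_cast hd
  have hmem : ∀ i, v i - v i₀ ∈ vectorSpan ℝ (range v) := fun i =>
    vsub_mem_vectorSpan ℝ ⟨i, rfl⟩ ⟨i₀, rfl⟩
  generalize vectorSpan ℝ (range v) = W at hfin hmem
  obtain ⟨B⟩ : Nonempty (Basis (Fin d) ℝ W) := ⟨finBasisOfFinrankEq ℝ W hfin⟩
  have hB : LinearIndependent ℝ fun k => (B k : Fin N → ℝ) :=
    B.linearIndependent.map' W.subtype W.ker_subtype
  refine ⟨v i₀, fun k => B k, fun i k => B.repr ⟨v i - v i₀, hmem i⟩ k, hB, fun i => ?_⟩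
  have h := congrArg W.subtype (B.sum_repr ⟨v i - v i₀, hmem i⟩)
  rw [map_sum] at h
  simp only [map_smul, Submodule.subtype_apply] at h
  rw [frameMap, h, add_sub_cancel]

variable {p : Fin N → ℝ} {b : Fin d → Fin N → ℝ} (u : ι → Fin d → ℝ)

theorem faceSets_homog_frameMap (hb : LinearIndependent ℝ b) :
    (faceSets fun i => homog (frameMap p b (u i))) = faceSets fun i => homog (u i) := by
  obtain ⟨Φ, hΦ, h⟩ := exists_homog_frameMap p hb
  simp only [← h]
  exact faceSets_comp _ hΦ

theorem linearIndepOn_homog_frameMap_iff (hb : LinearIndependent ℝ b) {J : Set ι} :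
    LinearIndepOn ℝ (fun i => homog (frameMap p b (u i))) J ↔
      LinearIndepOn ℝ (fun i => homog (u i)) J := by
  obtain ⟨Φ, hΦ, h⟩ := exists_homog_frameMap p hb
  simp only [← h]
  exact LinearMap.linearIndependent_iff Φ (LinearMap.ker_eq_bot.mpr hΦ)

theorem pdim_convexHull_frameMap (hb : LinearIndependent ℝ b) :
    pdim (convexHull ℝ (range fun i => frameMap p b (u i))) + 1 =
      finrank ℝ (Submodule.span ℝ (range fun i => homog (u i))) := by
  obtain ⟨Φ, hΦ, h⟩ := exists_homog_frameMap p hb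
  have hr : (range fun i => homog (frameMap p b (u i))) = Φ '' range fun i => homog (u i) := by
    rw [← range_comp]
    exact congrArg range (funext fun i => (h (u i)).symm)
  rw [pdim_convexHull_range_add_one (v := fun i => frameMap p b (u i)), hr, ← Submodule.map_span]
  exact_mod_cast (LinearEquiv.finrank_eq (Submodule.equivMapOfInjective Φ hΦ _)).symm

theorem span_homog_eq_top_iff :
    Submodule.span ℝ (range fun i => homog (u i)) = ⊤ ↔
      finrank ℝ (Submodule.span ℝ (range fun i => homog (u i))) = d + 1 := by
  have hV : finrank ℝ ((Fin d → ℝ) × ℝ) = d + 1 := by simp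
  refine ⟨fun h => by rw [h, finrank_top, hV], fun h => ?_⟩
  exact Submodule.eq_top_of_finrank_eq (h.trans hV.symm)

end AffineCoordinates

section Simplicial

variable {N : ℕ} {ι : Type*} [Finite ι] {v : ι → Fin N → ℝ}

theorem IsSimplicial.exists_linearIndepOn (hs : IsSimplicial (convexHull ℝ (range v)))
    (hv : ∀ i, {i} ∈ faceSets fun i => homog (v i)) {I : Set ι}
    (hI : I ∈ faceSets fun i => homog (v i)) (hIu : I ≠ univ) :
    ∃ J ∈ faceSets fun i => homog (v i), I ⊆ J ∧ LinearIndepOn ℝ (fun i => homog (v i)) J := by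
  obtain ⟨g, hg, rfl⟩ := hI
  obtain ⟨i₀, hi₀⟩ := (ne_univ_iff_exists_notMem _).mp hIu
  have hpos : 0 < g (homog (v i₀)) := (hg i₀).lt_of_ne' hi₀
  obtain ⟨f, hf, hgf, -⟩ := exists_isFacetFunctional (fun i => homog (v i))
    (x := -homog (v i₀)) (neg_mem (Submodule.subset_span ⟨i₀, rfl⟩)) g hg (by simpa using hpos)
  have hJ : {i | f (homog (v i)) = 0} ∈ faceSets fun i => homog (v i) := ⟨f, hf.1, rfl⟩
  refine ⟨_, hJ, hgf, ?_⟩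
  set J := {i | f (homog (v i)) = 0}
  obtain ⟨S, hSind, hS⟩ := hs _ ((isFacetOf_iff_finrank hJ).mpr hf.2)
  have hmem : ∀ j : J, v j ∈ S := by
    intro j
    have h1 := (isFaceOf_convexHull_image (hv j)).1
    rw [image_singleton, convexHull_singleton] at h1
    refine h1.mem_of_mem_convexHull (X := S) ?_ ?_
    · refine (subset_convexHull ℝ _).trans ?_
      rw [← hS]
      exact convexHull_mono (image_subset_range _ _)
    · rw [← hS]
      exact subset_convexHull ℝ _ ⟨j, j.2, rfl⟩
  have hinj : Function.Injective v := by
    intro i j hij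
    obtain ⟨g', -, hg'⟩ := hv i
    have h1 : i ∈ {k | g' (homog (v k)) = 0} := hg' ▸ mem_singleton i
    have h2 : j ∈ ({i} : Set ι) := by
      rw [hg']
      simpa [hij] using h1
    exact (mem_singleton_iff.mp h2).symm
  let φ : J ↪ {x // x ∈ S} := ⟨fun j => ⟨v j, hmem j⟩, fun i j hij =>
    Subtype.ext (hinj (congrArg Subtype.val hij))⟩
  exact linearIndependent_homog_iff.mpr (hSind.comp_embedding φ)

theorem isSimplicial_of_linearIndepOn (h : ∀ I ∈ faceSets fun i => homog (v i), I ≠ univ →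
    LinearIndepOn ℝ (fun i => homog (v i)) I) : IsSimplicial (convexHull ℝ (range v)) := by
  intro F hF
  obtain ⟨hI, hFI⟩ := hF.1.mem_faceSets
  set I := {i | v i ∈ F}
  have hIu : I ≠ univ := by
    intro hu
    have := hF.2
    rw [← hFI, hu, image_univ] at this
    omega
  have hli : AffineIndependent ℝ fun i : I => v i := linearIndependent_homog_iff.mp (h I hI hIu)
  have hfin : (v '' I).Finite := toFinite _
  refine ⟨hfin.toFinset, ?_, by rw [hfin.coe_toFinset, hFI]⟩
  refine hli.range.comp_embedding (⟨fun x => ⟨x.1, ?_⟩, fun x y hxy => ?_⟩ :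
    {x // x ∈ hfin.toFinset} ↪ range fun i : I => v i)
  · obtain ⟨i, hi, hx⟩ := hfin.mem_toFinset.mp x.2
    exact ⟨⟨i, hi⟩, hx⟩
  · have h1 : (x : Fin N → ℝ) = y := congrArg (fun z : range fun i : I => v i => z.1) hxy
    exact Subtype.ext h1

end Simplicial

theorem hausdorffDist_convexHull_range_le {N : ℕ} {ι : Type*} {v v' : ι → Fin N → ℝ} {r : ℝ}
    (hr : 0 ≤ r) (h : ∀ i, dist (v i) (v' i) ≤ r) :
    Metric.hausdorffDist (convexHull ℝ (range v)) (convexHull ℝ (range v')) ≤ r := by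
  have key : ∀ a b : ι → Fin N → ℝ, (∀ i, dist (a i) (b i) ≤ r) →
      ∀ x ∈ convexHull ℝ (range a), Metric.infDist x (convexHull ℝ (range b)) ≤ r := by
    intro a b hab x hx
    have hsub : convexHull ℝ (range a) ⊆ Metric.cthickening r (convexHull ℝ (range b)) := by
      refine convexHull_min ?_ ((convex_convexHull ℝ _).cthickening r)
      rintro _ ⟨i, rfl⟩
      exact Metric.mem_cthickening_of_dist_le _ _ _ _ (subset_convexHull ℝ _ ⟨i, rfl⟩) (hab i)
    exact ENNReal.toReal_le_of_le_ofReal hr (Metric.mem_cthickening_iff.mp (hsub hx))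
  exact Metric.hausdorffDist_le_of_infDist hr (key v v' h)
    (key v' v fun i => by rw [dist_comm]; exact h i)

section Approximation

theorem eventually_linearIndepOn {V ι : Type*} [NormedAddCommGroup V] [NormedSpace ℝ V]
    [Finite ι] (w : ι → V) :
    ∀ᶠ w' in 𝓝 w, ∀ J : Set ι, LinearIndepOn ℝ w J → LinearIndepOn ℝ w' J := by
  refine eventually_all.mpr fun J => ?_
  by_cases hJ : LinearIndepOn ℝ w J
  · have hcont : Continuous fun (w' : ι → V) (j : J) => w' j := by fun_prop
    have hopen := (isOpen_setOfPred_linearIndependent (𝕜 := ℝ) (E := V) (ι := J)).preimage hcont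
    filter_upwards [hopen.mem_nhds hJ] with w' hw' _ using hw'
  · exact Eventually.of_forall fun _ h => absurd h hJ

theorem span_range_eq_top_of_linearIndepOn {V ι : Type*} [AddCommGroup V] [Module ℝ V]
    [FiniteDimensional ℝ V] [Finite ι] {w w' : ι → V} (hw : Submodule.span ℝ (range w) = ⊤)
    (h : ∀ J : Set ι, LinearIndepOn ℝ w J → LinearIndepOn ℝ w' J) :
    Submodule.span ℝ (range w') = ⊤ := by
  obtain ⟨J, -, -, hspan, hJ⟩ := exists_linearIndepOn_extension
    (linearIndepOn_empty ℝ w) (empty_subset univ)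
  have := Fintype.ofFinite J
  have htop : Submodule.span ℝ (range fun j : J => w j) = ⊤ := by
    rw [image_univ] at hspan
    rw [eq_top_iff, ← hw, ← image_eq_range]
    exact Submodule.span_le.mpr hspan
  have hcard : Fintype.card J = finrank ℝ V := by
    rw [← finrank_span_eq_card hJ, htop, finrank_top]
  have h' : Submodule.span ℝ (range fun j : J => w' j) = ⊤ :=
    (h J hJ).span_eq_top_of_card_eq_finrank' hcard
  rw [eq_top_iff, ← h']
  exact Submodule.span_mono (range_subset_iff.mpr fun j => ⟨j, rfl⟩)

/-- Near a tuple of real points there is a tuple of rational points outside the zero set of a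
given nonzero polynomial. -/
theorem exists_rat_dist_lt_eval_ne_zero {m k : ℕ} {R : MvPolynomial (Fin m × Fin k) ℝ}
    (hR : R ≠ 0) (x : Fin m → Fin k → ℝ) {δ : ℝ} (hδ : 0 < δ) :
    ∃ q : Fin m → Fin k → ℚ, dist (fun i j => (q i j : ℝ)) x < δ ∧
      MvPolynomial.eval (fun t => (q t.1 t.2 : ℝ)) R ≠ 0 := by
  obtain ⟨q, hq, hqR⟩ := exists_rat_eval_ne_zero hR (fun t => x t.1 t.2) hδ
  refine ⟨fun i j => q (i, j), ?_, hqR⟩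
  exact (dist_pi_lt_iff hδ).mpr fun i => (dist_pi_lt_iff hδ).mpr fun j => hq (i, j)

end Approximation

theorem exists_isPolytope_xc_le {N : ℕ} {P : Set (Fin N → ℝ)} (hP : IsPolytope P) :
    ∃ (e : ℕ) (Q : Set (Fin e → ℝ)) (π : (Fin e → ℝ) →ᵃ[ℝ] (Fin N → ℝ)),
      IsPolytope Q ∧ π '' Q = P ∧ facetCount Q = xc P :=
  Nat.sInf_mem (s := {n | ∃ (e : ℕ) (Q : Set (Fin e → ℝ)) (π : (Fin e → ℝ) →ᵃ[ℝ] (Fin N → ℝ)),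
    IsPolytope Q ∧ π '' Q = P ∧ facetCount Q = n})
    ⟨facetCount P, N, P, AffineMap.id ℝ _, hP, by simp, rfl⟩

theorem exists_forall_dist_lt_frameMap {N d n : ℕ} {p : Fin N → ℝ} {b : Fin d → Fin N → ℝ}
    {u : Fin n → Fin d → ℝ} (hb : LinearIndependent ℝ b)
    (hspan : Submodule.span ℝ (range fun i => homog (u i)) = ⊤)
    (hs : ∀ I ∈ faceSets fun i => homog (u i), I ≠ univ →
      ∃ J ∈ faceSets fun i => homog (u i), I ⊆ J ∧ LinearIndepOn ℝ (fun i => homog (u i)) J)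
    {r : ℝ} (hr : 0 < r) :
    ∃ δ > 0, ∀ (u' : Fin n → Fin d → ℝ) (p' : Fin N → ℝ) (b' : Fin d → Fin N → ℝ),
      dist u' u < δ → dist p' p < δ → dist b' b < δ →
        (faceSets fun i => homog (u' i)) = (faceSets fun i => homog (u i)) ∧
        (∀ J : Set (Fin n), LinearIndepOn ℝ (fun i => homog (u i)) J →
          LinearIndepOn ℝ (fun i => homog (u' i)) J) ∧
        LinearIndependent ℝ b' ∧
        ∀ i, dist (frameMap p b (u i)) (frameMap p' b' (u' i)) < r := by
  have hhomog : Continuous fun (u' : Fin n → Fin d → ℝ) i => homog (u' i) := by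
    unfold homog
    fun_prop
  have h1 := (hhomog.tendsto u).eventually (eventually_faceSets_eq hspan hs)
  have h2 := (hhomog.tendsto u).eventually
    (eventually_linearIndepOn fun i => homog (u i))
  have h3 : ∀ᶠ b' in 𝓝 b, LinearIndependent ℝ b' :=
    (isOpen_setOfPred_linearIndependent (𝕜 := ℝ) (ι := Fin d)).mem_nhds hb
  have h4 : ∀ᶠ z : (Fin n → Fin d → ℝ) × (Fin N → ℝ) × (Fin d → Fin N → ℝ) in 𝓝 (u, p, b),
      ∀ i, dist (frameMap p b (u i)) (frameMap z.2.1 z.2.2 (z.1 i)) < r := by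
    refine eventually_all.mpr fun i => ?_
    have hc : Continuous fun z : (Fin n → Fin d → ℝ) × (Fin N → ℝ) × (Fin d → Fin N → ℝ) =>
        dist (frameMap p b (u i)) (frameMap z.2.1 z.2.2 (z.1 i)) := by
      unfold frameMap
      fun_prop
    exact hc.continuousAt.eventually_lt continuousAt_const (by simpa using hr)
  have hall := ((continuous_fst.tendsto (u, p, b)).eventually (h1.and h2)).and
    (((continuous_snd.comp continuous_snd).tendsto (u, p, b)).eventually h3 |>.and h4)
  obtain ⟨δ, hδ, h⟩ := Metric.eventually_nhds_iff.mp hall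
  refine ⟨δ, hδ, fun u' p' b' hu' hp' hb' => ?_⟩
  obtain ⟨⟨ha, hc⟩, hd, he⟩ := @h (u', p', b') (max_lt hu' (max_lt hp' hb'))
  exact ⟨ha, hc, hd, he⟩

end

theorem generic_simplicial_lower_bound (N d n : ℕ) (P : Set (Fin N → ℝ))
    (hP : IsPolytope P) (hdP : pdim P = d) (hsimp : IsSimplicial P)
    (hn : vertexCount P = n) (ε : ℝ) (hε : 0 < ε) :
    ∃ P' : Set (Fin N → ℝ),
      IsPolytope P' ∧ pdim P' = d ∧ IsSimplicial P' ∧ CombEquiv P' P ∧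
      (∀ v ∈ vertexSet P', ∀ i : Fin N, ∃ q : ℚ, v i = (q : ℝ)) ∧
      Metric.hausdorffDist P P' < ε ∧
      2 * Real.sqrt ((d : ℝ) * n - d) - d + 1 ≤ (xc P' : ℝ) := by
  obtain ⟨v, hPv, hv⟩ := hP.exists_vertex_enumeration
  generalize vertexCount P = m at v hn hPv hv
  subst hn hPv
  have hne : (convexHull ℝ (range v)).Nonempty := by
    by_contra hempty
    rw [pdim, if_neg hempty] at hdP
    omega
  obtain ⟨_, i₀, -⟩ := convexHull_nonempty_iff.mp hne
  have : Nonempty (Fin m) := ⟨i₀⟩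
  obtain ⟨p, b, u, hb, hvu⟩ := exists_frameMap_eq v hdP
  obtain rfl : v = fun i => frameMap p b (u i) := funext hvu
  have hspan : Submodule.span ℝ (range fun i => homog (u i)) = ⊤ := by
    rw [span_homog_eq_top_iff]
    have := pdim_convexHull_frameMap (p := p) u hb
    omega
  have hfaces := faceSets_homog_frameMap (p := p) u hb
  have hs : ∀ I ∈ faceSets fun i => homog (u i), I ≠ univ →
      ∃ J ∈ faceSets fun i => homog (u i), I ⊆ J ∧
        LinearIndepOn ℝ (fun i => homog (u i)) J := by
    intro I hI hIu
    obtain ⟨J, hJ, hIJ, hJli⟩ := hsimp.exists_linearIndepOn hv (hfaces ▸ hI) hIu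
    exact ⟨J, hfaces ▸ hJ, hIJ, (linearIndepOn_homog_frameMap_iff u hb).mp hJli⟩
  obtain ⟨R, hR, hbound⟩ := exists_generic_lower_bound d i₀.pos
  obtain ⟨δ, hδ, hnear⟩ := exists_forall_dist_lt_frameMap (p := p) hb hspan hs (half_pos hε)
  obtain ⟨u', hu', hRu'⟩ := exists_rat_dist_lt_eval_ne_zero hR u hδ
  obtain ⟨p', hp', -⟩ := exists_rat_dist_lt_eval_ne_zero (m := 1) one_ne_zero (fun _ => p) hδ
  obtain ⟨b', hb', -⟩ := exists_rat_dist_lt_eval_ne_zero one_ne_zero b hδ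
  obtain ⟨hfaces', hli, hbli, hdist⟩ := hnear _ _ _ hu'
    ((dist_le_pi_dist _ _ (0 : Fin 1)).trans_lt hp') hb'
  set U : Fin m → Fin d → ℝ := fun i j => (u' i j : ℝ) with hU
  set p₁ : Fin N → ℝ := fun j => (p' 0 j : ℝ) with hp₁
  set b₁ : Fin d → Fin N → ℝ := fun i j => (b' i j : ℝ) with hb₁
  have hfaces₁ := faceSets_homog_frameMap (p := p₁) U hbli
  have hpoly : IsPolytope (convexHull ℝ (range fun i => frameMap p₁ b₁ (U i))) :=
    ⟨(finite_range _).toFinset, by rw [Finite.coe_toFinset]⟩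
  refine ⟨convexHull ℝ (range fun i => frameMap p₁ b₁ (U i)), hpoly, ?_, ?_, ?_, ?_, ?_, ?_⟩
  · have h1 := (span_homog_eq_top_iff U).mp (span_range_eq_top_of_linearIndepOn hspan hli)
    have h2 := pdim_convexHull_frameMap (p := p₁) U hbli
    omega
  · refine isSimplicial_of_linearIndepOn fun I hI hIu => ?_
    rw [hfaces₁, hfaces'] at hI
    obtain ⟨J, -, hIJ, hJ⟩ := hs I hI hIu
    exact (linearIndepOn_homog_frameMap_iff U hbli).mpr ((hli J hJ).mono hIJ)
  · exact combEquiv_of_faceSets_eq (hfaces₁.trans (hfaces'.trans hfaces.symm))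
  · intro x hx k
    obtain ⟨i, rfl⟩ := vertexSet_convexHull_subset _ hx
    exact ⟨p' 0 k + ∑ j, u' i j * b' j k, by simp [frameMap, hU, hp₁, hb₁]⟩
  · exact (hausdorffDist_convexHull_range_le (half_pos hε).le fun i => (hdist i).le).trans_lt
      (half_lt_self hε)
  · obtain ⟨e, Q, π, hQ, hπ, hxc⟩ := exists_isPolytope_xc_le hpoly
    obtain ⟨ψ, hψ⟩ := exists_frameMap_leftInverse p₁ hbli
    rw [← hxc]
    refine hbound U (fun i => ?_) hRu' e Q (ψ.comp π) hQ ?_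
    · rw [hfaces', ← hfaces]
      exact hv i
    · rw [AffineMap.coe_comp, image_comp, hπ, AffineMap.image_convexHull, ← range_comp]
      exact congrArg (fun f => convexHull ℝ (range f)) (funext fun i => hψ (U i))

end
end
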